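/- Let p and q be primes satisfying conditions (1) or conditions (2), and let m be the natural number such that 2^m is the order of the 2-Sylow subgroup of the ideal class group of Q(√(-2q)). Then the 2-class group of the multiquadratic field L*_pq = Q(√2, √p, √q, i) (of degree 16 over Q) is cyclic of order 2^m, i.e. isomorphic to Z/2^m Z. -/

import Mathlib

noncomputable section

open IntermediateField NumberField

/-- Conditions (1). -/
def Cond1 (p q : ℕ) : Prop :=
  p.Prime ∧ q.Prime ∧ p % 4 = 1 ∧ q % 4 = 3 ∧
    jacobiSym 2 p = -1 ∧ jacobiSym 2 q = 1 ∧ jacobiSym (p : ℤ) q = -1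

/-- Conditions (2). -/
def Cond2 (p q : ℕ) : Prop :=
  p.Prime ∧ q.Prime ∧ p % 4 = 3 ∧ q % 4 = 3 ∧
    jacobiSym 2 p = -1 ∧ jacobiSym 2 q = 1 ∧ jacobiSym (p : ℤ) q = -1

/-- The imaginary quadratic field `ℚ(√(-2q))` as a subfield of `ℂ`,
where `√(-2q) = i√(2q)`. -/
def k0 (q : ℕ) : IntermediateField ℚ ℂ :=
  adjoin ℚ {Complex.I * ((Real.sqrt (2 * q) : ℝ) : ℂ)}

/-- The multiquadratic field `L*_pq = ℚ(√2, √p, √q, i)` as a subfield of `ℂ`. -/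
def Lstar (p q : ℕ) : IntermediateField ℚ ℂ :=
  adjoin ℚ {((Real.sqrt 2 : ℝ) : ℂ), ((Real.sqrt p : ℝ) : ℂ), ((Real.sqrt q : ℝ) : ℂ),
    Complex.I}

set_option linter.unusedSectionVars false

section AmbiguousClasses

variable {X I : Type*} [CommGroup X] [CommGroup I]

/-- The homomorphism `x ↦ s x / x`. -/
def involDiff (s : X →* X) : X →* X := s / MonoidHom.id X

/-- The homomorphism `x ↦ x * s x`. -/
def involNorm (s : X →* X) : X →* X := MonoidHom.id X * s

@[simp] lemma involDiff_apply (s : X →* X) (x : X) : involDiff s x = s x / x := rfl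

@[simp] lemma involNorm_apply (s : X →* X) (x : X) : involNorm s x = x * s x := rfl

lemma relIndex_map_of_ker_le (f : X →* I) {H K : Subgroup X} (hK : f.ker ≤ K) :
    (H.map f).relIndex (K.map f) = (H ⊔ f.ker).relIndex K := by
  rw [Subgroup.relIndex_map_map, sup_eq_left.2 hK]

/-- The abstract form of the ambiguous class number formula for an involution. -/
theorem abstract_ambiguous_formula (s : X →* X) (hs : ∀ x, s (s x) = x) (t : I →* I)
    (ht : ∀ a, t (t a) = a) (d : X →* I) (hd : ∀ x, d (s x) = t (d x))
    (hX : ∀ x, x * s x = 1 → ∃ y, s y / y = x)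
    (hI : ∀ a, a * t a = 1 → ∃ b, t b / b = a) :
    d.range.relIndex (d.range.comap (involDiff t)) *
      (d.ker ⊓ (involNorm s).range).relIndex (d.ker ⊓ (involDiff s).ker) *
      ((d.ker ⊓ (involNorm s).ker).map (powMonoidHom 2)).relIndex (d.ker ⊓ (involNorm s).ker) =
    ((d.ker ⊓ (involDiff s).ker).map (powMonoidHom 2)).relIndex (d.ker ⊓ (involDiff s).ker) *
      ((involDiff s).ker.map d).relIndex (involDiff t).ker := by
  set E := d.ker
  set N := involNorm s
  set D := involDiff s
  set DI := involDiff t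
  have hdD : ∀ x, d (D x) = DI (d x) := by intro x; simp [D, DI, hd]
  have hrD : D.range = N.ker := by
    ext x
    constructor
    · rintro ⟨y, rfl⟩
      simp [D, N, MonoidHom.mem_ker, hs]
    · intro hx
      exact hX x hx
  have hrDI : DI.range = (involNorm t).ker := by
    ext x
    constructor
    · rintro ⟨y, rfl⟩
      simp [DI, MonoidHom.mem_ker, ht]
    · intro hx
      exact hI x hx
  have hND : ∀ x ∈ N.range, x ∈ D.ker := by
    rintro _ ⟨y, rfl⟩
    simp [D, N, MonoidHom.mem_ker, hs, mul_comm]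
  -- the part of ambiguous classes without ambiguous ideals
  have ha : (DI.ker ⊔ d.range).relIndex (d.range.comap DI) =
      (E.map N).relIndex (E ⊓ N.range) := by
    have h1 : (d.range.comap DI).map DI = (E.comap N).map d := by
      ext a
      constructor
      · rintro ⟨b, ⟨x, hx⟩, rfl⟩
        refine ⟨x, ?_, hx⟩
        change d (x * s x) = 1
        rw [map_mul, hd, hx]
        simp [DI, ht]
      · rintro ⟨x, hx, rfl⟩
        obtain ⟨b, hb⟩ := hI (d x) (by
          have : d (x * s x) = 1 := hx
          rwa [map_mul, hd] at this)
        exact ⟨b, ⟨x, hb.symm⟩, hb⟩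
    have h2 : d.range.map DI = D.range.map d := by
      rw [MonoidHom.map_range, MonoidHom.map_range]
      congr 1
      ext x
      exact (hdD x).symm
    have hle : DI.ker ≤ d.range.comap DI := by
      intro a ha
      exact ⟨1, by rw [map_one]; exact ha.symm⟩
    have hle2 : E ≤ E.comap N := by
      intro x hx
      change d (x * s x) = 1
      have : d x = 1 := hx
      simp [hd, this]
    have hle3 : N.ker ≤ E.comap N := by
      intro x hx
      have : N x = 1 := hx
      change N x ∈ E
      rw [this]
      exact E.one_mem
    have h3 : (E.comap N).map N = E ⊓ N.range := by
      rw [Subgroup.map_comap_eq, inf_comm]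
    rw [sup_comm, ← relIndex_map_of_ker_le DI hle, h1, h2, relIndex_map_of_ker_le d hle2, hrD,
      sup_comm, ← relIndex_map_of_ker_le N hle3, h3]
  have hb : ((D.ker).map d).relIndex (d.range ⊓ DI.ker) = (E.map D).relIndex (E ⊓ N.ker) := by
    have h1 : d.range ⊓ DI.ker = (E.comap D).map d := by
      ext a
      constructor
      · rintro ⟨⟨x, rfl⟩, hx⟩
        refine ⟨x, ?_, rfl⟩
        change d (D x) = 1
        rw [hdD]; exact hx
      · rintro ⟨x, hx, rfl⟩
        refine ⟨⟨x, rfl⟩, ?_⟩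
        have : d (D x) = 1 := hx
        rw [hdD] at this
        exact this
    have hle2 : E ≤ E.comap D := by
      intro x hx
      change d (D x) = 1
      have : d x = 1 := hx
      rw [hdD, this, map_one]
    have hle3 : D.ker ≤ E.comap D := by
      intro x hx
      have : D x = 1 := hx
      change D x ∈ E
      rw [this]
      exact E.one_mem
    rw [h1, relIndex_map_of_ker_le d hle2, sup_comm, ← relIndex_map_of_ker_le D hle3,
      Subgroup.map_comap_eq, hrD, inf_comm]
  -- the Herbrand quotient
  have hmem : ∀ x ∈ E, s x ∈ E := by
    intro x hx
    have h : d x = 1 := hx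
    change d (s x) = 1
    rw [hd, h, map_one]
  have hNE : E.map N ≤ E ⊓ N.range := by
    rintro _ ⟨x, hx, rfl⟩
    exact ⟨E.mul_mem hx (hmem x hx), x, rfl⟩
  have hNE' : E ⊓ N.range ≤ E ⊓ D.ker := fun x hx => ⟨hx.1, hND x hx.2⟩
  have hDE : E.map D ≤ E ⊓ N.ker := by
    rintro _ ⟨x, hx, rfl⟩
    exact ⟨E.div_mem (hmem x hx) hx, by rw [SetLike.mem_coe, ← hrD]; exact ⟨x, rfl⟩⟩
  have hp : (E ⊓ D.ker).map (powMonoidHom 2) = (E ⊓ D.ker).map N := by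
    ext y
    have : ∀ x ∈ E ⊓ D.ker, N x = x ^ 2 := by
      rintro x ⟨-, hx⟩
      have : s x / x = 1 := hx
      simp [N, div_eq_one.1 this, pow_two]
    constructor
    · rintro ⟨x, hx, rfl⟩
      exact ⟨x, hx, this x hx⟩
    · rintro ⟨x, hx, rfl⟩
      exact ⟨x, hx, (this x hx).symm⟩
  have hm : (E ⊓ N.ker).map (powMonoidHom 2) = (E ⊓ N.ker).map D := by
    ext y
    have : ∀ x ∈ E ⊓ N.ker, D x⁻¹ = x ^ 2 := by
      rintro x ⟨-, hx⟩
      have : x * s x = 1 := hx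
      simp [D, eq_inv_of_mul_eq_one_right this, pow_two]
    constructor
    · rintro ⟨x, hx, rfl⟩
      exact ⟨x⁻¹, inv_mem hx, this x hx⟩
    · rintro ⟨x, hx, rfl⟩
      exact ⟨x⁻¹, inv_mem hx, by
        have := this x⁻¹ (inv_mem hx)
        rw [inv_inv] at this
        exact this.symm⟩
  have relIdx : ∀ (f : X →* X) (A : Subgroup X), A ≤ E →
      (A.map f).relIndex (E.map f) = (A ⊔ (E ⊓ f.ker)).relIndex E := by
    intro f A hA
    have h1 : E ⊓ (A ⊔ f.ker) = A ⊔ (E ⊓ f.ker) := by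
      rw [inf_comm, sup_inf_assoc_of_le _ hA, inf_comm]
    have h2 : E ⊔ f.ker = E ⊔ (A ⊔ f.ker) := by
      rw [← sup_assoc, sup_eq_left.2 hA]
    rw [Subgroup.relIndex_map_map, ← h1, Subgroup.inf_relIndex_left, h2,
      Subgroup.relIndex_sup_right]
  have hkey : ((E ⊓ D.ker).map N).relIndex (E.map N) = ((E ⊓ N.ker).map D).relIndex (E.map D) := by
    rw [relIdx N _ inf_le_left, relIdx D _ inf_le_left, sup_comm]
  have e1 := Subgroup.relIndex_mul_relIndex _ _ _ hNE hNE'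
  have e2 := Subgroup.relIndex_mul_relIndex ((E ⊓ D.ker).map N) (E.map N) (E ⊓ D.ker)
    (Subgroup.map_mono inf_le_left) (hNE.trans hNE')
  have e3 := Subgroup.relIndex_mul_relIndex ((E ⊓ N.ker).map D) (E.map D) (E ⊓ N.ker)
    (Subgroup.map_mono inf_le_left) hDE
  have e4 := Subgroup.relIndex_mul_relIndex ((D.ker).map d) (d.range ⊓ DI.ker) DI.ker
    (by
      rintro _ ⟨x, hx, rfl⟩
      refine ⟨⟨x, rfl⟩, ?_⟩
      have : D x = 1 := hx
      change DI (d x) = 1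
      rw [← hdD, this, map_one]) inf_le_right
  have e5 := Subgroup.relIndex_mul_relIndex d.range (DI.ker ⊔ d.range) (d.range.comap DI)
    le_sup_right (by
      refine sup_le ?_ ?_
      · intro a ha
        exact ⟨1, by rw [map_one]; exact ha.symm⟩
      · rintro _ ⟨x, rfl⟩
        exact ⟨D x, hdD x⟩)
  have e6 : d.range.relIndex (DI.ker ⊔ d.range) = (d.range ⊓ DI.ker).relIndex DI.ker := by
    rw [Subgroup.inf_relIndex_right, sup_comm, Subgroup.relIndex_sup_left]
  rw [hp, hm, ← e2, ← e3, ← e4, ← e5, e6, ha, hb, hkey, ← e1]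
  ring

end AmbiguousClasses

section DoublingIndex

open Module

lemma index_range_nsmul_two_mul_card_ker_of_finite (T : Type*) [AddCommGroup T] [Finite T] :
    (nsmulAddMonoidHom 2 : T →+ T).range.index =
      Nat.card (nsmulAddMonoidHom 2 : T →+ T).ker := by
  have h1 := AddSubgroup.card_mul_index (nsmulAddMonoidHom 2 : T →+ T).range
  have h2 := AddSubgroup.card_mul_index (nsmulAddMonoidHom 2 : T →+ T).ker
  rw [AddSubgroup.index_ker, ← h1, mul_comm] at h2
  exact (Nat.eq_of_mul_eq_mul_left Nat.card_pos h2).symm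

lemma index_range_nsmul_two_int_pi (n : ℕ) :
    (nsmulAddMonoidHom 2 : (Fin n →₀ ℤ) →+ (Fin n →₀ ℤ)).range.index = 2 ^ n := by
  let f : (Fin n →₀ ℤ) →+ (Fin n → ZMod 2) :=
    { toFun := fun v i => (v i : ZMod 2)
      map_zero' := by ext; simp
      map_add' := by intros; ext; simp }
  have hf : f.ker = (nsmulAddMonoidHom 2 : (Fin n →₀ ℤ) →+ (Fin n →₀ ℤ)).range := by
    ext v
    constructor
    · intro hv
      have h : ∀ i, (2 : ℤ) ∣ v i := by
        intro i
        have : ((v i : ℤ) : ZMod 2) = 0 := congrFun hv i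
        exact (ZMod.intCast_zmod_eq_zero_iff_dvd _ 2).1 this
      refine ⟨Finsupp.equivFunOnFinite.symm fun i => v i / 2, ?_⟩
      ext i
      have := h i
      simp
      omega
    · rintro ⟨w, rfl⟩
      change f _ = 0
      ext i
      simp [f, CharTwo.two_eq_zero]
  have hsurj : f.range = ⊤ := by
    rw [AddMonoidHom.range_eq_top]
    intro w
    refine ⟨Finsupp.equivFunOnFinite.symm fun i => ((w i).val : ℤ), ?_⟩
    ext i
    simp [f]
  rw [← hf, AddSubgroup.index_ker, hsurj]
  simp

lemma index_range_nsmul_two_of_equiv {M T : Type*} [AddCommGroup M] [AddCommGroup T] [Finite T]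
    {n : ℕ} (φ : M ≃+ (Fin n →₀ ℤ) × T) :
    (nsmulAddMonoidHom 2 : M →+ M).range.index =
      2 ^ finrank ℤ M * Nat.card (nsmulAddMonoidHom 2 : M →+ M).ker := by
  have h1 : (nsmulAddMonoidHom 2 : M →+ M).range.map (φ : M →+ (Fin n →₀ ℤ) × T) =
      (nsmulAddMonoidHom 2 : (Fin n →₀ ℤ) →+ (Fin n →₀ ℤ)).range.prod
        (nsmulAddMonoidHom 2 : T →+ T).range := by
    ext ⟨x, y⟩
    constructor
    · rintro ⟨_, ⟨z, rfl⟩, h⟩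
      obtain ⟨rfl, rfl⟩ : 2 • (φ z).1 = x ∧ 2 • (φ z).2 = y := by
        simpa [Prod.ext_iff] using h
      exact ⟨⟨_, rfl⟩, ⟨_, rfl⟩⟩
    · rintro ⟨⟨x, rfl⟩, ⟨y, rfl⟩⟩
      refine ⟨_, ⟨φ.symm (x, y), rfl⟩, ?_⟩
      simp
  have h2 : Nat.card (nsmulAddMonoidHom 2 : M →+ M).ker =
      Nat.card (nsmulAddMonoidHom 2 : T →+ T).ker := by
    refine Nat.card_congr ⟨fun z => ⟨(φ z.1).2, ?_⟩, fun y => ⟨φ.symm (0, y.1), ?_⟩, ?_, ?_⟩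
    · have := z.2
      rw [AddMonoidHom.mem_ker, nsmulAddMonoidHom_apply] at this ⊢
      rw [← Prod.smul_snd, ← map_nsmul, this]
      simp
    · have := y.2
      rw [AddMonoidHom.mem_ker, nsmulAddMonoidHom_apply] at this ⊢
      rw [← map_nsmul, Prod.smul_mk, this]
      simp
    · intro z
      have := z.2
      rw [AddMonoidHom.mem_ker, nsmulAddMonoidHom_apply] at this
      have h0 : (φ z.1).1 = 0 := by
        have h3 : 2 • (φ z.1).1 = 0 := by rw [← Prod.smul_fst, ← map_nsmul, this]; simp
        simpa using h3
      ext
      simp only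
      rw [AddEquiv.symm_apply_eq, ← h0]
    · intro y
      ext
      simp
  have h3 : finrank ℤ M = n := by
    rw [φ.toIntLinearEquiv.finrank_eq]
    have hfin : Module.Finite ℤ T := Module.Finite.of_finite
    have h4 := Submodule.finrank_quotient_add_finrank
      (LinearMap.ker (LinearMap.fst ℤ (Fin n →₀ ℤ) T))
    rw [(LinearMap.quotKerEquivOfSurjective (LinearMap.fst ℤ (Fin n →₀ ℤ) T)
      Prod.fst_surjective).finrank_eq] at h4
    have h5 : finrank ℤ (LinearMap.ker (LinearMap.fst ℤ (Fin n →₀ ℤ) T)) = 0 := by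
      refine Module.finrank_eq_zero_of_not_faithfulSMul fun hf => ?_
      have := hf.eq_of_smul_eq_smul (m₁ := (Nat.card T : ℤ)) (m₂ := 0) fun x => by
        obtain ⟨⟨a, b⟩, hx⟩ := x
        obtain rfl : a = 0 := hx
        ext1
        change (Nat.card T : ℤ) • ((0 : Fin n →₀ ℤ), b) = (0 : ℤ) • (0, b)
        simp
      exact Nat.card_pos.ne' (Int.natCast_eq_zero.1 this)
    rw [← h4, h5]
    simp
  rw [h2, h3, ← AddSubgroup.index_map_equiv _ φ, ← index_range_nsmul_two_int_pi n,
    ← index_range_nsmul_two_mul_card_ker_of_finite, ← AddSubgroup.index_prod]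
  exact congrArg _ h1

theorem index_range_nsmul_two (M : Type*) [AddCommGroup M] [Module.Finite ℤ M] :
    (nsmulAddMonoidHom 2 : M →+ M).range.index =
      2 ^ finrank ℤ M * Nat.card (nsmulAddMonoidHom 2 : M →+ M).ker := by
  have : AddGroup.FG M := Module.Finite.iff_addGroup_fg.1 ‹_›
  obtain ⟨n, ι, _, p, hp, e, ⟨φ⟩⟩ := AddCommGroup.equiv_free_prod_directSum_zmod M
  have : ∀ i, NeZero (p i ^ e i) := fun i => ⟨pow_ne_zero _ (hp i).ne_zero⟩
  have : Finite (DirectSum ι fun i => ZMod (p i ^ e i)) :=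
    Finite.of_equiv _ (DirectSum.addEquivProd (fun i => ZMod (p i ^ e i))).symm.toEquiv
  exact index_range_nsmul_two_of_equiv φ

end DoublingIndex

section QuadraticPrimes

open Module

variable {K L : Type*} [Field K] [Field L] [NumberField K] [NumberField L] [Algebra K L]

/-- `σ` is the nontrivial automorphism of the quadratic extension `L / K`. -/
structure IsQuadInvol (σ : L ≃ₐ[K] L) : Prop where
  invol : ∀ y, σ (σ y) = y
  fixed : ∀ y, σ y = y → ∃ a, algebraMap K L a = y
  finrank_eq : finrank K L = 2

/-- The extension of ideals from `𝓞 K` to `𝓞 L`. -/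
abbrev extIdeal (L : Type*) [Field L] [NumberField L] [Algebra K L] (I : Ideal (𝓞 K)) :
    Ideal (𝓞 L) :=
  I.map (algebraMap (𝓞 K) (𝓞 L))

/-- The contraction of ideals from `𝓞 L` to `𝓞 K`. -/
abbrev conIdeal (K : Type*) [Field K] [NumberField K] [Algebra K L] (I : Ideal (𝓞 L)) :
    Ideal (𝓞 K) :=
  I.comap (algebraMap (𝓞 K) (𝓞 L))

/-- The action of an automorphism on ideals. -/
def conjIdeal (σ : L ≃ₐ[K] L) : Ideal (𝓞 L) →* Ideal (𝓞 L) :=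
  (Ideal.mapHom (RingOfIntegers.mapAlgEquiv σ : 𝓞 L →+* 𝓞 L) : Ideal (𝓞 L) →* Ideal (𝓞 L))

lemma conjIdeal_apply (σ : L ≃ₐ[K] L) (I : Ideal (𝓞 L)) :
    conjIdeal σ I = I.map (RingOfIntegers.mapAlgEquiv σ : 𝓞 L →+* 𝓞 L) := rfl

lemma conjIdeal_mono (σ : L ≃ₐ[K] L) {I J : Ideal (𝓞 L)} (h : I ≤ J) :
    conjIdeal σ I ≤ conjIdeal σ J := Ideal.map_mono h

lemma conjIdeal_ext (σ : L ≃ₐ[K] L) (I : Ideal (𝓞 K)) :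
    conjIdeal σ (extIdeal L I) = extIdeal L I := by
  rw [conjIdeal_apply, extIdeal, Ideal.map_map]
  congr 1
  ext x
  exact congrArg _ ((RingOfIntegers.mapAlgEquiv σ : 𝓞 L ≃ₐ[𝓞 K] 𝓞 L).commutes x)

lemma mem_conjIdeal (σ : L ≃ₐ[K] L) {x : 𝓞 L} {I : Ideal (𝓞 L)} :
    x ∈ I → (RingOfIntegers.mapAlgEquiv σ : 𝓞 L ≃ₐ[𝓞 K] 𝓞 L) x ∈ conjIdeal σ I :=
  fun h => Ideal.mem_map_of_mem _ h

namespace IsQuadInvol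

variable {σ : L ≃ₐ[K] L} (h : IsQuadInvol σ)
include h

lemma mapAlgEquiv_invol (x : 𝓞 L) : (RingOfIntegers.mapAlgEquiv σ : 𝓞 L ≃ₐ[𝓞 K] 𝓞 L)
    ((RingOfIntegers.mapAlgEquiv σ : 𝓞 L ≃ₐ[𝓞 K] 𝓞 L) x) = x := by
  ext
  exact h.invol x

lemma conjIdeal_conjIdeal (I : Ideal (𝓞 L)) : conjIdeal σ (conjIdeal σ I) = I := by
  rw [conjIdeal_apply, conjIdeal_apply, Ideal.map_map]
  convert Ideal.map_id I
  ext x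
  exact h.invol x

lemma conjIdeal_isPrime (P : Ideal (𝓞 L)) [P.IsPrime] : (conjIdeal σ P).IsPrime :=
  Ideal.map_isPrime_of_equiv (RingOfIntegers.mapAlgEquiv σ : 𝓞 L ≃ₐ[𝓞 K] 𝓞 L)

lemma conjIdeal_ne_bot {P : Ideal (𝓞 L)} (hP : P ≠ ⊥) : conjIdeal σ P ≠ ⊥ := by
  intro h0
  apply hP
  rw [← h.conjIdeal_conjIdeal P, h0, conjIdeal_apply, Ideal.map_bot]

lemma exists_of_fixed (x : 𝓞 L)
    (hx : (RingOfIntegers.mapAlgEquiv σ : 𝓞 L ≃ₐ[𝓞 K] 𝓞 L) x = x) :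
    ∃ a, algebraMap (𝓞 K) (𝓞 L) a = x := by
  obtain ⟨a, ha⟩ := h.fixed x (congrArg (algebraMap (𝓞 L) L) hx)
  have hai : IsIntegral ℤ a := by
    have : IsIntegral ℤ (algebraMap K L a) := ha ▸ x.2
    exact (isIntegral_algebraMap_iff (algebraMap K L).injective).1 this
  refine ⟨⟨a, hai⟩, ?_⟩
  ext
  exact ha

lemma conIdeal_conj (I : Ideal (𝓞 L)) : conIdeal K (conjIdeal σ I) = conIdeal K I := by
  have key : ∀ J : Ideal (𝓞 L), conIdeal K J ≤ conIdeal K (conjIdeal σ J) := by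
    intro J x hx
    have := mem_conjIdeal σ (I := J) hx
    rwa [AlgEquiv.commutes] at this
  apply le_antisymm _ (key I)
  have := key (conjIdeal σ I)
  rwa [h.conjIdeal_conjIdeal] at this

lemma absNorm_ext (I : Ideal (𝓞 K)) : (extIdeal L I).absNorm = I.absNorm ^ 2 := by
  rw [extIdeal, Ideal.absNorm_algebraMap, ← h.finrank_eq,
    IsFractionRing.finrank_eq (𝓞 K) K (𝓞 L) L]

omit h in
lemma absNorm_con_dvd (P : Ideal (𝓞 L)) : (conIdeal K P).absNorm ∣ P.absNorm := by
  rw [← Ideal.absNorm_relNorm (𝓞 K) (𝓞 L) P]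
  exact Ideal.absNorm_dvd_absNorm_of_le (Ideal.relNorm_le_comap (𝓞 K) P)

lemma conIdeal_ne_bot {P : Ideal (𝓞 L)} (hP : P ≠ ⊥) : conIdeal K P ≠ ⊥ := by
  intro h0
  have := absNorm_con_dvd (K := K) P
  rw [h0, Ideal.absNorm_bot, zero_dvd_iff, Ideal.absNorm_eq_zero_iff] at this
  exact hP this

lemma ext_con_eq_mul {P Q J : Ideal (𝓞 L)} (h0 : P ≠ ⊥) (hQ : conIdeal K Q = conIdeal K P)
    (hJ : extIdeal L (conIdeal K P) = P * Q * J) : extIdeal L (conIdeal K P) = P * Q := by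
  have h1 := congrArg Ideal.absNorm hJ
  rw [h.absNorm_ext, map_mul, map_mul] at h1
  have hc : 0 < (conIdeal K P).absNorm :=
    Nat.pos_of_ne_zero fun h2 => h.conIdeal_ne_bot h0 (Ideal.absNorm_eq_zero_iff.1 h2)
  have hpos : 0 < (conIdeal K P).absNorm ^ 2 := pow_pos hc 2
  have hP := absNorm_con_dvd (K := K) P
  have hQ' := absNorm_con_dvd (K := K) Q
  rw [hQ] at hQ'
  have h2 := mul_dvd_mul hP hQ'
  have h3 : J.absNorm ∣ 1 := by
    rw [h1] at hpos
    have h4 : P.absNorm * Q.absNorm * J.absNorm ∣ P.absNorm * Q.absNorm * 1 := by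
      rw [← h1, pow_two, mul_one]
      exact h2
    exact Nat.dvd_of_mul_dvd_mul_left (Nat.pos_of_mul_pos_right hpos) h4
  rw [hJ, Ideal.absNorm_eq_one_iff.1 (Nat.dvd_one.1 h3), Ideal.mul_top]

/-- The decomposition of primes in a quadratic extension. -/
theorem prime_trichotomy (P : Ideal (𝓞 L)) [hP : P.IsPrime] (h0 : P ≠ ⊥) :
    (conjIdeal σ P ≠ P ∧ extIdeal L (conIdeal K P) = P * conjIdeal σ P) ∨
      (conjIdeal σ P = P ∧
        (extIdeal L (conIdeal K P) = P ∨ extIdeal L (conIdeal K P) = P ^ 2)) := by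
  have hdvd : ∀ Q : Ideal (𝓞 L), conIdeal K Q = conIdeal K P →
      Q ∣ extIdeal L (conIdeal K P) := fun Q hQ =>
    Ideal.dvd_iff_le.2 (hQ ▸ Ideal.map_comap_le)
  have hmax : P.IsMaximal := hP.isMaximal h0
  by_cases hσ : conjIdeal σ P = P
  · refine .inr ⟨hσ, ?_⟩
    obtain ⟨J, hJ⟩ := hdvd P rfl
    by_cases hJ1 : J = ⊤
    · left
      rw [hJ, hJ1, Ideal.mul_top]
    right
    obtain ⟨Q, hQ, hJQ⟩ := Ideal.exists_le_maximal J hJ1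
    have hQP : conIdeal K Q = conIdeal K P := by
      have h1 : conIdeal K P ≤ conIdeal K Q := by
        rw [← Ideal.map_le_iff_le_comap]
        refine le_trans ?_ hJQ
        change extIdeal L (conIdeal K P) ≤ J
        rw [hJ]
        exact Ideal.mul_le_right
      have hp1 : (conIdeal K P).IsPrime := Ideal.IsPrime.comap _
      exact ((hp1.isMaximal (h.conIdeal_ne_bot h0)).eq_of_le
        (Ideal.IsPrime.comap (hK := hQ.isPrime) _).ne_top h1).symm
    have hQeq : Q = P := by
      by_contra hne
      have : ¬ Q ≤ P := fun hle => hne (hQ.eq_of_le hmax.ne_top hle)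
      obtain ⟨x, hxQ, hxP⟩ := SetLike.not_le_iff_exists.1 this
      set y := x * (RingOfIntegers.mapAlgEquiv σ : 𝓞 L ≃ₐ[𝓞 K] 𝓞 L) x with hy
      obtain ⟨a, ha⟩ := h.exists_of_fixed y (by
        rw [hy, map_mul, h.mapAlgEquiv_invol, mul_comm])
      have h1 : a ∈ conIdeal K Q := by
        change algebraMap _ _ a ∈ Q
        rw [ha, hy]
        exact Ideal.mul_mem_right _ _ hxQ
      rw [hQP] at h1
      change algebraMap _ _ a ∈ P at h1
      rw [ha, hy] at h1
      rcases hP.mem_or_mem h1 with h2 | h2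
      · exact hxP h2
      · apply hxP
        have := mem_conjIdeal σ h2
        rwa [h.mapAlgEquiv_invol, hσ] at this
    obtain ⟨J', hJ'⟩ := Ideal.dvd_iff_le.2 hJQ
    rw [pow_two]
    apply h.ext_con_eq_mul (J := J') h0 rfl
    rw [hJ, hJ', hQeq, mul_assoc]
  · left
    refine ⟨hσ, ?_⟩
    have hco : IsCoprime P (conjIdeal σ P) := by
      have := h.conjIdeal_isPrime P
      have hm : (conjIdeal σ P).IsMaximal := this.isMaximal (h.conjIdeal_ne_bot h0)
      rw [Ideal.isCoprime_iff_sup_eq]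
      exact Ideal.IsMaximal.coprime_of_ne hmax hm (Ne.symm hσ)
    obtain ⟨J, hJ⟩ := hco.mul_dvd (hdvd P rfl) (hdvd _ (h.conIdeal_conj P))
    exact h.ext_con_eq_mul h0 (h.conIdeal_conj P) hJ

end IsQuadInvol

end QuadraticPrimes

section QuadraticFractional

open Module FractionalIdeal nonZeroDivisors

variable {K L : Type*} [Field K] [Field L] [NumberField K] [NumberField L] [Algebra K L]

lemma map_nonZeroDivisors_le (σ : L ≃ₐ[K] L) : (𝓞 L)⁰ ≤ Submonoid.comap
    ((RingOfIntegers.mapAlgEquiv σ : 𝓞 L ≃ₐ[𝓞 K] 𝓞 L) : 𝓞 L →+* 𝓞 L) (𝓞 L)⁰ :=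
  nonZeroDivisors_le_comap_nonZeroDivisors_of_injective _
    (RingOfIntegers.mapAlgEquiv σ : 𝓞 L ≃ₐ[𝓞 K] 𝓞 L).injective

/-- The action of an automorphism on fractional ideals. -/
def conjFrac (σ : L ≃ₐ[K] L) : FractionalIdeal (𝓞 L)⁰ L →+* FractionalIdeal (𝓞 L)⁰ L :=
  extendedHom' L (map_nonZeroDivisors_le σ)

/-- The extension of fractional ideals from `K` to `L`. -/
def extFrac (K L : Type*) [Field K] [Field L] [NumberField K] [NumberField L] [Algebra K L] :
    FractionalIdeal (𝓞 K)⁰ K →+* FractionalIdeal (𝓞 L)⁰ L :=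
  extendedHom L (𝓞 L)

lemma localizationMap_eq (σ : L ≃ₐ[K] L) (x : L) :
    IsLocalization.map L ((RingOfIntegers.mapAlgEquiv σ : 𝓞 L ≃ₐ[𝓞 K] 𝓞 L) : 𝓞 L →+* 𝓞 L)
      (map_nonZeroDivisors_le σ) x = σ x := by
  have : (IsLocalization.map L ((RingOfIntegers.mapAlgEquiv σ : 𝓞 L ≃ₐ[𝓞 K] 𝓞 L) : 𝓞 L →+* 𝓞 L)
      (map_nonZeroDivisors_le σ) : L →+* L) = (σ : L →+* L) := by
    apply IsLocalization.ringHom_ext (𝓞 L)⁰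
    ext y
    simp only [RingHom.comp_apply, IsLocalization.map_eq]
    rfl
  exact congrArg (fun f : L →+* L => f x) this

lemma conjFrac_coe (σ : L ≃ₐ[K] L) (I : Ideal (𝓞 L)) :
    conjFrac σ (I : FractionalIdeal (𝓞 L)⁰ L) = (conjIdeal σ I : Ideal (𝓞 L)) :=
  extended_coeIdeal_eq_map L _ I

lemma conjFrac_spanSingleton (σ : L ≃ₐ[K] L) (x : L) :
    conjFrac σ (spanSingleton (𝓞 L)⁰ x) = spanSingleton (𝓞 L)⁰ (σ x) := by
  rw [conjFrac, extendedHom'_apply, extended_spanSingleton, localizationMap_eq]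

lemma extFrac_coe (I : Ideal (𝓞 K)) :
    extFrac K L (I : FractionalIdeal (𝓞 K)⁰ K) = (extIdeal L I : Ideal (𝓞 L)) :=
  extendedHom_coeIdeal_eq_map L (𝓞 L) I

lemma extFrac_spanSingleton (x : K) :
    extFrac K L (spanSingleton (𝓞 K)⁰ x) = spanSingleton (𝓞 L)⁰ (algebraMap K L x) := by
  rw [extFrac, extendedHom_spanSingleton]
  congr 1
  have : (IsFractionRing.map (FaithfulSMul.algebraMap_injective (𝓞 K) (𝓞 L)) : K →+* L)
      = algebraMap K L := by
    apply IsLocalization.ringHom_ext (𝓞 K)⁰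
    ext y
    simp only [RingHom.comp_apply, IsFractionRing.map, IsLocalization.map_eq]
    rfl
  exact congrArg (fun f : K →+* L => f x) this

lemma extFrac_injective : Function.Injective (extFrac K L) :=
  extendedHom_injective (𝓞 K) K L (𝓞 L)

lemma exists_frac_eq (I : FractionalIdeal (𝓞 K)⁰ K) : ∃ (a : 𝓞 K) (J : Ideal (𝓞 K)), a ≠ 0 ∧
    I = spanSingleton (𝓞 K)⁰ (algebraMap (𝓞 K) K a)⁻¹ * J :=
  exists_eq_spanSingleton_mul I

lemma conjFrac_extFrac (σ : L ≃ₐ[K] L) (I : FractionalIdeal (𝓞 K)⁰ K) :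
    conjFrac σ (extFrac K L I) = extFrac K L I := by
  obtain ⟨a, J, -, rfl⟩ := exists_frac_eq I
  rw [map_mul, map_mul, extFrac_spanSingleton, extFrac_coe, conjFrac_coe, conjFrac_spanSingleton,
    conjIdeal_ext, AlgEquiv.commutes]

namespace IsQuadInvol

variable {σ : L ≃ₐ[K] L} (h : IsQuadInvol σ)
include h

lemma conjFrac_conjFrac (I : FractionalIdeal (𝓞 L)⁰ L) : conjFrac σ (conjFrac σ I) = I := by
  obtain ⟨a, J, -, rfl⟩ := exists_frac_eq I
  rw [map_mul, map_mul, conjFrac_coe, conjFrac_coe, conjFrac_spanSingleton, conjFrac_spanSingleton,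
    h.conjIdeal_conjIdeal, h.invol]

/-- Hilbert's theorem 90 for ideals. -/
lemma exists_frac_div (I : (FractionalIdeal (𝓞 L)⁰ L)ˣ)
    (hI : I * Units.map (conjFrac σ : _ →* _) I = 1) :
    ∃ J : (FractionalIdeal (𝓞 L)⁰ L)ˣ, Units.map (conjFrac σ : _ →* _) J / J = I := by
  have h0 : (1 + I.1 : FractionalIdeal (𝓞 L)⁰ L) ≠ 0 := by
    intro h1
    have : (1 : FractionalIdeal (𝓞 L)⁰ L) ≤ 0 := h1 ▸ le_sup_left
    exact one_ne_zero (le_antisymm this (zero_le _))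
  have hI' : I.1 * conjFrac σ I.1 = 1 := congrArg Units.val hI
  have h2 : I.1 * conjFrac σ (1 + I.1) = 1 + I.1 := by
    rw [map_add, map_one, mul_add, mul_one, hI', add_comm]
  refine ⟨Units.map (conjFrac σ : _ →* _) (Units.mk0 _ h0), ?_⟩
  rw [div_eq_iff_eq_mul]
  ext1
  change conjFrac σ (conjFrac σ (1 + I.1)) = I.1 * conjFrac σ (1 + I.1)
  rw [h.conjFrac_conjFrac, h2]

lemma exists_ne : ∃ x, σ x ≠ x := by
  by_contra! hc
  have : (⊥ : Subalgebra K L) = ⊤ := by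
    rw [eq_top_iff]
    intro y _
    obtain ⟨a, ha⟩ := h.fixed y (hc y)
    exact ⟨a, ha⟩
  have h1 := h.finrank_eq
  rw [← finrank_top K L, ← Algebra.top_toSubmodule, ← this] at h1
  have := Subalgebra.finrank_bot (F := K) (E := L)
  have h2 : finrank K (⊥ : Subalgebra K L) = 2 := h1
  omega

/-- Hilbert's theorem 90. -/
lemma exists_unit_div (x : Lˣ) (hx : x * Units.map (σ : L →* L) x = 1) :
    ∃ y : Lˣ, Units.map (σ : L →* L) y / y = x := by
  have hx' : (x : L) * σ x = 1 := congrArg Units.val hx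
  by_cases h0 : (1 + x : L) = 0
  · obtain ⟨z, hz⟩ := h.exists_ne
    refine ⟨Units.mk0 (σ z - z) (sub_ne_zero.2 hz), ?_⟩
    rw [div_eq_iff_eq_mul]
    ext1
    change σ (σ z - z) = x * (σ z - z)
    rw [map_sub, h.invol]
    linear_combination (σ z - z) * h0 * (-1)
  · have h1 : σ (1 + x : L) ≠ 0 := (map_ne_zero σ).2 h0
    refine ⟨Units.mk0 _ h1, ?_⟩
    rw [div_eq_iff_eq_mul]
    ext1
    change σ (σ (1 + x)) = x * σ (1 + x)
    rw [h.invol, map_add, map_one, mul_add, hx', mul_one, add_comm]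

end IsQuadInvol

end QuadraticFractional

section RamifiedPrimes

open Module FractionalIdeal nonZeroDivisors IsDedekindDomain

variable {K L : Type*} [Field K] [Field L] [NumberField K] [NumberField L] [Algebra K L]

/-- The primes of `L` ramified in the quadratic extension `L / K`. -/
def ramPrimes (K L : Type*) [Field K] [Field L] [NumberField K] [NumberField L] [Algebra K L] :
    Set (HeightOneSpectrum (𝓞 L)) :=
  {P | extIdeal L (conIdeal K P.asIdeal) = P.asIdeal ^ 2}

lemma count_ext_even (v : HeightOneSpectrum (𝓞 L)) (hv : v ∈ ramPrimes K L) (I : Ideal (𝓞 K))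
    (hI : I ≠ 0) (hinj : ∀ J : Ideal (𝓞 K), J ≠ 0 → extIdeal L J ≠ 0) :
    Even (count L v (extIdeal L I : Ideal (𝓞 L))) := by
  induction I using UniqueFactorizationMonoid.induction_on_prime with
  | h₁ => exact absurd rfl hI
  | h₂ J hJ =>
    rw [Ideal.isUnit_iff] at hJ
    rw [hJ, extIdeal, Ideal.map_top, coeIdeal_top, count_one]
    exact Even.zero
  | h₃ J p hJ hp ih =>
    have h1 : extIdeal L (p * J) = extIdeal L p * extIdeal L J := Ideal.map_mul _ _ _
    rw [h1, coeIdeal_mul, count_mul L v (coeIdeal_ne_zero.2 (hinj p hp.ne_zero))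
      (coeIdeal_ne_zero.2 (hinj J hJ))]
    refine Even.add ?_ (ih hJ)
    have hpp : p.IsPrime := Ideal.isPrime_of_prime hp
    by_cases hc : p = conIdeal K v.asIdeal
    · rw [hc, show extIdeal L (conIdeal K v.asIdeal) = v.asIdeal ^ 2 from hv, coeIdeal_pow,
        count_pow_self]
      exact even_two
    · have : count L v (extIdeal L p : Ideal (𝓞 L)) = 0 := by
        classical
        rw [count_coe L v (hinj p hp.ne_zero)]
        by_contra h0
        have h0' := Nat.cast_ne_zero.1 h0
        rw [Associates.count_ne_zero_iff_dvd (hinj p hp.ne_zero) v.irreducible,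
          Ideal.dvd_iff_le, extIdeal, Ideal.map_le_iff_le_comap] at h0'
        exact hc ((hpp.isMaximal hp.ne_zero).eq_of_le
          (Ideal.IsPrime.comap (hK := v.isPrime) _).ne_top h0')
      rw [this]
      exact Even.zero

namespace IsQuadInvol

variable {σ : L ≃ₐ[K] L} (h : IsQuadInvol σ)
include h

lemma ext_ne_zero (J : Ideal (𝓞 K)) (hJ : J ≠ 0) : extIdeal L J ≠ 0 := by
  intro h1
  have := congrArg Ideal.absNorm h1
  rw [h.absNorm_ext, Ideal.zero_eq_bot, Ideal.absNorm_bot] at this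
  exact hJ (Ideal.absNorm_eq_zero_iff.1 (pow_eq_zero_iff two_ne_zero |>.1 this))

lemma conj_ram {P : Ideal (𝓞 L)} [P.IsPrime] (h0 : P ≠ ⊥)
    (hP : extIdeal L (conIdeal K P) = P ^ 2) : conjIdeal σ P = P := by
  rcases h.prime_trichotomy P h0 with ⟨-, h2⟩ | ⟨h1, -⟩
  · rw [hP, pow_two] at h2
    exact (mul_left_cancel₀ h0 h2).symm
  · exact h1

/-- The automorphism acts trivially modulo a ramified prime. -/
lemma sub_mem_of_ram {P : Ideal (𝓞 L)} [P.IsPrime] (h0 : P ≠ ⊥)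
    (hP : extIdeal L (conIdeal K P) = P ^ 2) (x : 𝓞 L) :
    (RingOfIntegers.mapAlgEquiv σ : 𝓞 L ≃ₐ[𝓞 K] 𝓞 L) x - x ∈ P := by
  have h1 : (conIdeal K P).absNorm = P.absNorm := by
    have := congrArg Ideal.absNorm hP
    rw [h.absNorm_ext, map_pow] at this
    exact Nat.pow_left_injective two_ne_zero this
  have hsurj : Function.Surjective (Ideal.quotientMap P (algebraMap (𝓞 K) (𝓞 L))
      (le_refl (conIdeal K P))) := by
    have hfin : Finite (𝓞 L ⧸ P) := Ideal.finiteQuotientOfFreeOfNeBot P h0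
    have hfin' : Finite (𝓞 K ⧸ conIdeal K P) :=
      Ideal.finiteQuotientOfFreeOfNeBot _ (h.conIdeal_ne_bot h0)
    refine ((Nat.bijective_iff_injective_and_card _).2 ⟨Ideal.quotientMap_injective, ?_⟩).2
    exact h1
  obtain ⟨a, ha⟩ := hsurj (Ideal.Quotient.mk P x)
  obtain ⟨a, rfl⟩ := Ideal.Quotient.mk_surjective a
  rw [Ideal.quotientMap_mk, Ideal.Quotient.eq] at ha
  have h2 := mem_conjIdeal σ ha
  rw [h.conj_ram h0 hP, map_sub, AlgEquiv.commutes] at h2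
  have := sub_mem ha h2
  rwa [sub_sub_sub_cancel_left] at this

lemma exists_int_ne : ∃ x : 𝓞 L, (RingOfIntegers.mapAlgEquiv σ : 𝓞 L ≃ₐ[𝓞 K] 𝓞 L) x ≠ x := by
  by_contra! hc
  obtain ⟨z, hz⟩ := h.exists_ne
  obtain ⟨a, b, hb, rfl⟩ := IsFractionRing.div_surjective (A := 𝓞 L) z
  apply hz
  rw [map_div₀]
  congr 1
  · exact congrArg (algebraMap (𝓞 L) L) (hc a)
  · exact congrArg (algebraMap (𝓞 L) L) (hc b)

lemma finite_ramPrimes : (ramPrimes K L).Finite := by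
  obtain ⟨x, hx⟩ := h.exists_int_ne
  refine (Ideal.finite_factors (I := Ideal.span {(RingOfIntegers.mapAlgEquiv σ :
    𝓞 L ≃ₐ[𝓞 K] 𝓞 L) x - x}) ?_).subset ?_
  · simpa [sub_eq_zero] using hx
  · intro v hv
    have := v.isPrime
    rw [Set.mem_ofPred_eq, Ideal.dvd_span_singleton]
    exact h.sub_mem_of_ram v.ne_bot hv x

/-- An invariant ideal with even exponents at the ramified primes comes from the base field. -/
lemma exists_ext_eq (n : ℕ) : ∀ J : Ideal (𝓞 L), J.absNorm ≤ n → J ≠ ⊥ → conjIdeal σ J = J →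
    (∀ v ∈ ramPrimes K L, Even (count L v (J : FractionalIdeal (𝓞 L)⁰ L))) →
    ∃ I : Ideal (𝓞 K), extIdeal L I = J := by
  classical
  induction n with
  | zero =>
    intro J hn h0
    exact absurd (Ideal.absNorm_eq_zero_iff.1 (Nat.le_zero.1 hn)) h0
  | succ n ih =>
    intro J hn h0 hJ hev
    by_cases htop : J = ⊤
    · exact ⟨⊤, by rw [htop, extIdeal, Ideal.map_top]⟩
    obtain ⟨P, hPm, hJP⟩ := Ideal.exists_le_maximal J htop
    have hP := hPm.isPrime
    have hP0 : P ≠ ⊥ := fun hb => h0 (le_bot_iff.1 (hb ▸ hJP))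
    have hlt : ∀ A B : Ideal (𝓞 L), A * B = J → A ≤ P → B.absNorm ≤ n := by
      intro A B hAB hA
      have h1 := congrArg Ideal.absNorm hAB
      rw [map_mul] at h1
      have h2 : A.absNorm ≠ 1 := fun h3 => hP.ne_top (top_le_iff.1
        ((Ideal.absNorm_eq_one_iff.1 h3) ▸ hA))
      have h3 : J.absNorm ≠ 0 := fun h4 => h0 (Ideal.absNorm_eq_zero_iff.1 h4)
      have h4 : A.absNorm ≠ 0 := fun h5 => h3 (by rw [← h1, h5, zero_mul])
      have h6 : B.absNorm ≠ 0 := fun h5 => h3 (by rw [← h1, h5, mul_zero])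
      have h5 : 2 ≤ A.absNorm := by omega
      nlinarith [Nat.pos_of_ne_zero h6]
    have main : ∀ p : Ideal (𝓞 K), extIdeal L p ∣ J → extIdeal L p ≤ P →
        ∃ I : Ideal (𝓞 K), extIdeal L I = J := by
      rintro p ⟨B, hB⟩ hp
      have he0 : extIdeal L p ≠ ⊥ := fun hb => h0 (by rw [hB, hb, Ideal.bot_mul])
      have hB0 : B ≠ ⊥ := fun hb => h0 (by rw [hB, hb, Ideal.mul_bot])
      have hp0 : p ≠ 0 := by
        rintro rfl
        exact he0 (Ideal.map_bot)
      obtain ⟨I, hI⟩ := ih B (hlt _ _ hB.symm hp) hB0 (by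
        have h1 := hJ
        rw [hB, map_mul, conjIdeal_ext] at h1
        exact mul_left_cancel₀ he0 h1) (by
        intro v hv
        have h1 := hev v hv
        rw [hB, coeIdeal_mul, count_mul L v (coeIdeal_ne_zero.2 he0)
          (coeIdeal_ne_zero.2 hB0)] at h1
        exact (Int.even_add.1 h1).1 (count_ext_even v hv p hp0 h.ext_ne_zero))
      exact ⟨p * I, by rw [extIdeal, Ideal.map_mul, hB, ← hI]⟩
    rcases h.prime_trichotomy P hP0 with ⟨h1, h2⟩ | ⟨h1, h2 | h2⟩
    · refine main (conIdeal K P) ?_ (h2 ▸ Ideal.mul_le_left)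
      rw [h2]
      have hco : IsCoprime P (conjIdeal σ P) := by
        have := h.conjIdeal_isPrime P
        have hm : (conjIdeal σ P).IsMaximal := this.isMaximal (h.conjIdeal_ne_bot hP0)
        rw [Ideal.isCoprime_iff_sup_eq]
        exact Ideal.IsMaximal.coprime_of_ne hPm hm (Ne.symm h1)
      refine hco.mul_dvd (Ideal.dvd_iff_le.2 hJP) (Ideal.dvd_iff_le.2 ?_)
      rw [← hJ]
      exact conjIdeal_mono σ hJP
    · exact main (conIdeal K P) (by rw [h2]; exact Ideal.dvd_iff_le.2 hJP) h2.le
    · refine main (conIdeal K P) ?_ (h2 ▸ Ideal.pow_le_self two_ne_zero)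
      rw [h2]
      obtain ⟨B, hB⟩ := Ideal.dvd_iff_le.2 hJP
      have hB0 : B ≠ ⊥ := fun hb => h0 (by rw [hB, hb, Ideal.mul_bot])
      let v : HeightOneSpectrum (𝓞 L) := ⟨P, hP, hP0⟩
      have h3 := hev v h2
      rw [hB, coeIdeal_mul, count_mul L v (coeIdeal_ne_zero.2 hP0)
          (coeIdeal_ne_zero.2 hB0), show (P : FractionalIdeal (𝓞 L)⁰ L) = v.asIdeal from rfl,
          count_self, count_coe L v hB0] at h3
      have h4 : (Associates.mk v.asIdeal).count (Associates.mk B).factors ≠ 0 := by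
        intro h5
        rw [h5] at h3
        exact absurd h3 (by decide)
      rw [Associates.count_ne_zero_iff_dvd hB0 v.irreducible] at h4
      rw [hB, pow_two]
      exact mul_dvd_mul_left P h4

end IsQuadInvol

end RamifiedPrimes

section AmbiguousIdeals

open Module FractionalIdeal nonZeroDivisors IsDedekindDomain

variable {K L : Type*} [Field K] [Field L] [NumberField K] [NumberField L] [Algebra K L]

/-- The action of an automorphism on the group of fractional ideals. -/
def conjUnit (σ : L ≃ₐ[K] L) : (FractionalIdeal (𝓞 L)⁰ L)ˣ →* (FractionalIdeal (𝓞 L)⁰ L)ˣ :=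
  Units.map (conjFrac σ : FractionalIdeal (𝓞 L)⁰ L →* FractionalIdeal (𝓞 L)⁰ L)

/-- The extension homomorphism between groups of fractional ideals. -/
def extUnit (K L : Type*) [Field K] [Field L] [NumberField K] [NumberField L] [Algebra K L] :
    (FractionalIdeal (𝓞 K)⁰ K)ˣ →* (FractionalIdeal (𝓞 L)⁰ L)ˣ :=
  Units.map (extFrac K L : FractionalIdeal (𝓞 K)⁰ K →* FractionalIdeal (𝓞 L)⁰ L)

lemma extUnit_injective : Function.Injective (extUnit K L) :=
  Units.map_injective extFrac_injective

/-- The parities of the exponents at the ramified primes. -/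
def ramParity (K L : Type*) [Field K] [Field L] [NumberField K] [NumberField L] [Algebra K L] :
    (FractionalIdeal (𝓞 L)⁰ L)ˣ →* Multiplicative (ramPrimes K L → ZMod 2) where
  toFun J := Multiplicative.ofAdd fun v => ((count L v.1 J.1 : ℤ) : ZMod 2)
  map_one' := by
    have : (fun v : ramPrimes K L => ((count L v.1 (1 : FractionalIdeal (𝓞 L)⁰ L) : ℤ) : ZMod 2))
        = 0 := by
      funext v
      rw [count_one]
      simp
    simp only [Units.val_one]
    rw [this]
    rfl
  map_mul' I J := by
    rw [← ofAdd_add]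
    congr 1
    funext v
    rw [Units.val_mul, count_mul L _ I.ne_zero J.ne_zero]
    simp

lemma ramParity_eq_one_iff (J : (FractionalIdeal (𝓞 L)⁰ L)ˣ) : ramParity K L J = 1 ↔
    ∀ v ∈ ramPrimes K L, Even (count L v J.1) := by
  rw [← ofAdd_zero]
  constructor
  · intro h v hv
    have := congrFun (Multiplicative.ofAdd.injective h) ⟨v, hv⟩
    exact (ZMod.intCast_eq_zero_iff_even).1 this
  · intro h
    refine congrArg Multiplicative.ofAdd (funext fun v => ?_)
    exact (ZMod.intCast_eq_zero_iff_even).2 (h v.1 v.2)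

namespace IsQuadInvol

variable {σ : L ≃ₐ[K] L} (h : IsQuadInvol σ)
include h

lemma range_extUnit : (extUnit K L).range = (ramParity K L).ker ⊓ (involDiff (conjUnit σ)).ker := by
  ext J
  rw [Subgroup.mem_inf, MonoidHom.mem_ker, MonoidHom.mem_ker, ramParity_eq_one_iff,
    involDiff_apply, div_eq_one]
  constructor
  · rintro ⟨I, rfl⟩
    refine ⟨?_, ?_⟩
    · intro v hv
      obtain ⟨a, J, ha, hJ⟩ := exists_frac_eq I.1
      have haI : I.1 * ((Ideal.span {a} : Ideal (𝓞 K)) : FractionalIdeal (𝓞 K)⁰ K) = J := by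
        have ha' : algebraMap (𝓞 K) K a ≠ 0 := by simpa using ha
        rw [hJ, coeIdeal_span_singleton, mul_right_comm, spanSingleton_mul_spanSingleton,
          inv_mul_cancel₀ ha', spanSingleton_one, one_mul]
      have ha0 : (Ideal.span {a} : Ideal (𝓞 K)) ≠ 0 := by simpa using ha
      have hJ0 : J ≠ 0 := by
        rintro rfl
        apply I.ne_zero
        rw [hJ]
        simp
      have h1 := congrArg (extFrac K L) haI
      rw [map_mul, extFrac_coe, extFrac_coe] at h1
      have h2 := congrArg (count L v) h1
      have h3 : extFrac K L I.1 ≠ 0 := ((extUnit K L) I).ne_zero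
      rw [count_mul L v h3 (coeIdeal_ne_zero.2 (h.ext_ne_zero _ ha0))] at h2
      have h4 := count_ext_even v hv J hJ0 h.ext_ne_zero
      rw [← h2, Int.even_add] at h4
      exact h4.2 (count_ext_even v hv _ ha0 h.ext_ne_zero)
    · ext1
      exact conjFrac_extFrac σ I.1
  · rintro ⟨h1, h2⟩
    obtain ⟨a, I, ha, hI⟩ := exists_frac_eq J.1
    set τ := (RingOfIntegers.mapAlgEquiv σ : 𝓞 L ≃ₐ[𝓞 K] 𝓞 L) with hτ
    have hτa : τ a ≠ 0 := by simpa using ha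
    obtain ⟨c, hc⟩ := h.exists_of_fixed (a * τ a) (by
      rw [map_mul, h.mapAlgEquiv_invol, mul_comm])
    have hc0 : c ≠ 0 := by
      rintro rfl
      rw [map_zero] at hc
      exact mul_ne_zero ha hτa hc.symm
    have ha' : algebraMap (𝓞 L) L a ≠ 0 := by simpa using ha
    have hc' : algebraMap (𝓞 K) K c ≠ 0 := by simpa using hc0
    have hcL : algebraMap K L (algebraMap (𝓞 K) K c) = algebraMap (𝓞 L) L (a * τ a) := by
      rw [← hc]
      rfl
    set b : (FractionalIdeal (𝓞 K)⁰ K)ˣ := Units.mk0 (spanSingleton (𝓞 K)⁰ (algebraMap (𝓞 K) K c))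
      (spanSingleton_ne_zero_iff.2 hc') with hb
    set J' : Ideal (𝓞 L) := Ideal.span {τ a} * I with hJ'
    have hbJ : (J * extUnit K L b).1 = (J' : FractionalIdeal (𝓞 L)⁰ L) := by
      have e1 : (extUnit K L b).1 = spanSingleton (𝓞 L)⁰ (algebraMap (𝓞 L) L (a * τ a)) := by
        rw [← hcL, ← extFrac_spanSingleton]
        rfl
      rw [Units.val_mul, hI, e1, hJ', coeIdeal_mul, coeIdeal_span_singleton, mul_right_comm,
        spanSingleton_mul_spanSingleton, map_mul, inv_mul_cancel_left₀ ha']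
    have hb1 : ∀ v ∈ ramPrimes K L, Even (count L v (extUnit K L b).1) := by
      intro v hv
      have : (extUnit K L b).1 = (extIdeal L (Ideal.span {c}) : Ideal (𝓞 L)) := by
        rw [← extFrac_coe, coeIdeal_span_singleton]
        rfl
      rw [this]
      exact count_ext_even v hv _ (by simpa using hc0) h.ext_ne_zero
    have hJ0 : J' ≠ ⊥ := by
      rintro hb
      rw [hb] at hbJ
      exact (J * extUnit K L b).ne_zero (by rw [hbJ]; simp)
    obtain ⟨M, hM⟩ := h.exists_ext_eq J'.absNorm J' le_rfl hJ0 (by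
      apply coeIdeal_injective (K := L)
      change ((conjIdeal σ J' : Ideal (𝓞 L)) : FractionalIdeal (𝓞 L)⁰ L) = J'
      rw [← conjFrac_coe, ← hbJ, Units.val_mul, map_mul]
      congr 1
      · exact congrArg Units.val h2
      · exact conjFrac_extFrac σ b.1) (by
      intro v hv
      rw [← hbJ, Units.val_mul, count_mul L v J.ne_zero (Units.ne_zero _)]
      exact (h1 v hv).add (hb1 v hv))
    have hM0 : (M : FractionalIdeal (𝓞 K)⁰ K) ≠ 0 := by
      rw [coeIdeal_ne_zero]
      rintro rfl
      exact hJ0 (hM ▸ Ideal.map_bot)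
    refine ⟨Units.mk0 _ hM0 / b, ?_⟩
    rw [map_div, div_eq_iff_eq_mul]
    ext1
    rw [hbJ, ← hM, ← extFrac_coe]
    rfl

lemma map_ramParity : (involDiff (conjUnit σ)).ker.map (ramParity K L) = ⊤ := by
  classical
  have := h.finite_ramPrimes.fintype
  rw [eq_top_iff]
  intro f _
  refine ⟨∏ w : ramPrimes K L, (Units.mk0 (w.1.asIdeal : FractionalIdeal (𝓞 L)⁰ L)
    (coeIdeal_ne_zero.2 w.1.ne_bot)) ^ (f.toAdd w).val, ?_, ?_⟩
  · refine Subgroup.prod_mem _ fun w _ => Subgroup.pow_mem _ ?_ _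
    rw [MonoidHom.mem_ker, involDiff_apply, div_eq_one]
    ext1
    have := w.1.isPrime
    change conjFrac σ (w.1.asIdeal : FractionalIdeal (𝓞 L)⁰ L) = w.1.asIdeal
    rw [conjFrac_coe, h.conj_ram w.1.ne_bot w.2]
  · refine congrArg Multiplicative.ofAdd (funext fun v => ?_)
    rw [Units.coe_prod, count_prod]
    · rw [Finset.sum_eq_single v]
      · rw [Units.val_pow_eq_pow_val, Units.val_mk0, count_pow_self]
        simp
        rfl
      · intro w _ hw
        rw [Units.val_pow_eq_pow_val, Units.val_mk0, count_pow, count_maximal_coprime, mul_zero]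
        exact fun h1 => hw (Subtype.ext h1)
      · simp
    · exact fun i _ => Units.ne_zero _

/-- The index of the extended ideals in the group of ambiguous ideals. -/
theorem relIndex_range_extUnit :
    (extUnit K L).range.relIndex (involDiff (conjUnit σ)).ker = 2 ^ (ramPrimes K L).ncard := by
  classical
  have := h.finite_ramPrimes.fintype
  rw [h.range_extUnit, Subgroup.inf_relIndex_right, Subgroup.relIndex_ker, h.map_ramParity,
    Subgroup.card_top, Nat.card_congr Multiplicative.toAdd, Nat.card_fun, Nat.card_zmod,
    Nat.card_coe_set_eq]

end IsQuadInvol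

end AmbiguousIdeals

section ClassGroupMaps

open Module FractionalIdeal nonZeroDivisors IsDedekindDomain

variable {K L : Type*} [Field K] [Field L] [NumberField K] [NumberField L] [Algebra K L]

/-- The class of a fractional ideal. -/
def clMk (L : Type*) [Field L] [NumberField L] :
    (FractionalIdeal (𝓞 L)⁰ L)ˣ →* ClassGroup (𝓞 L) :=
  (ClassGroup.equiv L).symm.toMonoidHom.comp (QuotientGroup.mk' _)

lemma clMk_surjective : Function.Surjective (clMk L) :=
  (ClassGroup.equiv L).symm.surjective.comp (QuotientGroup.mk'_surjective _)

lemma ker_clMk : (clMk L).ker = (toPrincipalIdeal (𝓞 L) L).range := by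
  ext J
  rw [MonoidHom.mem_ker, ← QuotientGroup.eq_one_iff]
  exact (ClassGroup.equiv L).symm.map_eq_one_iff

lemma conjUnit_toPrincipalIdeal (σ : L ≃ₐ[K] L) (x : Lˣ) :
    conjUnit σ (toPrincipalIdeal (𝓞 L) L x) =
      toPrincipalIdeal (𝓞 L) L (Units.map (σ : L →* L) x) := by
  ext1
  change conjFrac σ _ = _
  rw [coe_toPrincipalIdeal, coe_toPrincipalIdeal, conjFrac_spanSingleton]
  rfl

lemma extUnit_toPrincipalIdeal (x : Kˣ) :
    extUnit K L (toPrincipalIdeal (𝓞 K) K x) =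
      toPrincipalIdeal (𝓞 L) L (Units.map (algebraMap K L : K →* L) x) := by
  ext1
  change extFrac K L _ = _
  rw [coe_toPrincipalIdeal, coe_toPrincipalIdeal, extFrac_spanSingleton]
  rfl

/-- The action of an automorphism on the class group. -/
def conjCl (σ : L ≃ₐ[K] L) : ClassGroup (𝓞 L) →* ClassGroup (𝓞 L) :=
  (clMk L).liftOfSurjective clMk_surjective ⟨(clMk L).comp (conjUnit σ), by
    rw [ker_clMk]
    rintro _ ⟨x, rfl⟩
    rw [MonoidHom.mem_ker, MonoidHom.comp_apply, conjUnit_toPrincipalIdeal, ← MonoidHom.mem_ker,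
      ker_clMk]
    exact ⟨_, rfl⟩⟩

/-- The extension homomorphism between class groups. -/
def extCl (K L : Type*) [Field K] [Field L] [NumberField K] [NumberField L] [Algebra K L] :
    ClassGroup (𝓞 K) →* ClassGroup (𝓞 L) :=
  (clMk K).liftOfSurjective clMk_surjective ⟨(clMk L).comp (extUnit K L), by
    rw [ker_clMk]
    rintro _ ⟨x, rfl⟩
    rw [MonoidHom.mem_ker, MonoidHom.comp_apply, extUnit_toPrincipalIdeal, ← MonoidHom.mem_ker,
      ker_clMk]
    exact ⟨_, rfl⟩⟩

lemma conjCl_mk (σ : L ≃ₐ[K] L) (J : (FractionalIdeal (𝓞 L)⁰ L)ˣ) :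
    conjCl σ (clMk L J) = clMk L (conjUnit σ J) :=
  MonoidHom.liftOfRightInverse_comp_apply _ _ _ _ _

lemma extCl_mk (J : (FractionalIdeal (𝓞 K)⁰ K)ˣ) :
    extCl K L (clMk K J) = clMk L (extUnit K L J) :=
  MonoidHom.liftOfRightInverse_comp_apply _ _ _ _ _

/-- The class of an integral ideal. -/
def idealUnit {I : Ideal (𝓞 L)} (hI : I ≠ ⊥) : (FractionalIdeal (𝓞 L)⁰ L)ˣ :=
  Units.mk0 (I : FractionalIdeal (𝓞 L)⁰ L) (coeIdeal_ne_zero.2 hI)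

lemma exists_idealUnit (c : ClassGroup (𝓞 L)) :
    ∃ (I : Ideal (𝓞 L)) (hI : I ≠ ⊥), clMk L (idealUnit hI) = c := by
  obtain ⟨J, rfl⟩ := clMk_surjective c
  obtain ⟨a, I, ha, hI⟩ := exists_frac_eq J.1
  have hI0 : I ≠ ⊥ := by
    rintro rfl
    apply J.ne_zero
    rw [hI]
    simp
  refine ⟨I, hI0, ?_⟩
  have ha' : algebraMap (𝓞 L) L a ≠ 0 := by simpa using ha
  rw [← div_eq_one, ← map_div, ← MonoidHom.mem_ker, ker_clMk]
  refine ⟨Units.mk0 _ ha', ?_⟩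
  rw [eq_div_iff_mul_eq']
  ext1
  rw [Units.val_mul, hI, coe_toPrincipalIdeal, Units.val_mk0, ← mul_assoc,
    spanSingleton_mul_spanSingleton, mul_inv_cancel₀ ha', spanSingleton_one, one_mul]
  rfl

namespace IsQuadInvol

variable {σ : L ≃ₐ[K] L} (h : IsQuadInvol σ)
include h

lemma conjUnit_conjUnit (J : (FractionalIdeal (𝓞 L)⁰ L)ˣ) : conjUnit σ (conjUnit σ J) = J := by
  ext1
  exact h.conjFrac_conjFrac J.1

lemma conjCl_conjCl (c : ClassGroup (𝓞 L)) : conjCl σ (conjCl σ c) = c := by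
  obtain ⟨J, rfl⟩ := clMk_surjective c
  rw [conjCl_mk, conjCl_mk, h.conjUnit_conjUnit]

lemma mul_conjUnit_mem (J : Ideal (𝓞 L)) (hJ : J ≠ 0) :
    ∃ I : Ideal (𝓞 K), extIdeal L I = J * conjIdeal σ J := by
  induction J using UniqueFactorizationMonoid.induction_on_prime with
  | h₁ => exact absurd rfl hJ
  | h₂ J hu =>
    rw [Ideal.isUnit_iff] at hu
    refine ⟨⊤, ?_⟩
    rw [hu, extIdeal, Ideal.map_top, ← Ideal.one_eq_top, map_one, one_mul]
  | h₃ J p hJ0 hp ih =>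
    obtain ⟨I, hI⟩ := ih hJ0
    have hpp : p.IsPrime := Ideal.isPrime_of_prime hp
    have hp0 : p ≠ ⊥ := hp.ne_zero
    have : ∃ I' : Ideal (𝓞 K), extIdeal L I' = p * conjIdeal σ p := by
      rcases h.prime_trichotomy p hp0 with ⟨-, h2⟩ | ⟨h1, h2 | h2⟩
      · exact ⟨_, h2⟩
      · refine ⟨conIdeal K p * conIdeal K p, ?_⟩
        rw [h1, extIdeal, Ideal.map_mul, show (conIdeal K p).map _ = p from h2]
      · exact ⟨_, by rw [h1, h2, pow_two]⟩
    obtain ⟨I', hI'⟩ := this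
    refine ⟨I' * I, ?_⟩
    rw [map_mul, mul_mul_mul_comm, ← hI, ← hI', extIdeal, Ideal.map_mul]

/-- The norm of an ideal class comes from the base field. -/
theorem mul_conjCl_mem (c : ClassGroup (𝓞 L)) : c * conjCl σ c ∈ (extCl K L).range := by
  obtain ⟨J, hJ, rfl⟩ := exists_idealUnit c
  obtain ⟨I, hI⟩ := h.mul_conjUnit_mem J hJ
  have hI0 : I ≠ ⊥ := by
    rintro rfl
    refine mul_ne_zero hJ (h.conjIdeal_ne_bot hJ) ?_
    rw [← hI, extIdeal, Ideal.map_bot, Ideal.zero_eq_bot]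
  refine ⟨clMk K (idealUnit hI0), ?_⟩
  rw [extCl_mk, conjCl_mk, ← map_mul]
  congr 1
  ext1
  change extFrac K L (I : FractionalIdeal (𝓞 K)⁰ K) =
    (J : FractionalIdeal (𝓞 L)⁰ L) * conjFrac σ (J : FractionalIdeal (𝓞 L)⁰ L)
  rw [extFrac_coe, conjFrac_coe, hI, coeIdeal_mul]

end IsQuadInvol

end ClassGroupMaps

section UnitSquares

open Module

lemma relIndex_map_pow_two {M X : Type*} [CommGroup M] [CommGroup X]
    [Module.Finite ℤ (Additive M)] (ι : M →* X) (hι : Function.Injective ι) :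
    (ι.range.map (powMonoidHom 2)).relIndex ι.range =
      2 ^ finrank ℤ (Additive M) * Nat.card {x : M // x ^ 2 = 1} := by
  have h1 : ι.range.map (powMonoidHom 2) = ((powMonoidHom 2 : M →* M).range).map ι := by
    rw [MonoidHom.map_range, MonoidHom.map_range]
    congr 1
    ext x
    exact (map_pow ι x 2).symm
  rw [h1, MonoidHom.range_eq_map, MonoidHom.range_eq_map ι,
    Subgroup.relIndex_map_map_of_injective _ _ hι, Subgroup.relIndex_top_right,
    ← MonoidHom.range_eq_map]
  exact index_range_nsmul_two (Additive M)

lemma card_sq_eq_one_of_neg {M R : Type*} [CommGroup M] [CommRing R] [IsDomain R] [CharZero R]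
    (ι : M →* Rˣ) (hι : Function.Injective ι) (hneg : ∃ x, ι x = -1) :
    Nat.card {x : M // x ^ 2 = 1} = 2 := by
  obtain ⟨z, hz⟩ := hneg
  have hz2 : z ^ 2 = 1 := hι (by rw [map_pow, hz, map_one, neg_one_sq])
  have hz1 : z ≠ 1 := by
    rintro rfl
    rw [map_one] at hz
    have := congrArg Units.val hz
    have h2 : (2 : R) = 0 := by
      push_cast at this
      linear_combination this
    exact two_ne_zero h2
  rw [Nat.card_eq_two_iff]
  refine ⟨⟨1, one_pow 2⟩, ⟨z, hz2⟩, fun h => hz1 (congrArg Subtype.val h).symm, ?_⟩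
  ext ⟨x, hx⟩
  simp only [Set.mem_insert_iff, Set.mem_singleton_iff, Set.mem_univ, iff_true, Subtype.mk.injEq]
  have h1 : ((ι x : Rˣ) : R) ^ 2 = 1 := by
    rw [← Units.val_pow_eq_pow_val, ← map_pow, hx, map_one, Units.val_one]
  rcases sq_eq_sq_iff_eq_or_eq_neg.1 (h1.trans (one_pow 2).symm) with h | h
  · left
    apply hι
    ext1
    rw [h, map_one, Units.val_one]
  · right
    apply hι
    ext1
    rw [h, hz, Units.val_neg, Units.val_one]

lemma finrank_ker_norm {M N : Type*} [AddCommGroup M] [AddCommGroup N] [Module.Finite ℤ M]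
    [Module.Finite ℤ N] (s : M →ₗ[ℤ] M) (j : N →ₗ[ℤ] M) (hj : Function.Injective j)
    (hs : ∀ x, s (j x) = j x) (hN : ∀ x, x + s x ∈ LinearMap.range j) :
    finrank ℤ (LinearMap.ker (LinearMap.id + s)) + finrank ℤ N = finrank ℤ M := by
  set n : M →ₗ[ℤ] M := LinearMap.id + s with hn
  have h1 := (LinearMap.ker n).finrank_quotient_add_finrank
  rw [n.quotKerEquivRange.finrank_eq] at h1
  have h2 : finrank ℤ (LinearMap.range n) ≤ finrank ℤ N := by
    rw [← LinearMap.finrank_range_of_inj hj]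
    apply Submodule.finrank_mono
    rintro _ ⟨x, rfl⟩
    exact hN x
  have h3 : finrank ℤ N ≤ finrank ℤ (LinearMap.range n) := by
    have e1 := (LinearMap.ker (n ∘ₗ j)).finrank_quotient_add_finrank
    rw [(n ∘ₗ j).quotKerEquivRange.finrank_eq] at e1
    have e2 : finrank ℤ (LinearMap.ker (n ∘ₗ j)) = 0 := by
      apply Module.IsTorsion.finrank_eq_zero
      rintro ⟨x, hx⟩
      refine ⟨⟨2, by simp⟩, ?_⟩
      ext1
      have hx' : j x + s (j x) = 0 := hx
      rw [hs, ← two_smul ℤ, ← map_smul] at hx'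
      exact hj (hx'.trans (map_zero j).symm)
    have e3 : finrank ℤ (LinearMap.range (n ∘ₗ j)) ≤ finrank ℤ (LinearMap.range n) :=
      Submodule.finrank_mono (LinearMap.range_comp_le_range _ _)
    omega
  omega

end UnitSquares

section Chevalley

open Module FractionalIdeal nonZeroDivisors IsDedekindDomain

variable {K L : Type*} [Field K] [Field L] [NumberField K] [NumberField L] [Algebra K L]

/-- The inclusion of the units of `𝓞 L` in `Lˣ`. -/
def unitsIncl (L : Type*) [Field L] [NumberField L] : (𝓞 L)ˣ →* Lˣ :=
  Units.map (algebraMap (𝓞 L) L : 𝓞 L →* L)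

/-- The inclusion of the units of `𝓞 K` in `(𝓞 L)ˣ`. -/
def unitsExt (K L : Type*) [Field K] [Field L] [NumberField K] [NumberField L] [Algebra K L] :
    (𝓞 K)ˣ →* (𝓞 L)ˣ :=
  Units.map (algebraMap (𝓞 K) (𝓞 L) : 𝓞 K →* 𝓞 L)

/-- The action of an automorphism on units. -/
def conjUnits (σ : L ≃ₐ[K] L) : (𝓞 L)ˣ →* (𝓞 L)ˣ :=
  Units.map ((RingOfIntegers.mapAlgEquiv σ : 𝓞 L ≃ₐ[𝓞 K] 𝓞 L) : 𝓞 L →* 𝓞 L)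

lemma unitsIncl_injective : Function.Injective (unitsIncl L) :=
  Units.map_injective (RingOfIntegers.coe_injective)

lemma unitsExt_injective : Function.Injective (unitsExt K L) :=
  Units.map_injective (FaithfulSMul.algebraMap_injective (𝓞 K) (𝓞 L))

/-- The units of `K` which are norms of elements of `L`. -/
def normUnits (σ : L ≃ₐ[K] L) : Subgroup (𝓞 K)ˣ :=
  (involNorm (Units.map (σ : L →* L))).range.comap ((unitsIncl L).comp (unitsExt K L))

lemma mem_normUnits (σ : L ≃ₐ[K] L) (u : (𝓞 K)ˣ) :
    u ∈ normUnits σ ↔ ∃ y : L, y * σ y = algebraMap K L (u : K) := by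
  constructor
  · rintro ⟨y, hy⟩
    exact ⟨y, congrArg Units.val hy⟩
  · rintro ⟨y, hy⟩
    have hu : algebraMap K L (u : K) ≠ 0 := by simp
    have hy0 : y ≠ 0 := by
      rintro rfl
      rw [zero_mul] at hy
      exact hu hy.symm
    exact ⟨Units.mk0 y hy0, Units.ext hy⟩

lemma range_unitsIncl : (toPrincipalIdeal (𝓞 L) L).ker = (unitsIncl L).range := by
  ext x
  rw [MonoidHom.mem_ker, toPrincipalIdeal_eq_iff, Units.val_one, ← spanSingleton_one]
  constructor
  · intro hx
    have h1 : ∀ a b : L, spanSingleton (𝓞 L)⁰ a = spanSingleton (𝓞 L)⁰ b →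
        ∃ c : 𝓞 L, algebraMap (𝓞 L) L c * b = a := by
      intro a b hab
      have : a ∈ spanSingleton (𝓞 L)⁰ b := hab ▸ mem_spanSingleton_self _ a
      obtain ⟨c, hc⟩ := (mem_spanSingleton _).1 this
      exact ⟨c, by rw [← hc, Algebra.smul_def]⟩
    obtain ⟨a, ha⟩ := h1 _ _ hx
    obtain ⟨b, hb⟩ := h1 _ _ hx.symm
    rw [mul_one] at ha
    have hab : a * b = 1 := by
      apply RingOfIntegers.coe_injective
      rw [map_mul, ha, map_one, mul_comm, hb]
    exact ⟨⟨a, b, hab, by rw [mul_comm, hab]⟩, Units.ext ha⟩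
  · rintro ⟨u, rfl⟩
    apply le_antisymm
    · rw [spanSingleton_le_iff_mem, mem_spanSingleton]
      exact ⟨u, by rw [Algebra.smul_def, mul_one]; rfl⟩
    · rw [spanSingleton_le_iff_mem, mem_spanSingleton]
      refine ⟨(u⁻¹ : (𝓞 L)ˣ), ?_⟩
      rw [Algebra.smul_def]
      change algebraMap (𝓞 L) L _ * algebraMap (𝓞 L) L _ = 1
      rw [← map_mul, Units.inv_mul, map_one]

namespace IsQuadInvol

variable {σ : L ≃ₐ[K] L} (h : IsQuadInvol σ)
include h

lemma ker_involDiff : (involDiff (Units.map (σ : L →* L))).ker =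
    (Units.map (algebraMap K L : K →* L)).range := by
  ext x
  rw [MonoidHom.mem_ker, involDiff_apply, div_eq_one]
  constructor
  · intro hx
    obtain ⟨a, ha⟩ := h.fixed x (congrArg Units.val hx)
    have ha0 : a ≠ 0 := by
      rintro rfl
      rw [map_zero] at ha
      exact x.ne_zero ha.symm
    exact ⟨Units.mk0 a ha0, Units.ext ha⟩
  · rintro ⟨a, rfl⟩
    ext1
    exact σ.commutes a.1

lemma inf_ker_involDiff : (toPrincipalIdeal (𝓞 L) L).ker ⊓ (involDiff (Units.map (σ : L →* L))).ker
    = ((unitsIncl L).comp (unitsExt K L)).range := by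
  rw [range_unitsIncl]
  ext x
  rw [Subgroup.mem_inf, MonoidHom.mem_ker, involDiff_apply, div_eq_one]
  constructor
  · rintro ⟨⟨u, rfl⟩, hu⟩
    have hu' : conjUnits σ u = u := unitsIncl_injective (Units.ext (congrArg Units.val hu))
    obtain ⟨a, ha⟩ := h.exists_of_fixed u.1 (congrArg Units.val hu')
    have hv' : conjUnits σ u⁻¹ = u⁻¹ := by rw [map_inv, hu']
    obtain ⟨b, hb⟩ := h.exists_of_fixed (u⁻¹ : (𝓞 L)ˣ) (congrArg Units.val hv')
    have hab : a * b = 1 := by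
      apply FaithfulSMul.algebraMap_injective (𝓞 K) (𝓞 L)
      rw [map_mul, ha, hb, map_one, Units.mul_inv]
    exact ⟨⟨a, b, hab, by rw [mul_comm, hab]⟩, Units.ext (congrArg (algebraMap (𝓞 L) L) ha)⟩
  · rintro ⟨u, rfl⟩
    refine ⟨⟨_, rfl⟩, ?_⟩
    ext1
    exact σ.commutes (u : K)

lemma relIndex_norm : ((toPrincipalIdeal (𝓞 L) L).ker ⊓
      (involNorm (Units.map (σ : L →* L))).range).relIndex ((toPrincipalIdeal (𝓞 L) L).ker ⊓
      (involDiff (Units.map (σ : L →* L))).ker) = (normUnits σ).index := by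
  rw [h.inf_ker_involDiff, ← Subgroup.index_comap]
  congr 1
  rw [Subgroup.comap_inf, normUnits, inf_eq_right]
  intro u _
  rw [Subgroup.mem_comap, range_unitsIncl]
  exact ⟨_, rfl⟩

lemma relIndex_pos : (((toPrincipalIdeal (𝓞 L) L).ker ⊓
      (involDiff (Units.map (σ : L →* L))).ker).map (powMonoidHom 2)).relIndex
      ((toPrincipalIdeal (𝓞 L) L).ker ⊓ (involDiff (Units.map (σ : L →* L))).ker) =
      2 ^ Units.rank K * 2 := by
  rw [h.inf_ker_involDiff, relIndex_map_pow_two _ (unitsIncl_injective.comp unitsExt_injective),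
    Units.finrank_eq, card_sq_eq_one_of_neg (MonoidHom.id _) Function.injective_id ⟨-1, rfl⟩]

lemma relIndex_neg : (((toPrincipalIdeal (𝓞 L) L).ker ⊓
      (involNorm (Units.map (σ : L →* L))).ker).map (powMonoidHom 2)).relIndex
      ((toPrincipalIdeal (𝓞 L) L).ker ⊓ (involNorm (Units.map (σ : L →* L))).ker) *
      2 ^ Units.rank K = 2 ^ Units.rank L * 2 := by
  set M := (involNorm (conjUnits σ)).ker with hM
  have h1 : (toPrincipalIdeal (𝓞 L) L).ker ⊓ (involNorm (Units.map (σ : L →* L))).ker =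
      ((unitsIncl L).comp M.subtype).range := by
    rw [range_unitsIncl]
    ext x
    rw [Subgroup.mem_inf, MonoidHom.mem_ker, involNorm_apply]
    constructor
    · rintro ⟨⟨u, rfl⟩, hu⟩
      refine ⟨⟨u, ?_⟩, rfl⟩
      rw [hM, MonoidHom.mem_ker, involNorm_apply]
      apply unitsIncl_injective
      exact Units.ext (congrArg Units.val hu)
    · rintro ⟨⟨u, hu⟩, rfl⟩
      refine ⟨⟨_, rfl⟩, ?_⟩
      rw [hM, MonoidHom.mem_ker, involNorm_apply] at hu
      have := congrArg (unitsIncl L) hu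
      exact Units.ext (congrArg Units.val this)
  have hfin : finrank ℤ (Additive M) + Units.rank K = Units.rank L := by
    rw [← Units.finrank_eq, ← Units.finrank_eq]
    exact finrank_ker_norm (MonoidHom.toAdditive (conjUnits σ)).toIntLinearMap
      (MonoidHom.toAdditive (unitsExt K L)).toIntLinearMap unitsExt_injective
      (fun u => by
        apply unitsIncl_injective
        ext1
        exact σ.commutes _)
      (fun u => by
        set w : (𝓞 L)ˣ := u.toMul * conjUnits σ u.toMul with hw
        have : unitsIncl L w ∈ ((unitsIncl L).comp (unitsExt K L)).range := by
          rw [← h.inf_ker_involDiff, range_unitsIncl, Subgroup.mem_inf]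
          refine ⟨⟨_, rfl⟩, ?_⟩
          rw [MonoidHom.mem_ker, involDiff_apply, div_eq_one]
          have h3 : conjUnits σ w = w := by
            rw [hw, map_mul, mul_comm]
            congr 1
            ext1
            exact h.mapAlgEquiv_invol _
          have := congrArg (unitsIncl L) h3
          exact Units.ext (congrArg Units.val this)
        obtain ⟨v, hv⟩ := this
        exact ⟨Additive.ofMul v, unitsIncl_injective hv⟩)
  have : Module.Finite ℤ (Additive M) := by
    have : Module.Finite ℤ (LinearMap.ker (LinearMap.id + (MonoidHom.toAdditive
      (conjUnits σ)).toIntLinearMap)) := inferInstance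
    exact this
  rw [h1, relIndex_map_pow_two _ (unitsIncl_injective.comp Subtype.val_injective),
    card_sq_eq_one_of_neg M.subtype Subtype.val_injective ⟨⟨-1, ?_⟩, rfl⟩, mul_right_comm, ← pow_add,
    hfin]
  rw [hM, MonoidHom.mem_ker, involNorm_apply]
  ext
  simp [conjUnits]

lemma relIndex_principal : ((involDiff (Units.map (σ : L →* L))).ker.map
      (toPrincipalIdeal (𝓞 L) L)).relIndex (involDiff (conjUnit σ)).ker =
      Nat.card (ClassGroup (𝓞 K)) * 2 ^ (ramPrimes K L).ncard := by
  have h1 : (involDiff (Units.map (σ : L →* L))).ker.map (toPrincipalIdeal (𝓞 L) L) =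
      (toPrincipalIdeal (𝓞 K) K).range.map (extUnit K L) := by
    rw [h.ker_involDiff, MonoidHom.map_range, MonoidHom.map_range]
    congr 1
    ext1 x
    exact (extUnit_toPrincipalIdeal x).symm
  have h2 : (extUnit K L).range ≤ (involDiff (conjUnit σ)).ker := by
    rw [h.range_extUnit]
    exact inf_le_right
  rw [h1, ← Subgroup.relIndex_mul_relIndex _ (extUnit K L).range _ (Subgroup.map_le_range _ _) h2,
    h.relIndex_range_extUnit, MonoidHom.range_eq_map (extUnit K L),
    Subgroup.relIndex_map_map_of_injective _ _ extUnit_injective, Subgroup.relIndex_top_right,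
    ← ker_clMk, Subgroup.index_ker, MonoidHom.range_eq_top.2 clMk_surjective, Subgroup.card_top]

lemma relIndex_ambiguous : (toPrincipalIdeal (𝓞 L) L).range.relIndex
      ((toPrincipalIdeal (𝓞 L) L).range.comap (involDiff (conjUnit σ))) =
      Nat.card (involDiff (conjCl σ)).ker := by
  rw [← ker_clMk, Subgroup.relIndex_ker]
  have : (clMk L).ker.comap (involDiff (conjUnit σ)) =
      (involDiff (conjCl σ)).ker.comap (clMk L) := by
    ext J
    rw [Subgroup.mem_comap, MonoidHom.mem_ker, Subgroup.mem_comap, MonoidHom.mem_ker,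
      involDiff_apply, involDiff_apply, map_div, conjCl_mk]
  rw [this, Subgroup.map_comap_eq_self_of_surjective clMk_surjective]

/-- Chevalley's ambiguous class number formula for quadratic extensions. -/
theorem chevalley : Nat.card (involDiff (conjCl σ)).ker * (normUnits σ).index * 2 ^ Units.rank L =
    Nat.card (ClassGroup (𝓞 K)) * 2 ^ ((ramPrimes K L).ncard + 2 * Units.rank K) := by
  have key := abstract_ambiguous_formula (Units.map (σ : L →* L))
    (fun x => Units.ext (h.invol x.1)) (conjUnit σ) h.conjUnit_conjUnit
    (toPrincipalIdeal (𝓞 L) L) (fun x => (conjUnit_toPrincipalIdeal σ x).symm)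
    h.exists_unit_div h.exists_frac_div
  rw [h.relIndex_ambiguous, h.relIndex_norm, h.relIndex_pos, h.relIndex_principal] at key
  have key2 := h.relIndex_neg
  rw [pow_add, mul_comm 2 (Units.rank K), pow_mul]
  set r := (((toPrincipalIdeal (𝓞 L) L).ker ⊓
      (involNorm (Units.map (σ : L →* L))).ker).map (powMonoidHom 2)).relIndex
      ((toPrincipalIdeal (𝓞 L) L).ker ⊓ (involNorm (Units.map (σ : L →* L))).ker)
  have : (Nat.card (involDiff (conjCl σ)).ker * (normUnits σ).index * 2 ^ Units.rank L) * 2 =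
    (Nat.card (ClassGroup (𝓞 K)) * (2 ^ ((ramPrimes K L).ncard) * (2 ^ Units.rank K) ^ 2)) * 2 := by
    calc _ = Nat.card (involDiff (conjCl σ)).ker * (normUnits σ).index *
          (2 ^ Units.rank L * 2) := by ring
      _ = (Nat.card (involDiff (conjCl σ)).ker * (normUnits σ).index * r) * 2 ^ Units.rank K := by
          rw [← key2]; ring
      _ = _ := by rw [key]; ring
  exact Nat.eq_of_mul_eq_mul_right two_pos this

end IsQuadInvol

end Chevalley

section InvolutionsOnFiniteGroups

variable {G : Type*} [CommGroup G] [Finite G]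

/-- If the group of fixed points of an involution has odd order, the group has odd order. -/
lemma odd_card_of_odd_card_fixed (s : G →* G) (hs : ∀ x, s (s x) = x)
    (hodd : (Nat.card (involDiff s).ker).factorization 2 = 0) :
    (Nat.card G).factorization 2 = 0 := by
  rw [Nat.factorization_eq_zero_iff] at hodd ⊢
  have hF : ¬ 2 ∣ Nat.card (involDiff s).ker := by
    rcases hodd with h | h | h
    · exact absurd Nat.prime_two h
    · exact h
    · exact absurd h Nat.card_pos.ne'
  refine .inr (.inl fun h2 => hF ?_)
  have : Fact (Nat.Prime 2) := ⟨Nat.prime_two⟩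
  obtain ⟨x, hx⟩ := exists_prime_orderOf_dvd_card' (G := G) 2 h2
  have hx2 : x ^ 2 = 1 := hx ▸ pow_orderOf_eq_one x
  have hx1 : x ≠ 1 := by
    rintro rfl
    simp at hx
  have key : ∀ y : G, y ^ 2 = 1 → y ≠ 1 → s y = y → 2 ∣ Nat.card (involDiff s).ker := by
    intro y h2 h1 hy
    have hy' : y ∈ (involDiff s).ker := by
      rw [MonoidHom.mem_ker, involDiff_apply, hy, div_self']
    have := orderOf_dvd_natCard (⟨y, hy'⟩ : (involDiff s).ker)
    rwa [Subgroup.orderOf_mk, orderOf_eq_prime h2 h1] at this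
  by_cases hxs : x * s x = 1
  · apply key x hx2 hx1
    have h3 : s x = x⁻¹ := eq_inv_of_mul_eq_one_right hxs
    rw [h3, inv_eq_iff_mul_eq_one, ← pow_two, hx2]
  · apply key _ _ hxs
    · rw [map_mul, hs, mul_comm]
    · rw [mul_pow, ← map_pow, hx2, map_one, one_mul]

lemma factorization_card_fixed_eq (s : G →* G)
    (hs : ∀ (x : G) (k : ℕ), x ^ 2 ^ k = 1 → s x = x) :
    (Nat.card (involDiff s).ker).factorization 2 = (Nat.card G).factorization 2 := by
  have : Fact (Nat.Prime 2) := ⟨Nat.prime_two⟩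
  obtain ⟨P⟩ : Nonempty (Sylow 2 G) := inferInstance
  apply le_antisymm
  · exact (Nat.factorization_le_iff_dvd Nat.card_pos.ne' Nat.card_pos.ne').2
      (Subgroup.card_subgroup_dvd_card _) 2
  · have hP : (P : Subgroup G) ≤ (involDiff s).ker := by
      intro x hx
      obtain ⟨k, hk⟩ := P.2 ⟨x, hx⟩
      rw [MonoidHom.mem_ker, involDiff_apply, hs x k (congrArg Subtype.val hk), div_self']
    have h1 := Subgroup.card_dvd_of_le hP
    rw [P.card_eq_multiplicity] at h1
    exact (Nat.Prime.pow_dvd_iff_le_factorization Nat.prime_two Nat.card_pos.ne').1 h1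

lemma isCyclic_of_card_sq_eq_one_le (A : Type*) [CommGroup A] [Finite A] (hA : IsPGroup 2 A)
    (h : Nat.card {x : A // x ^ 2 = 1} ≤ 2) : IsCyclic A := by
  classical
  have := Fintype.ofFinite A
  have hk : ∀ k, Nat.card (powMonoidHom (2 ^ k) : A →* A).ker ≤ 2 ^ k := by
    intro k
    induction k with
    | zero =>
      rw [pow_zero, Finite.card_le_one_iff_subsingleton]
      refine ⟨fun a b => Subtype.ext ?_⟩
      have ha := a.2
      have hb := b.2
      simp only [MonoidHom.mem_ker, powMonoidHom_apply, pow_one] at ha hb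
      rw [ha, hb]
    | succ k ih =>
      let f : (powMonoidHom (2 ^ (k + 1)) : A →* A).ker →* A :=
        (powMonoidHom 2).comp (Subgroup.subtype _)
      have h1 := Subgroup.card_mul_index f.ker
      rw [Subgroup.index_ker] at h1
      have h2 : Nat.card f.range ≤ 2 ^ k := by
        refine le_trans (Nat.card_le_card_of_injective (Subgroup.inclusion (?_ : f.range ≤
          (powMonoidHom (2 ^ k) : A →* A).ker)) (Subgroup.inclusion_injective _)) ih
        rintro _ ⟨x, rfl⟩
        have hx := x.2
        rw [MonoidHom.mem_ker, powMonoidHom_apply] at hx ⊢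
        change (x.1 ^ 2) ^ 2 ^ k = 1
        rw [← pow_mul, ← pow_succ', hx]
      have h3 : Nat.card f.ker ≤ 2 := by
        refine le_trans (Nat.card_le_card_of_injective (fun x : f.ker =>
          (⟨x.1.1, x.2⟩ : {x : A // x ^ 2 = 1})) ?_) h
        intro a b hab
        exact Subtype.ext (Subtype.ext (congrArg (fun x : {x : A // x ^ 2 = 1} => x.1) hab))
      calc _ = Nat.card f.ker * Nat.card f.range := h1.symm
        _ ≤ 2 * 2 ^ k := Nat.mul_le_mul h3 h2
        _ = 2 ^ (k + 1) := (pow_succ' 2 k).symm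
  apply isCyclic_of_card_pow_eq_one_le
  intro n hn
  obtain ⟨k, r, hr, rfl⟩ := Nat.exists_eq_two_pow_mul_odd hn.ne'
  have h1 : (Finset.univ.filter fun a : A => a ^ (2 ^ k * r) = 1).card ≤
      Nat.card (powMonoidHom (2 ^ k) : A →* A).ker := by
    rw [← Fintype.card_subtype, ← Nat.card_eq_fintype_card]
    refine Nat.card_le_card_of_injective (fun x => ⟨x.1, ?_⟩) fun a b hab =>
      Subtype.ext (congrArg (fun x : (powMonoidHom (2 ^ k) : A →* A).ker => x.1) hab)
    rw [MonoidHom.mem_ker, powMonoidHom_apply, ← orderOf_dvd_iff_pow_eq_one]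
    obtain ⟨j, hj⟩ := hA x.1
    have h2 := (Nat.dvd_prime_pow Nat.prime_two).1 (orderOf_dvd_of_pow_eq_one hj)
    obtain ⟨l, -, hl⟩ := h2
    have h3 := orderOf_dvd_of_pow_eq_one x.2
    refine Nat.Coprime.dvd_of_dvd_mul_right ?_ h3
    rw [hl]
    exact Nat.Coprime.pow_left _ (Nat.coprime_two_left.2 hr)
  refine h1.trans ((hk k).trans ?_)
  exact Nat.le_mul_of_pos_right _ hr.pos

lemma mem_sylow_of_pow_eq_one (P : Sylow 2 G) {x : G} {k : ℕ} (hx : x ^ 2 ^ k = 1) :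
    x ∈ (P : Subgroup G) := by
  have : Fact (Nat.Prime 2) := ⟨Nat.prime_two⟩
  have h : IsPGroup 2 (Subgroup.zpowers x) := by
    rintro ⟨_, j, rfl⟩
    refine ⟨k, Subtype.ext ?_⟩
    change (x ^ j) ^ 2 ^ k = 1
    rw [← zpow_natCast, zpow_comm, zpow_natCast, hx, one_zpow]
  obtain ⟨Q, hQ⟩ := h.exists_le_sylow
  have := Sylow.unique_of_normal P inferInstance
  rw [Subsingleton.elim P Q]
  exact hQ (Subgroup.mem_zpowers x)

/-- A cyclic Sylow `2`-subgroup on which the norm of an involution is small but the fixed part is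
large. -/
theorem card_sylow_of_isCyclic (P : Sylow 2 G) (hP : IsCyclic P) (s : G →* G) (R : Subgroup G)
    (hsR : ∀ c, c * s c ∈ R) (m : ℕ) (hm : 2 ≤ m)
    (hR : (Nat.card R).factorization 2 ≤ m - 1)
    (hF : m ≤ (Nat.card (involDiff s).ker).factorization 2) : Nat.card P = 2 ^ m := by
  have : Fact (Nat.Prime 2) := ⟨Nat.prime_two⟩
  obtain ⟨⟨g, hgP⟩, hg⟩ := hP.exists_generator
  obtain ⟨n, hn⟩ := IsPGroup.iff_card.1 P.2
  have hgn : orderOf g = 2 ^ n := by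
    rw [← Subgroup.orderOf_mk _ hgP, ← hn, orderOf_eq_card_of_forall_mem_zpowers hg]
  have hgen : ∀ x ∈ (P : Subgroup G), ∃ a : ℕ, g ^ a = x := by
    intro x hx
    obtain ⟨a, ha⟩ := mem_powers_iff_mem_zpowers.2 (hg ⟨x, hx⟩)
    exact ⟨a, Subtype.ext_iff.1 ha⟩
  have hnG : n = (Nat.card G).factorization 2 := by
    have := P.card_eq_multiplicity
    rw [hn] at this
    exact Nat.pow_right_injective le_rfl this
  have hmn : m ≤ n := by
    rw [hnG]
    exact hF.trans ((Nat.factorization_le_iff_dvd Nat.card_pos.ne' Nat.card_pos.ne').2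
      (Subgroup.card_subgroup_dvd_card _) 2)
  obtain ⟨e, he⟩ := hgen (s g) (mem_sylow_of_pow_eq_one P (k := n) (by
    rw [← map_pow, ← hgn, pow_orderOf_eq_one, map_one]))
  have hz : ∃ z : G, s z = z ∧ orderOf z = 2 ^ m := by
    obtain ⟨H, hH⟩ := Sylow.exists_subgroup_card_pow_prime (G := (involDiff s).ker) 2
      ((Nat.Prime.pow_dvd_iff_le_factorization Nat.prime_two Nat.card_pos.ne').2 hF)
    have hHP : ∀ x : H, (x.1.1 : G) ∈ (P : Subgroup G) := fun x =>
      mem_sylow_of_pow_eq_one P (k := m) (by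
        have := pow_card_eq_one' (x := x)
        rw [hH] at this
        exact Subtype.ext_iff.1 (Subtype.ext_iff.1 this))
    let f : H →* P := ((Subgroup.subtype _).comp (Subgroup.subtype H)).codRestrict _ hHP
    have hf : Function.Injective f := fun a b hab =>
      Subtype.ext (Subtype.ext (congrArg (fun x : (P : Subgroup G) => x.1) hab))
    have hHc : IsCyclic H := isCyclic_of_injective f hf
    obtain ⟨z, hz⟩ := hHc.exists_generator
    refine ⟨z.1.1, ?_, ?_⟩
    · have := z.1.2
      rwa [MonoidHom.mem_ker, involDiff_apply, div_eq_one] at this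
    · rw [← hH, ← orderOf_eq_card_of_forall_mem_zpowers hz, Subgroup.orderOf_coe,
        Subgroup.orderOf_coe]
  obtain ⟨z, hz1, hz2⟩ := hz
  obtain ⟨a, rfl⟩ := hgen z (mem_sylow_of_pow_eq_one P (k := m) (by
    rw [← hz2, pow_orderOf_eq_one]))
  have h1 : (g ^ a) ^ e = (g ^ a) ^ 1 := by
    rw [pow_one, ← pow_mul, mul_comm, pow_mul, he, ← map_pow, hz1]
  have h4 : e ≡ 1 [MOD 4] := by
    rw [pow_eq_pow_iff_modEq, hz2] at h1
    exact h1.of_dvd (pow_dvd_pow 2 hm)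
  have hgcd : Nat.gcd (2 ^ n) (e + 1) = 2 := by
    obtain ⟨c, hc⟩ : ∃ c, e + 1 = 2 * (2 * c + 1) := ⟨(e - 1) / 4, by
      have : e % 4 = 1 := h4
      omega⟩
    rw [hc, show n = (n - 1) + 1 by omega, pow_succ', Nat.gcd_mul_left,
      (Nat.Coprime.pow_left (n - 1) (by simp) : Nat.Coprime (2 ^ (n - 1)) (2 * c + 1)).gcd_eq_one]
  have h5 : g ^ (e + 1) ∈ R := by
    have := hsR g
    rwa [← he, ← pow_succ'] at this
  have h6 : orderOf (g ^ (e + 1)) = 2 ^ (n - 1) := by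
    rw [orderOf_pow, hgn, hgcd, show n = (n - 1) + 1 by omega, pow_succ]
    simp
  have h7 : 2 ^ (n - 1) ∣ Nat.card R := by
    rw [← h6, ← Subgroup.orderOf_mk _ h5]
    exact orderOf_dvd_natCard _
  have h8 := (Nat.Prime.pow_dvd_iff_le_factorization Nat.prime_two Nat.card_pos.ne').1 h7
  rw [hn, show n = m by omega]

end InvolutionsOnFiniteGroups

section ClassGroupParity

open Module nonZeroDivisors IsDedekindDomain

/-- The exponent of `2` in the class number. -/
def cl2 (K : Type*) [Field K] [NumberField K] : ℕ :=
  (Nat.card (ClassGroup (𝓞 K))).factorization 2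

variable {K K' K'' L : Type*} [Field K] [Field K'] [Field K''] [Field L] [NumberField K]
  [NumberField K'] [NumberField K''] [NumberField L] [Algebra K L] [Algebra K' L] [Algebra K'' L]

/-- The exponent of `2` in the number of ambiguous classes. -/
def amb2 (σ : L ≃ₐ[K] L) : ℕ :=
  (Nat.card (involDiff (conjCl σ)).ker).factorization 2

lemma conjCl_idealUnit (σ : L ≃ₐ[K] L) {I : Ideal (𝓞 L)} (hI : I ≠ ⊥)
    (hI' : conjIdeal σ I ≠ ⊥) :
    conjCl σ (clMk L (idealUnit hI)) = clMk L (idealUnit hI') := by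
  rw [conjCl_mk]
  congr 1
  ext1
  exact conjFrac_coe σ I

lemma conjCl_comp (σ : L ≃ₐ[K] L) (σ' : L ≃ₐ[K'] L) (σ'' : L ≃ₐ[K''] L)
    (h : IsQuadInvol σ) (h' : IsQuadInvol σ') (h'' : IsQuadInvol σ'')
    (hc : ∀ x, σ (σ' x) = σ'' x) (c : ClassGroup (𝓞 L)) :
    conjCl σ (conjCl σ' c) = conjCl σ'' c := by
  obtain ⟨I, hI, rfl⟩ := exists_idealUnit c
  have h1 := h'.conjIdeal_ne_bot hI
  have h2 := h.conjIdeal_ne_bot h1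
  have h3 := h''.conjIdeal_ne_bot hI
  rw [conjCl_idealUnit σ' hI h1, conjCl_idealUnit σ h1 h2, conjCl_idealUnit σ'' hI h3]
  have : conjIdeal σ (conjIdeal σ' I) = conjIdeal σ'' I := by
    rw [conjIdeal_apply, conjIdeal_apply, conjIdeal_apply, Ideal.map_map]
    congr 1
    ext x
    exact hc _
  congr 2
  
namespace IsQuadInvol

variable {σ : L ≃ₐ[K] L} (h : IsQuadInvol σ)
include h

lemma index_normUnits_ne_zero : (normUnits σ).index ≠ 0 := by
  intro h0
  have := h.chevalley
  rw [h0, mul_zero, zero_mul] at this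
  simp at this

lemma amb2_add : amb2 σ + (normUnits σ).index.factorization 2 + Units.rank L =
    cl2 K + ((ramPrimes K L).ncard + 2 * Units.rank K) := by
  have key := congrArg (fun n => n.factorization 2) h.chevalley
  have h0 := h.index_normUnits_ne_zero
  have h1 : Nat.card (involDiff (conjCl σ)).ker ≠ 0 := Nat.card_pos.ne'
  have h2 : Nat.card (ClassGroup (𝓞 K)) ≠ 0 := Nat.card_pos.ne'
  unfold amb2 cl2
  generalize Nat.card (involDiff (conjCl σ)).ker = a at *
  generalize Nat.card (ClassGroup (𝓞 K)) = b at *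
  simpa [Nat.factorization_mul, h0, h1, h2, Nat.prime_two.factorization_self] using key

lemma sq_mem_normUnits (u : (𝓞 K)ˣ) : u ^ 2 ∈ normUnits σ := by
  rw [mem_normUnits]
  refine ⟨algebraMap K L (u : K), ?_⟩
  rw [σ.commutes, ← map_mul]
  congr 1
  simp [pow_two]

omit h in
lemma _root_.index_units_sq (K : Type*) [Field K] [NumberField K] :
    (powMonoidHom 2 : (𝓞 K)ˣ →* (𝓞 K)ˣ).range.index = 2 ^ (Units.rank K + 1) := by
  have := relIndex_map_pow_two (MonoidHom.id (𝓞 K)ˣ) Function.injective_id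
  rwa [Units.finrank_eq, card_sq_eq_one_of_neg (MonoidHom.id _) Function.injective_id ⟨-1, rfl⟩,
    ← pow_succ, MonoidHom.range_eq_top.2 Function.surjective_id, Subgroup.relIndex_top_right,
    ← MonoidHom.range_eq_map] at this

lemma range_pow_le : (powMonoidHom 2 : (𝓞 K)ˣ →* (𝓞 K)ˣ).range ≤ normUnits σ := by
  rintro _ ⟨u, rfl⟩
  exact h.sq_mem_normUnits u

lemma exists_index : ∃ j ≤ Units.rank K + 1, (normUnits σ).index = 2 ^ j := by
  have := Subgroup.index_dvd_of_le h.range_pow_le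
  rw [index_units_sq] at this
  exact (Nat.dvd_prime_pow Nat.prime_two).1 this

lemma index_le_of_neg_one (h1 : (-1 : (𝓞 K)ˣ) ∈ normUnits σ) (h2 : ∀ x : K, x ^ 2 ≠ -1) :
    (normUnits σ).index.factorization 2 ≤ Units.rank K := by
  obtain ⟨j, hj, hj2⟩ := h.exists_index
  rw [hj2, Nat.prime_two.factorization_pow, Finsupp.single_eq_same]
  by_contra! hlt
  have h3 : j = Units.rank K + 1 := by omega
  have h4 : (powMonoidHom 2 : (𝓞 K)ˣ →* (𝓞 K)ˣ).range.relIndex (normUnits σ) = 1 := by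
    have := Subgroup.relIndex_mul_index h.range_pow_le
    rw [index_units_sq, hj2, h3] at this
    exact Nat.eq_of_mul_eq_mul_right (pow_pos two_pos (Units.rank K + 1)) (by rw [this, one_mul])
  rw [Subgroup.relIndex_eq_one] at h4
  obtain ⟨u, hu⟩ := h4 h1
  refine h2 (u : K) ?_
  have := congrArg (fun v : (𝓞 K)ˣ => ((v : 𝓞 K) : K)) hu
  simpa using this

lemma one_le_index (u : (𝓞 K)ˣ) (hu : u ∉ normUnits σ) :
    1 ≤ (normUnits σ).index.factorization 2 := by
  obtain ⟨j, hj, hj2⟩ := h.exists_index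
  rw [hj2, Nat.prime_two.factorization_pow, Finsupp.single_eq_same]
  by_contra! hlt
  rw [Nat.lt_one_iff.1 hlt, pow_zero, Subgroup.index_eq_one] at hj2
  exact hu (hj2 ▸ Subgroup.mem_top u)

lemma cl2_eq_zero (h0 : amb2 σ = 0) : cl2 L = 0 :=
  odd_card_of_odd_card_fixed (conjCl σ) h.conjCl_conjCl h0

lemma amb2_le : amb2 σ ≤ cl2 L :=
  (Nat.factorization_le_iff_dvd Nat.card_pos.ne' Nat.card_pos.ne').2
      (Subgroup.card_subgroup_dvd_card _) 2

lemma conjCl_eq_inv (h0 : cl2 K = 0) (c : ClassGroup (𝓞 L)) (k : ℕ) (hc : c ^ 2 ^ k = 1) :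
    conjCl σ c = c⁻¹ := by
  have h1 := h.mul_conjCl_mem c
  have h2 : (c * conjCl σ c) ^ 2 ^ k = 1 := by
    rw [mul_pow, ← map_pow, hc, map_one, one_mul]
  have h3 : orderOf (c * conjCl σ c) ∣ Nat.card (ClassGroup (𝓞 K)) := by
    refine dvd_trans ?_ (Subgroup.card_range_dvd (extCl K L))
    rw [← Subgroup.orderOf_mk _ h1]
    exact orderOf_dvd_natCard _
  have h4 : Nat.Coprime (2 ^ k) (Nat.card (ClassGroup (𝓞 K))) := by
    refine Nat.Coprime.pow_left _ ((Nat.prime_two.coprime_iff_not_dvd).2 fun hd => ?_)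
    have := (Nat.prime_two.dvd_iff_one_le_factorization Nat.card_pos.ne').1 hd
    rw [cl2] at h0
    omega
  have h5 := Nat.eq_one_of_dvd_coprimes h4 (orderOf_dvd_of_pow_eq_one h2) h3
  rw [orderOf_eq_one_iff] at h5
  exact eq_inv_of_mul_eq_one_right h5

omit h in
lemma amb2_eq (h : IsQuadInvol σ) {σ' : L ≃ₐ[K'] L} {σ'' : L ≃ₐ[K''] L} (h' : IsQuadInvol σ')
    (h'' : IsQuadInvol σ'') (h0' : cl2 K' = 0) (h0'' : cl2 K'' = 0)
    (hc : ∀ x, σ' (σ'' x) = σ x) : amb2 σ = cl2 L := by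
  refine factorization_card_fixed_eq (conjCl σ) fun x k hx => ?_
  rw [← conjCl_comp σ' σ'' σ h' h'' h hc, h''.conjCl_eq_inv h0'' x k hx, map_inv,
    h'.conjCl_eq_inv h0' x k hx, inv_inv]

lemma isCyclic_sylow (h0 : cl2 K = 0) (h1 : amb2 σ ≤ 1) (P : Sylow 2 (ClassGroup (𝓞 L))) :
    IsCyclic P := by
  have : Fact (Nat.Prime 2) := ⟨Nat.prime_two⟩
  refine isCyclic_of_card_sq_eq_one_le P P.2 ?_
  let f : (powMonoidHom 2 : P →* P).ker →* (involDiff (conjCl σ)).ker :=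
    ((Subgroup.subtype _).comp (Subgroup.subtype _)).codRestrict _ (by
      intro x
      have hx : (x.1.1 : ClassGroup (𝓞 L)) ^ 2 = 1 := congrArg Subtype.val x.2
      have h2 := h.conjCl_eq_inv h0 _ 1 hx
      change x.1.1 ∈ _
      rw [MonoidHom.mem_ker, involDiff_apply, h2, div_eq_one, inv_eq_iff_mul_eq_one, ← pow_two, hx])
  have hf : Function.Injective f := fun a b hab =>
    Subtype.ext (Subtype.ext (congrArg (fun x : (involDiff (conjCl σ)).ker => x.1) hab))
  have h2 := Subgroup.card_dvd_of_injective f hf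
  obtain ⟨j, hj⟩ := IsPGroup.iff_card.1 (P.2.to_subgroup (powMonoidHom 2 : P →* P).ker)
  rw [hj, Nat.prime_two.pow_dvd_iff_le_factorization Nat.card_pos.ne'] at h2
  change Nat.card (powMonoidHom 2 : P →* P).ker ≤ 2
  rw [hj]
  calc 2 ^ j ≤ 2 ^ 1 := Nat.pow_le_pow_right two_pos (h2.trans h1)
    _ = 2 := pow_one 2

lemma card_sylow (m : ℕ) (hm : 2 ≤ m) (hK : cl2 K ≤ m - 1) (hF : m ≤ amb2 σ)
    (P : Sylow 2 (ClassGroup (𝓞 L))) (hP : IsCyclic P) : Nat.card P = 2 ^ m := by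
  refine card_sylow_of_isCyclic P hP (conjCl σ) _ h.mul_conjCl_mem m hm (le_trans ?_ hK) hF
  exact (Nat.factorization_le_iff_dvd Nat.card_pos.ne' Nat.card_pos.ne').2
      (Subgroup.card_range_dvd _) 2

end IsQuadInvol

end ClassGroupParity

section UnitIndexFromSubfield

variable {F K M L : Type*} [Field F] [Field K] [Field M] [Field L] [NumberField F]
  [NumberField K] [NumberField M] [NumberField L] [Algebra F K] [Algebra F M] [Algebra K L]

lemma index_normUnits_le_two {σ : L ≃ₐ[K] L} {τ : M ≃ₐ[F] M} (hσ : IsQuadInvol σ)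
    (hτ : IsQuadInvol τ) (j : M →+* L)
    (hj : ∀ x, j (algebraMap F M x) = algebraMap K L (algebraMap F K x))
    (hjσ : ∀ x, j (τ x) = σ (j x)) (hr : Units.rank F = Units.rank K)
    (hidx : (normUnits τ).index.factorization 2 ≤ 1)
    (hsq : ∀ (u : F) (y : K), y ^ 2 = algebraMap F K u → ∃ a : F, a ^ 2 = u ∨ a ^ 2 = -u) :
    (normUnits σ).index.factorization 2 ≤ 2 := by
  set φ := unitsExt F K
  set S := (powMonoidHom 2 : (𝓞 K)ˣ →* (𝓞 K)ˣ).range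
  set S₀ := (powMonoidHom 2 : (𝓞 F)ˣ →* (𝓞 F)ˣ).range
  have hS₀ : S₀.index = 2 ^ (Units.rank K + 1) := by rw [← hr]; exact index_units_sq F
  have hS : S.index = 2 ^ (Units.rank K + 1) := index_units_sq K
  have hN : normUnits τ ≤ (normUnits σ).comap φ := by
    intro u hu
    rw [mem_normUnits] at hu
    obtain ⟨y, hy⟩ := hu
    rw [Subgroup.mem_comap, mem_normUnits]
    refine ⟨j y, ?_⟩
    rw [← hjσ, ← map_mul, hy, hj]
    rfl
  obtain ⟨a, ha, ha2⟩ := hτ.exists_index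
  obtain ⟨b, hb, hb2⟩ := hσ.exists_index
  rw [ha2, Nat.prime_two.factorization_pow, Finsupp.single_eq_same] at hidx
  rw [hb2, Nat.prime_two.factorization_pow, Finsupp.single_eq_same]
  have hN' : ((normUnits σ).comap φ).index ≤ 2 := by
    refine (Nat.le_of_dvd (Nat.pos_of_ne_zero hτ.index_normUnits_ne_zero)
      (Subgroup.index_dvd_of_le hN)).trans ?_
    rw [ha2]
    exact (Nat.pow_le_pow_right two_pos hidx).trans (pow_one 2).le
  have hS₀S : S₀ ≤ S.comap φ := by
    rintro _ ⟨u, rfl⟩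
    exact ⟨φ u, (map_pow φ u 2).symm⟩
  have hS₀S' : S₀.relIndex (S.comap φ) ≤ 2 := by
    have h1 : S.comap φ ≤ S₀ ⊔ Subgroup.zpowers (-1) := by
      rintro u ⟨y, hy⟩
      have hy' : ((y : 𝓞 K) : K) ^ 2 = algebraMap F K ((u : 𝓞 F) : F) := by
        exact congrArg (fun v : (𝓞 K)ˣ => ((v : 𝓞 K) : K)) hy
      obtain ⟨a, ha⟩ := hsq _ _ hy'
      have key : ∀ w : (𝓞 F)ˣ, a ^ 2 = ((w : 𝓞 F) : F) → w ∈ S₀ := by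
        intro w hw
        have hai : IsIntegral ℤ a :=
          IsIntegral.of_pow two_pos (hw ▸ RingOfIntegers.isIntegral_coe _)
        obtain ⟨a', ha'⟩ : ∃ a' : 𝓞 F, (a' : F) = a := ⟨⟨a, hai⟩, rfl⟩
        have h2 : a' ^ 2 = w := by
          ext
          rw [← hw, ← ha']
          simp
        have h3 : IsUnit a' := isUnit_pow_iff two_ne_zero |>.1 (h2 ▸ w.isUnit)
        exact ⟨h3.unit, Units.ext h2⟩
      rcases ha with ha | ha
      · exact Subgroup.mem_sup_left (key u ha)
      · have h4 := key (-u) (by simpa using ha)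
        have : u = -u * -1 := by simp
        rw [this]
        exact Subgroup.mul_mem_sup h4 (Subgroup.mem_zpowers _)
    have h5 : S₀.relIndex (S₀ ⊔ Subgroup.zpowers (-1)) ≤ 2 := by
      rw [sup_comm, Subgroup.relIndex_sup_right]
      have h6 : Nat.card (Subgroup.zpowers (-1 : (𝓞 F)ˣ)) = orderOf (-1 : (𝓞 F)ˣ) :=
        Nat.card_zpowers _
      have h7 : 0 < orderOf (-1 : (𝓞 F)ˣ) :=
        orderOf_pos_iff.2 (isOfFinOrder_iff_pow_eq_one.2 ⟨2, two_pos, by simp⟩)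
      refine (Nat.le_of_dvd (h6 ▸ h7) (Subgroup.relIndex_dvd_card _ _)).trans ?_
      rw [h6]
      exact orderOf_le_of_pow_eq_one two_pos (by simp)
    refine le_trans (Subgroup.relIndex_le_of_le_right h1 ?_) h5
    intro h0
    have := Subgroup.relIndex_mul_index (le_sup_left : S₀ ≤ S₀ ⊔ Subgroup.zpowers (-1))
    rw [h0, zero_mul, hS₀] at this
    exact absurd this.symm (by positivity)
  have h1 := Subgroup.relIndex_mul_index hS₀S
  have hSN : S ≤ normUnits σ := hσ.range_pow_le
  have hSN' : S.comap φ ≤ (normUnits σ).comap φ := Subgroup.comap_mono hSN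
  have h2 := Subgroup.relIndex_mul_index hSN
  have h3 := Subgroup.relIndex_mul_index hSN'
  have h4 : (S.comap φ).relIndex ((normUnits σ).comap φ) ≤ S.relIndex (normUnits σ) := by
    rw [Subgroup.relIndex_comap]
    refine Subgroup.relIndex_le_of_le_right (Subgroup.map_comap_le _ _) fun h0 => ?_
    rw [h0, zero_mul, hS] at h2
    exact absurd h2.symm (by positivity)
  rw [hS₀] at h1
  rw [hS, hb2] at h2
  have h5 : 2 ^ (Units.rank K + 1) * 2 ^ b ≤ 2 ^ (Units.rank K + 1) * 2 ^ 2 := by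
    calc 2 ^ (Units.rank K + 1) * 2 ^ b =
          S₀.relIndex (S.comap φ) * ((S.comap φ).relIndex ((normUnits σ).comap φ) *
            ((normUnits σ).comap φ).index) * 2 ^ b := by rw [h3, h1]
      _ ≤ 2 * (S.relIndex (normUnits σ) * 2) * 2 ^ b := by gcongr
      _ = (S.relIndex (normUnits σ) * 2 ^ b) * 2 ^ 2 := by ring
      _ = 2 ^ (Units.rank K + 1) * 2 ^ 2 := by rw [h2]
  have h6 := Nat.le_of_mul_le_mul_left h5 (by positivity)
  exact (Nat.pow_le_pow_iff_right one_lt_two).1 h6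

end UnitIndexFromSubfield

section PrimesAbove

open Module IsDedekindDomain

variable {K : Type*} [Field K] [NumberField K]

/-- The primes of `K` above `ℓ`. -/
def primesAbove (K : Type*) [Field K] [NumberField K] (ℓ : ℕ) : Set (HeightOneSpectrum (𝓞 K)) :=
  {P | (ℓ : 𝓞 K) ∈ P.asIdeal}

lemma prod_absNorm_le {ℓ : ℕ} (hℓ : ℓ ≠ 0) (S : Finset (HeightOneSpectrum (𝓞 K)))
    (e : HeightOneSpectrum (𝓞 K) → ℕ) (hS : ∀ P ∈ S, (ℓ : 𝓞 K) ∈ P.asIdeal ^ e P) :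
    ∏ P ∈ S, P.asIdeal.absNorm ^ e P ≤ ℓ ^ finrank ℚ K := by
  have h1 : ∏ P ∈ S, P.asIdeal ^ e P ∣ Ideal.span {(ℓ : 𝓞 K)} := by
    apply Finset.prod_dvd_of_coprime
    · intro P _ Q _ hPQ
      have := P.isMaximal
      have := Q.isMaximal
      exact (Ideal.isCoprime_of_isMaximal fun h => hPQ (HeightOneSpectrum.ext h)).pow
    · intro P hP
      rw [Ideal.dvd_span_singleton]
      exact hS P hP
  have h2 := Ideal.absNorm_dvd_absNorm_of_le (Ideal.le_of_dvd h1)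
  rw [Ideal.absNorm_span_natCast, map_prod, RingOfIntegers.rank] at h2
  simp only [map_pow] at h2
  exact Nat.le_of_dvd (pow_pos (Nat.pos_of_ne_zero hℓ) _) h2

lemma primesAbove_finite {ℓ : ℕ} (hℓ : ℓ ≠ 0) : (primesAbove K ℓ).Finite := by
  have : {P : HeightOneSpectrum (𝓞 K) | P.asIdeal ∣ Ideal.span {(ℓ : 𝓞 K)}}.Finite :=
    Ideal.finite_factors (by simpa using hℓ)
  refine this.subset fun P hP => ?_
  rw [Set.mem_ofPred_eq, Ideal.dvd_span_singleton]
  exact hP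

lemma two_le_absNorm (P : HeightOneSpectrum (𝓞 K)) : 2 ≤ P.asIdeal.absNorm := by
  have h0 : P.asIdeal.absNorm ≠ 0 := fun h => P.ne_bot (Ideal.absNorm_eq_zero_iff.1 h)
  have h1 : P.asIdeal.absNorm ≠ 1 := fun h => P.isPrime.ne_top (Ideal.absNorm_eq_one_iff.1 h)
  omega

lemma not_mem_of_coprime (P : HeightOneSpectrum (𝓞 K)) {ℓ n : ℕ} (hP : P ∈ primesAbove K ℓ)
    (hn : Nat.Coprime ℓ n) : (n : 𝓞 K) ∉ P.asIdeal := by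
  intro h
  have h1 := Nat.isCoprime_iff_coprime.2 hn
  obtain ⟨a, b, hab⟩ := h1
  apply P.isPrime.ne_top
  rw [Ideal.eq_top_iff_one]
  have h2 : (1 : 𝓞 K) = a * (ℓ : 𝓞 K) + b * (n : 𝓞 K) := by exact_mod_cast congrArg (Int.cast (R := 𝓞 K)) hab.symm
  rw [h2]
  exact add_mem (Ideal.mul_mem_left _ _ hP) (Ideal.mul_mem_left _ _ h)

lemma absNorm_eq_pow {ℓ : ℕ} (hℓ : ℓ.Prime) {P : HeightOneSpectrum (𝓞 K)}
    (hP : P ∈ primesAbove K ℓ) : ∃ f, 1 ≤ f ∧ P.asIdeal.absNorm = ℓ ^ f := by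
  have h1 := Ideal.absNorm_dvd_absNorm_of_le ((Ideal.span_singleton_le_iff_mem _).2 hP)
  rw [Ideal.absNorm_span_natCast] at h1
  obtain ⟨f, -, hf⟩ := (Nat.dvd_prime_pow hℓ).1 h1
  refine ⟨f, Nat.one_le_iff_ne_zero.2 ?_, hf⟩
  rintro rfl
  have := two_le_absNorm P
  rw [hf] at this
  simp at this

lemma le_absNorm {ℓ : ℕ} (hℓ : ℓ.Prime) {P : HeightOneSpectrum (𝓞 K)}
    (hP : P ∈ primesAbove K ℓ) : ℓ ^ 1 ≤ P.asIdeal.absNorm := by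
  obtain ⟨f, hf, h⟩ := absNorm_eq_pow hℓ hP
  rw [h]
  exact Nat.pow_le_pow_right hℓ.pos hf

/-- In a residue field of prime order every element is congruent to an integer. -/
lemma exists_int_sub_mem {ℓ : ℕ} (hℓ : ℓ.Prime) {P : HeightOneSpectrum (𝓞 K)}
    (hP : P.asIdeal.absNorm = ℓ) (w : 𝓞 K) : ∃ n : ℤ, w - n ∈ P.asIdeal := by
  have : Fact ℓ.Prime := ⟨hℓ⟩
  have h1 : Nat.card (𝓞 K ⧸ P.asIdeal) = ℓ := by
    rw [← hP]; rfl
  have : IsAddCyclic (𝓞 K ⧸ P.asIdeal) := isAddCyclic_of_prime_card h1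
  have h2 : (1 : 𝓞 K ⧸ P.asIdeal) ≠ 0 := by
    have := P.isPrime.ne_top
    have : Nontrivial (𝓞 K ⧸ P.asIdeal) := Ideal.Quotient.nontrivial_iff.2 this
    exact one_ne_zero
  have h3 := mem_zmultiples_of_prime_card (p := ℓ) h1 (g := (1 : 𝓞 K ⧸ P.asIdeal))
    (g' := Ideal.Quotient.mk _ w) h2
  obtain ⟨n, hn⟩ := h3
  refine ⟨n, ?_⟩
  rw [← Ideal.Quotient.eq, ← hn]
  simp

lemma sq_le_absNorm {ℓ : ℕ} (hℓ : ℓ.Prime) {P : HeightOneSpectrum (𝓞 K)}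
    (hP : P ∈ primesAbove K ℓ) (w : 𝓞 K) (b c : ℤ) (hw : w ^ 2 + b * w + c = 0)
    (hbc : ∀ n : ℤ, ¬ (ℓ : ℤ) ∣ n ^ 2 + b * n + c) : ℓ ^ 2 ≤ P.asIdeal.absNorm := by
  obtain ⟨f, hf, h⟩ := absNorm_eq_pow hℓ hP
  rcases hf.eq_or_lt with rfl | hf
  · exfalso
    obtain ⟨n, hn⟩ := exists_int_sub_mem hℓ (by rw [h, pow_one]) w
    have h1 : ((n ^ 2 + b * n + c : ℤ) : 𝓞 K) ∈ P.asIdeal := by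
      have : ((n ^ 2 + b * n + c : ℤ) : 𝓞 K) = - ((w + n + b) * (w - n)) := by
        push_cast
        linear_combination hw
      rw [this]
      exact neg_mem (Ideal.mul_mem_left _ _ hn)
    have h2 : ((n ^ 2 + b * n + c : ℤ).natAbs : 𝓞 K) ∈ P.asIdeal := by
      rcases Int.natAbs_eq (n ^ 2 + b * n + c : ℤ) with h3 | h3
      · rw [h3, Int.cast_natCast] at h1; exact h1
      · rw [h3, Int.cast_neg, Int.cast_natCast, neg_mem_iff] at h1; exact h1
    refine not_mem_of_coprime P hP ((Nat.Prime.coprime_iff_not_dvd hℓ).2 fun h4 => hbc n ?_) h2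
    exact Int.natCast_dvd.2 h4
  · rw [h]
    exact Nat.pow_le_pow_right hℓ.pos hf

lemma ncard_primesAbove_le {ℓ : ℕ} (hℓ : ℓ.Prime) (e f : ℕ)
    (he : ∀ P ∈ primesAbove K ℓ, (ℓ : 𝓞 K) ∈ P.asIdeal ^ e)
    (hf : ∀ P ∈ primesAbove K ℓ, ℓ ^ f ≤ P.asIdeal.absNorm) :
    (primesAbove K ℓ).ncard * (f * e) ≤ finrank ℚ K := by
  have hfin := primesAbove_finite (K := K) hℓ.ne_zero
  have h1 := prod_absNorm_le hℓ.ne_zero hfin.toFinset (fun _ => e) fun P hP =>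
    he P (hfin.mem_toFinset.1 hP)
  have h2 : ∏ P ∈ hfin.toFinset, (ℓ ^ f) ^ e ≤ ℓ ^ finrank ℚ K := by
    refine le_trans (Finset.prod_le_prod' fun P hP => ?_) h1
    exact Nat.pow_le_pow_left (hf P (hfin.mem_toFinset.1 hP)) e
  rw [Finset.prod_const, ← pow_mul, ← pow_mul, ← Set.ncard_eq_toFinset_card _ hfin,
    Nat.pow_le_pow_iff_right hℓ.one_lt] at h2
  linarith [mul_comm (f * e) (primesAbove K ℓ).ncard]

lemma notMem_sq_of_le_ncard {ℓ : ℕ} (hℓ : ℓ.Prime) (f : ℕ)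
    (hf : ∀ P ∈ primesAbove K ℓ, ℓ ^ f ≤ P.asIdeal.absNorm)
    (hn : finrank ℚ K ≤ (primesAbove K ℓ).ncard * f) {P : HeightOneSpectrum (𝓞 K)}
    (hP : P ∈ primesAbove K ℓ) :
    (ℓ : 𝓞 K) ∉ P.asIdeal ^ 2 ∧ P.asIdeal.absNorm = ℓ ^ f := by
  classical
  have hfin := primesAbove_finite (K := K) hℓ.ne_zero
  have hcard := Set.ncard_eq_toFinset_card _ hfin
  have hP' := hfin.mem_toFinset.2 hP
  have key : ∀ e : ℕ, (ℓ : 𝓞 K) ∈ P.asIdeal ^ e → P.asIdeal.absNorm ^ e ≤ ℓ ^ f := by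
    intro e he
    have h1 := prod_absNorm_le hℓ.ne_zero hfin.toFinset (fun Q => if Q = P then e else 1)
      fun Q hQ => by
        split_ifs with h
        · exact h ▸ he
        · rw [pow_one]; exact hfin.mem_toFinset.1 hQ
    rw [← Finset.mul_prod_erase _ _ hP', if_pos rfl] at h1
    have h2 : ∏ Q ∈ hfin.toFinset.erase P, ℓ ^ f ≤
        ∏ Q ∈ hfin.toFinset.erase P, Q.asIdeal.absNorm ^ (if Q = P then e else 1) := by
      refine Finset.prod_le_prod' fun Q hQ => ?_
      rw [if_neg (Finset.ne_of_mem_erase hQ), pow_one]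
      exact hf Q (hfin.mem_toFinset.1 (Finset.mem_of_mem_erase hQ))
    rw [Finset.prod_const, Finset.card_erase_of_mem hP', ← hcard, ← pow_mul] at h2
    have hpos : 1 ≤ (primesAbove K ℓ).ncard := by
      rw [hcard]
      exact Finset.card_pos.2 ⟨P, hP'⟩
    have h3 : P.asIdeal.absNorm ^ e * ℓ ^ (f * ((primesAbove K ℓ).ncard - 1)) ≤
        ℓ ^ f * ℓ ^ (f * ((primesAbove K ℓ).ncard - 1)) := by
      calc _ ≤ ℓ ^ finrank ℚ K := (Nat.mul_le_mul_left _ h2).trans h1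
        _ ≤ ℓ ^ ((primesAbove K ℓ).ncard * f) := Nat.pow_le_pow_right hℓ.pos hn
        _ = _ := by
          rw [← pow_add]
          congr 1
          obtain ⟨k, hk⟩ := Nat.exists_eq_add_of_le hpos
          rw [hk]
          simp
          ring
    exact Nat.le_of_mul_le_mul_right h3 (pow_pos hℓ.pos _)
  have hPf := hf P hP
  refine ⟨fun h => ?_, le_antisymm ?_ hPf⟩
  · have h1 := key 2 h
    have h2 : ℓ ^ f < P.asIdeal.absNorm ^ 2 := by
      have h3 : 1 < P.asIdeal.absNorm := two_le_absNorm P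
      nlinarith
    omega
  · simpa using key 1 (by rw [pow_one]; exact hP)

end PrimesAbove

section LocalNorms

open Module IsDedekindDomain WithZero

variable {K : Type*} [Field K] [NumberField K]

/-- A unit at `P` of the form `a² - d b²` with `d` of valuation one is a square modulo `P`. -/
lemma exists_sq_mod (P : HeightOneSpectrum (𝓞 K)) {d u : 𝓞 K} (hd : d ∈ P.asIdeal)
    (hd2 : d ∉ P.asIdeal ^ 2) (hu : u ∉ P.asIdeal) {a b : K} (h : a ^ 2 - d * b ^ 2 = u) :
    ∃ r s : 𝓞 K, s ∉ P.asIdeal ∧ r ^ 2 - u * s ^ 2 ∈ P.asIdeal := by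
  set v := P.valuation K
  have hvd : v (d : K) = exp (-1 : ℤ) := by
    rw [P.valuation_of_algebraMap]
    have h1 : P.intValuation d ≤ exp (-((1 : ℕ) : ℤ)) := by
      rw [P.intValuation_le_pow_iff_dvd, pow_one, Ideal.dvd_span_singleton]; exact hd
    have h2 : ¬ P.intValuation d ≤ exp (-((2 : ℕ) : ℤ)) := by
      rw [P.intValuation_le_pow_iff_dvd, Ideal.dvd_span_singleton]; exact hd2
    have h0 : P.intValuation d ≠ 0 := fun h0 => h2 (by rw [h0]; exact zero_le)
    rw [← exp_log h0] at h1 h2 ⊢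
    rw [exp_le_exp] at h1 h2
    congr 1
    push_cast at h1 h2
    omega
  have hvu : v (u : K) = 1 := P.valuation_eq_one_iff_notMem.2 hu
  have hB1 : v (d * b ^ 2) ≠ 1 := by
    intro hB
    by_cases hb : b = 0
    · simp [hb] at hB
    have hb0 : v b ≠ 0 := (Valuation.ne_zero_iff _).2 hb
    rw [map_mul, map_pow, hvd, ← exp_log hb0, ← exp_nsmul, ← exp_add, ← exp_zero, exp_inj] at hB
    simp at hB
    omega
  have hAB : v (a ^ 2) ≠ v (d * b ^ 2) := by
    intro hB
    by_cases hb : b = 0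
    · rw [hb] at hB h
      simp at hB
      rw [hB] at h
      apply hu
      have : u = 0 := by
        ext
        simpa using h.symm
      rw [this]
      exact zero_mem _
    have hb0 : v b ≠ 0 := (Valuation.ne_zero_iff _).2 hb
    by_cases ha : a = 0
    · rw [ha] at hB
      rw [map_mul, hvd, map_pow v b, ← exp_log hb0, ← exp_nsmul, ← exp_add] at hB
      simp at hB
    have ha0 : v a ≠ 0 := (Valuation.ne_zero_iff _).2 ha
    rw [map_mul, map_pow, map_pow, hvd, ← exp_log hb0, ← exp_log ha0, ← exp_nsmul, ← exp_nsmul,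
      ← exp_add, exp_inj] at hB
    simp at hB
    omega
  have hmax : max (v (a ^ 2)) (v (d * b ^ 2)) = 1 := by
    rw [← hvu, ← h, sub_eq_add_neg, Valuation.map_add_of_distinct_val, Valuation.map_neg]
    rwa [Valuation.map_neg]
  have hB : v (d * b ^ 2) < 1 := lt_of_le_of_ne (hmax ▸ le_max_right _ _) hB1
  have hA : v a ≤ 1 := by
    have : v (a ^ 2) ≤ 1 := hmax ▸ le_max_left _ _
    rw [map_pow] at this
    exact pow_le_one_iff two_ne_zero |>.1 this
  obtain ⟨r, s, hrs⟩ := P.exists_primeCompl_mul_eq_of_integer a hA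
  refine ⟨r, s, s.2, ?_⟩
  rw [← P.valuation_lt_one_iff_mem (K := K)]
  have : algebraMap (𝓞 K) K (r ^ 2 - u * s ^ 2) = algebraMap (𝓞 K) K s ^ 2 * (d * b ^ 2) := by
    rw [map_sub, map_mul, map_pow, map_pow, ← hrs]
    linear_combination (algebraMap (𝓞 K) K s ^ 2) * h
  change P.valuation K (algebraMap (𝓞 K) K (r ^ 2 - u * s ^ 2)) < 1
  rw [this, map_mul, ← map_pow]
  exact lt_of_le_of_lt (mul_le_of_le_one_left zero_le (P.valuation_le_one (s.1 ^ 2))) hB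

lemma pow_sub_one_mem (P : HeightOneSpectrum (𝓞 K)) {d u : 𝓞 K} (hd : d ∈ P.asIdeal)
    (hd2 : d ∉ P.asIdeal ^ 2) (hu : u ∉ P.asIdeal) {a b : K} (h : a ^ 2 - d * b ^ 2 = u)
    {t : ℕ} (ht : P.asIdeal.absNorm = 2 * t + 1) : u ^ t - 1 ∈ P.asIdeal := by
  obtain ⟨r, s, hs, hrs⟩ := exists_sq_mod P hd hd2 hu h
  have := P.isMaximal
  let _ : Field (𝓞 K ⧸ P.asIdeal) := Ideal.Quotient.field _
  have hN : Nat.card (𝓞 K ⧸ P.asIdeal) = 2 * t + 1 := ht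
  have : Finite (𝓞 K ⧸ P.asIdeal) := Nat.finite_of_card_ne_zero (by omega)
  have := Fintype.ofFinite (𝓞 K ⧸ P.asIdeal)
  rw [Nat.card_eq_fintype_card] at hN
  rw [← Ideal.Quotient.eq_zero_iff_mem] at hs hu hrs ⊢
  rw [map_sub, map_mul, map_pow, map_pow, sub_eq_zero] at hrs
  rw [map_sub, map_pow, map_one, sub_eq_zero]
  set r' := Ideal.Quotient.mk P.asIdeal r
  set s' := Ideal.Quotient.mk P.asIdeal s
  set u' := Ideal.Quotient.mk P.asIdeal u
  have h1 : u' = (r' / s') ^ 2 := by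
    rw [div_pow, hrs]
    field_simp
  have h2 : r' / s' ≠ 0 := by
    intro h0
    rw [h0] at h1
    exact hu (by simpa using h1)
  rw [h1, ← pow_mul, show 2 * t = Fintype.card (𝓞 K ⧸ P.asIdeal) - 1 by omega]
  exact FiniteField.pow_card_sub_one_eq_one _ h2

end LocalNorms

section PrimesRelative

open Module IsDedekindDomain

lemma notMem_pow {K : Type*} [Field K] [NumberField K] {ℓ : ℕ} (hℓ : ℓ.Prime) {e : ℕ}
    (hn : finrank ℚ K + 1 < (primesAbove K ℓ).ncard + e) {P : HeightOneSpectrum (𝓞 K)}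
    (hP : P ∈ primesAbove K ℓ) : (ℓ : 𝓞 K) ∉ P.asIdeal ^ e := by
  classical
  intro he
  have hfin := primesAbove_finite (K := K) hℓ.ne_zero
  have hcard := Set.ncard_eq_toFinset_card _ hfin
  have hP' := hfin.mem_toFinset.2 hP
  have h1 := prod_absNorm_le hℓ.ne_zero hfin.toFinset (fun Q => if Q = P then e else 1)
    fun Q hQ => by
      split_ifs with h
      · exact h ▸ he
      · rw [pow_one]; exact hfin.mem_toFinset.1 hQ
  have h2 : ∏ Q ∈ hfin.toFinset, ℓ ^ (if Q = P then e else 1) ≤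
      ∏ Q ∈ hfin.toFinset, Q.asIdeal.absNorm ^ (if Q = P then e else 1) := by
    refine Finset.prod_le_prod' fun Q hQ => Nat.pow_le_pow_left ?_ _
    simpa using le_absNorm hℓ (hfin.mem_toFinset.1 hQ)
  rw [Finset.prod_pow_eq_pow_sum, ← Finset.add_sum_erase _ _ hP', if_pos rfl,
    Finset.sum_congr rfl (fun Q hQ => if_neg (Finset.ne_of_mem_erase hQ)), Finset.sum_const,
    Finset.card_erase_of_mem hP', ← hcard, smul_eq_mul, mul_one] at h2
  have h3 := (Nat.pow_le_pow_iff_right hℓ.one_lt).1 (h2.trans h1)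
  omega

variable {K L : Type*} [Field K] [Field L] [NumberField K] [NumberField L] [Algebra K L]

variable (K) in
/-- The prime of `K` below a prime of `L`. -/
def conPrime (P : HeightOneSpectrum (𝓞 L)) : HeightOneSpectrum (𝓞 K) where
  asIdeal := conIdeal K P.asIdeal
  isPrime := P.isPrime.comap _
  ne_bot := by
    intro h0
    have := IsQuadInvol.absNorm_con_dvd (K := K) P.asIdeal
    rw [h0, Ideal.absNorm_bot, zero_dvd_iff, Ideal.absNorm_eq_zero_iff] at this
    exact P.ne_bot this

lemma natCast_mem_conIdeal {n : ℕ} {I : Ideal (𝓞 L)} :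
    (n : 𝓞 K) ∈ conIdeal K I ↔ (n : 𝓞 L) ∈ I := by
  rw [Ideal.mem_comap, map_natCast]

lemma conPrime_mem {ℓ : ℕ} {P : HeightOneSpectrum (𝓞 L)} :
    conPrime K P ∈ primesAbove K ℓ ↔ P ∈ primesAbove L ℓ :=
  natCast_mem_conIdeal

lemma exists_conPrime_eq (P : HeightOneSpectrum (𝓞 K)) :
    ∃ Q : HeightOneSpectrum (𝓞 L), conPrime K Q = P := by
  have := P.isMaximal
  obtain ⟨Q, hQ, hc⟩ := Ideal.exists_ideal_over_maximal_of_isIntegral (S := 𝓞 L) P.asIdeal (by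
    rw [(RingHom.injective_iff_ker_eq_bot _).1
      (FaithfulSMul.algebraMap_injective (𝓞 K) (𝓞 L))]
    exact bot_le)
  refine ⟨⟨Q, hQ.isPrime, ?_⟩, HeightOneSpectrum.ext hc⟩
  rintro rfl
  apply P.ne_bot
  rw [← hc]
  exact (RingHom.injective_iff_ker_eq_bot _).1
      (FaithfulSMul.algebraMap_injective (𝓞 K) (𝓞 L))

lemma ncard_primesAbove_mono {ℓ : ℕ} (hℓ : ℓ ≠ 0) :
    (primesAbove K ℓ).ncard ≤ (primesAbove L ℓ).ncard := by
  have h1 : primesAbove K ℓ ⊆ conPrime K '' primesAbove L ℓ := by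
    intro P hP
    obtain ⟨Q, rfl⟩ := exists_conPrime_eq (L := L) P
    exact ⟨Q, conPrime_mem.1 hP, rfl⟩
  exact (Set.ncard_le_ncard h1 ((primesAbove_finite hℓ).image _)).trans
    (Set.ncard_image_le (primesAbove_finite hℓ))

lemma conPrime_injOn_ram : Set.InjOn (conPrime K) (ramPrimes K L) := by
  intro P hP Q hQ h
  have h1 : conIdeal K P.asIdeal = conIdeal K Q.asIdeal := congrArg (·.asIdeal) h
  have h2 : P.asIdeal ^ 2 = Q.asIdeal ^ 2 := by
    have hP' : _ = _ := hP
    have hQ' : _ = _ := hQ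
    rw [← hP', ← hQ', h1]
  have hPQ : P.asIdeal ≤ Q.asIdeal := by
    intro x hx
    have : x ^ 2 ∈ Q.asIdeal ^ 2 := h2 ▸ Ideal.pow_mem_pow hx 2
    exact Q.isPrime.mem_of_pow_mem 2 (Ideal.pow_le_self two_ne_zero this)
  exact HeightOneSpectrum.ext (P.isMaximal.eq_of_le Q.isPrime.ne_top hPQ)

lemma ncard_ramPrimes_le {T : Set (HeightOneSpectrum (𝓞 K))} (hT : T.Finite)
    (h : ∀ P ∈ ramPrimes K L, conPrime K P ∈ T) : (ramPrimes K L).ncard ≤ T.ncard := by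
  rw [← conPrime_injOn_ram.ncard_image]
  exact Set.ncard_le_ncard (by rintro _ ⟨P, hP, rfl⟩; exact h P hP) hT

lemma ncard_ramPrimes_le_primesAbove {ℓ : ℕ} (hℓ : ℓ ≠ 0)
    (h : ∀ P ∈ ramPrimes K L, (ℓ : 𝓞 L) ∈ P.asIdeal) :
    (ramPrimes K L).ncard ≤ (primesAbove K ℓ).ncard :=
  ncard_ramPrimes_le (primesAbove_finite hℓ) fun P hP => conPrime_mem.2 (h P hP)

namespace IsQuadInvol

variable {σ : L ≃ₐ[K] L} (h : IsQuadInvol σ)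
include h

lemma conIdeal_extIdeal (I : Ideal (𝓞 K)) : conIdeal K (extIdeal L I) = I :=
  Ideal.comap_map_eq_self_of_faithfullyFlat I

/-- Powers of an unramified prime contract to the same powers. -/
lemma natCast_mem_pow {ℓ e : ℕ} (P : HeightOneSpectrum (𝓞 L)) (hP : P ∉ ramPrimes K L)
    (he : (ℓ : 𝓞 L) ∈ P.asIdeal ^ e) : (ℓ : 𝓞 K) ∈ (conPrime K P).asIdeal ^ e := by
  rw [← h.conIdeal_extIdeal ((conPrime K P).asIdeal ^ e), natCast_mem_conIdeal]
  change _ ∈ extIdeal L (conIdeal K P.asIdeal ^ e)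
  rw [extIdeal, Ideal.map_pow]
  change _ ∈ extIdeal L (conIdeal K P.asIdeal) ^ e
  have := P.isPrime
  rcases h.prime_trichotomy P.asIdeal P.ne_bot with ⟨h1, h2⟩ | ⟨h1, h2 | h2⟩
  · rw [h2, mul_pow]
    have hc : (ℓ : 𝓞 L) ∈ conjIdeal σ P.asIdeal ^ e := by
      rw [← map_pow]
      simpa [conjIdeal_apply] using
        Ideal.mem_map_of_mem (RingOfIntegers.mapAlgEquiv σ : 𝓞 L →+* 𝓞 L) he
    have hm := P.isMaximal
    have hp := h.conjIdeal_isPrime P.asIdeal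
    have hm' : (conjIdeal σ P.asIdeal).IsMaximal :=
      hp.isMaximal (h.conjIdeal_ne_bot P.ne_bot)
    have hcop : IsCoprime (P.asIdeal ^ e) (conjIdeal σ P.asIdeal ^ e) :=
      (Ideal.isCoprime_of_isMaximal h1.symm).pow
    rw [Ideal.mul_eq_inf_of_isCoprime hcop]
    exact ⟨he, hc⟩
  · rw [h2]; exact he
  · exact absurd h2 hP

lemma le_ncard_ramPrimes {ℓ : ℕ} (e : ℕ)
    (hK : ∀ P ∈ primesAbove K ℓ, (ℓ : 𝓞 K) ∉ P.asIdeal ^ e)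
    (hL : ∀ P ∈ primesAbove L ℓ, (ℓ : 𝓞 L) ∈ P.asIdeal ^ e) :
    (primesAbove K ℓ).ncard ≤ (ramPrimes K L).ncard := by
  rw [← conPrime_injOn_ram.ncard_image]
  refine Set.ncard_le_ncard (fun P hP => ?_) (h.finite_ramPrimes.image _)
  obtain ⟨Q, rfl⟩ := exists_conPrime_eq (L := L) P
  refine ⟨Q, ?_, rfl⟩
  by_contra hQ
  exact hK _ hP (h.natCast_mem_pow Q hQ (hL Q (conPrime_mem.1 hP)))

/-- The conjugate prime. -/
def conjPrime (P : HeightOneSpectrum (𝓞 L)) : HeightOneSpectrum (𝓞 L) where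
  asIdeal := conjIdeal σ P.asIdeal
  isPrime := have := P.isPrime; h.conjIdeal_isPrime P.asIdeal
  ne_bot := h.conjIdeal_ne_bot P.ne_bot

lemma two_mul_ncard_le {ℓ : ℕ} (hℓ : ℓ ≠ 0) (x : 𝓞 L)
    (hx : ∀ Q ∈ primesAbove L ℓ, (∃ n : ℤ, x - n ∈ Q.asIdeal) ∧
      (RingOfIntegers.mapAlgEquiv σ : 𝓞 L ≃ₐ[𝓞 K] 𝓞 L) x - x ∉ Q.asIdeal) :
    2 * (primesAbove K ℓ).ncard ≤ (primesAbove L ℓ).ncard := by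
  have hne : ∀ Q ∈ primesAbove L ℓ, conjIdeal σ Q.asIdeal ≠ Q.asIdeal := by
    intro Q hQ hc
    obtain ⟨⟨n, hn⟩, h2⟩ := hx Q hQ
    apply h2
    have h3 : (RingOfIntegers.mapAlgEquiv σ : 𝓞 L ≃ₐ[𝓞 K] 𝓞 L) x - n ∈ Q.asIdeal := by
      have := Ideal.mem_map_of_mem (RingOfIntegers.mapAlgEquiv σ : 𝓞 L →+* 𝓞 L) hn
      rw [← conjIdeal_apply, hc, map_sub, map_intCast] at this
      exact this
    have := Q.asIdeal.sub_mem h3 hn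
    simpa using this
  have hfin := primesAbove_finite (K := L) hℓ
  have hfinK := primesAbove_finite (K := K) hℓ
  choose f hf using exists_conPrime_eq (K := K) (L := L)
  have hfi : Function.Injective f := fun a b hab => by rw [← hf a, ← hf b, hab]
  have hci : Function.Injective (h.conjPrime) := by
    intro a b hab
    have h1 : conjIdeal σ a.asIdeal = conjIdeal σ b.asIdeal := congrArg (·.asIdeal) hab
    have h2 := congrArg (conjIdeal σ) h1
    rw [h.conjIdeal_conjIdeal, h.conjIdeal_conjIdeal] at h2
    exact HeightOneSpectrum.ext h2
  have hcc : ∀ Q, conPrime K (h.conjPrime Q) = conPrime K Q := fun Q =>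
    HeightOneSpectrum.ext (h.conIdeal_conj Q.asIdeal)
  have hA : f '' primesAbove K ℓ ⊆ primesAbove L ℓ := by
    rintro _ ⟨P, hP, rfl⟩
    rw [← conPrime_mem (K := K), hf]; exact hP
  have hB : (fun P => h.conjPrime (f P)) '' primesAbove K ℓ ⊆ primesAbove L ℓ := by
    rintro _ ⟨P, hP, rfl⟩
    rw [← conPrime_mem (K := K), hcc, hf]; exact hP
  have hd : Disjoint (f '' primesAbove K ℓ) ((fun P => h.conjPrime (f P)) '' primesAbove K ℓ) := by
    rw [Set.disjoint_left]
    rintro _ ⟨P, hP, rfl⟩ ⟨P', hP', hPP⟩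
    have h1 := congrArg (conPrime K) hPP
    simp only [hcc, hf] at h1
    subst h1
    exact hne _ (hA ⟨_, hP, rfl⟩) (congrArg (·.asIdeal) hPP)
  have h1 := Set.ncard_le_ncard (Set.union_subset hA hB) hfin
  rw [Set.ncard_union_eq hd (hfinK.image _) (hfinK.image _), Set.ncard_image_of_injective _ hfi,
    Set.ncard_image_of_injective (f := fun P => h.conjPrime (f P)) _ (hci.comp hfi)] at h1
  omega

/-- If `n` is the square of `σ z - z`, then every ramified prime contains `n`. -/
lemma mem_of_ram {P : HeightOneSpectrum (𝓞 L)} (hP : P ∈ ramPrimes K L) (z n : 𝓞 L)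
    (hz : ((RingOfIntegers.mapAlgEquiv σ : 𝓞 L ≃ₐ[𝓞 K] 𝓞 L) z - z) ^ 2 = n) :
    n ∈ P.asIdeal := by
  have := P.isPrime
  rw [← hz]
  exact Ideal.pow_mem_of_mem _ (h.sub_mem_of_ram P.ne_bot hP z) 2 two_pos

end IsQuadInvol

end PrimesRelative

section ConcreteQuadratic

open Module

/-- `L = K(x)` with `x ^ 2 ∈ K`, for subfields of `ℂ`. -/
structure QuadGen (K L : IntermediateField ℚ ℂ) (x : ℂ) : Prop where
  le : K ≤ L
  mem : x ∈ L
  sq_mem : x ^ 2 ∈ K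
  exists_eq : ∀ y ∈ L, ∃ a ∈ K, ∃ b ∈ K, y = a + b * x

lemma quadGen_of_adjoin {K : IntermediateField ℚ ℂ} {T : Set ℂ} {x : ℂ}
    (hle : K ≤ adjoin ℚ T) (hx : x ∈ adjoin ℚ T) (hsq : x ^ 2 ∈ K)
    (hT : ∀ t ∈ T, ∃ a ∈ K, ∃ b ∈ K, t = a + b * x) : QuadGen K (adjoin ℚ T) x := by
  refine ⟨hle, hx, hsq, fun y hy => ?_⟩
  by_cases hxK : x ∈ K
  · have : adjoin ℚ T ≤ K := adjoin_le_iff.2 fun t ht => by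
      obtain ⟨a, ha, b, hb, rfl⟩ := hT t ht
      exact K.add_mem ha (K.mul_mem hb hxK)
    exact ⟨y, this hy, 0, K.zero_mem, by ring⟩
  · have hadd : ∀ y z : ℂ, (∃ a ∈ K, ∃ b ∈ K, y = a + b * x) → (∃ a ∈ K, ∃ b ∈ K, z = a + b * x) →
        ∃ a ∈ K, ∃ b ∈ K, y + z = a + b * x := by
      rintro _ _ ⟨a, ha, b, hb, rfl⟩ ⟨c, hc, d, hd, rfl⟩
      exact ⟨a + c, K.add_mem ha hc, b + d, K.add_mem hb hd, by ring⟩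
    have hmul : ∀ y z : ℂ, (∃ a ∈ K, ∃ b ∈ K, y = a + b * x) → (∃ a ∈ K, ∃ b ∈ K, z = a + b * x) →
        ∃ a ∈ K, ∃ b ∈ K, y * z = a + b * x := by
      rintro _ _ ⟨a, ha, b, hb, rfl⟩ ⟨c, hc, d, hd, rfl⟩
      exact ⟨a * c + b * d * x ^ 2, K.add_mem (K.mul_mem ha hc) (K.mul_mem (K.mul_mem hb hd) hsq),
        a * d + b * c, K.add_mem (K.mul_mem ha hd) (K.mul_mem hb hc), by ring⟩
    induction hy using adjoin_induction with
    | mem t ht => exact hT t ht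
    | algebraMap r => exact ⟨algebraMap ℚ ℂ r, K.algebraMap_mem r, 0, K.zero_mem, by simp⟩
    | add y z _ _ hy hz => exact hadd _ _ hy hz
    | mul y z _ _ hy hz => exact hmul _ _ hy hz
    | inv y _ hy =>
      obtain ⟨a, ha, b, hb, rfl⟩ := hy
      by_cases h0 : a + b * x = 0
      · exact ⟨0, K.zero_mem, 0, K.zero_mem, by rw [h0]; simp⟩
      · have h1 : a - b * x ≠ 0 := by
          intro h1
          by_cases hb0 : b = 0
          · subst hb0
            apply h0
            simpa using h1
          · apply hxK
            have : x = a / b := by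
              rw [eq_div_iff hb0]
              linear_combination -h1
            rw [this]
            exact K.div_mem ha hb
        have hN : a ^ 2 - b ^ 2 * x ^ 2 ∈ K :=
          K.sub_mem (K.pow_mem ha 2) (K.mul_mem (K.pow_mem hb 2) hsq)
        refine ⟨a / (a ^ 2 - b ^ 2 * x ^ 2), K.div_mem ha hN, -b / (a ^ 2 - b ^ 2 * x ^ 2),
          K.div_mem (K.neg_mem hb) hN, ?_⟩
        have h2 : a ^ 2 - b ^ 2 * x ^ 2 = (a + b * x) * (a - b * x) := by ring
        rw [h2]
        field_simp
        ring

namespace QuadGen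

variable {K L : IntermediateField ℚ ℂ} {x : ℂ} (h : QuadGen K L x)
include h

/-- `L` as a `K`-algebra. -/
@[reducible] def alg : Algebra K L := (inclusion h.le).toRingHom.toAlgebra

lemma le_of_mem (hx : x ∈ K) : L ≤ K := by
  intro y hy
  obtain ⟨a, ha, b, hb, rfl⟩ := h.exists_eq y hy
  exact K.add_mem ha (K.mul_mem hb hx)

lemma span_eq_top : letI := h.alg
    Submodule.span K (Set.range ![(1 : L), ⟨x, h.mem⟩]) = ⊤ := by
  let _ := h.alg
  rw [eq_top_iff]
  rintro ⟨y, hy⟩ -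
  obtain ⟨a, ha, b, hb, rfl⟩ := h.exists_eq y hy
  have : (⟨a + b * x, hy⟩ : L) = (⟨a, ha⟩ : K) • (1 : L) + (⟨b, hb⟩ : K) • (⟨x, h.mem⟩ : L) := by
    apply Subtype.ext
    change _ = a * 1 + b * x
    ring
  rw [this]
  exact Submodule.add_mem _ (Submodule.smul_mem _ _ (Submodule.subset_span ⟨0, rfl⟩))
    (Submodule.smul_mem _ _ (Submodule.subset_span ⟨1, rfl⟩))

lemma finite : letI := h.alg
    Module.Finite K L := by
  let _ := h.alg
  refine ⟨⟨(Set.finite_range ![(1 : L), ⟨x, h.mem⟩]).toFinset, ?_⟩⟩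
  rw [Set.Finite.coe_toFinset]
  exact h.span_eq_top

lemma finrank_le_two : letI := h.alg
    finrank K L ≤ 2 := by
  let _ := h.alg
  exact finrank_le_of_span_eq_top h.span_eq_top

lemma isScalarTower : letI := h.alg
    IsScalarTower ℚ K L := by
  let _ := h.alg
  exact IsScalarTower.of_algebraMap_eq fun q => rfl

lemma numberField [NumberField K] : NumberField L := by
  let _ := h.alg
  have := h.finite
  have := h.isScalarTower
  have := Module.Finite.trans (R := ℚ) K L
  exact { to_charZero := inferInstance, to_finiteDimensional := this }

lemma finrank_le : finrank ℚ L ≤ 2 * finrank ℚ K := by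
  let _ := h.alg
  have := h.finite
  have := h.isScalarTower
  rw [← finrank_mul_finrank ℚ K L, mul_comm]
  exact Nat.mul_le_mul_right _ h.finrank_le_two

lemma notMem [NumberField K] (hf : finrank ℚ L = 2 * finrank ℚ K) : x ∉ K := by
  intro hx
  have h1 := LinearMap.finrank_le_finrank_of_injective
    (f := (inclusion (h.le_of_mem hx)).toLinearMap) (inclusion (h.le_of_mem hx)).injective
  have h2 : 0 < finrank ℚ K := finrank_pos
  omega

lemma mem_or_mul_mem {y : ℂ} (hy : y ∈ L) (hy2 : y ^ 2 ∈ K) : y ∈ K ∨ y * x ∈ K := by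
  obtain ⟨a, ha, b, hb, rfl⟩ := h.exists_eq y hy
  by_cases ha0 : a = 0
  · right
    subst ha0
    have : (0 + b * x) * x = b * x ^ 2 := by ring
    rw [this]
    exact K.mul_mem hb h.sq_mem
  · by_cases hb0 : b = 0
    · left
      subst hb0
      simpa using ha
    · left
      have : x = ((a + b * x) ^ 2 - a ^ 2 - b ^ 2 * x ^ 2) / (2 * a * b) := by
        field_simp
        ring
      have hx : x ∈ K := by
        rw [this]
        exact K.div_mem (K.sub_mem (K.sub_mem hy2 (K.pow_mem ha 2))
          (K.mul_mem (K.pow_mem hb 2) h.sq_mem))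
          (K.mul_mem (K.mul_mem (K.algebraMap_mem 2) ha) hb)
      exact K.add_mem ha (K.mul_mem hb hx)

end QuadGen

/-- A quadratic extension `L = K(x)` of subfields of `ℂ`, with `x ^ 2 ∈ K` and `x ∉ K`. -/
structure QuadExt (K L : IntermediateField ℚ ℂ) (x : ℂ) : Prop extends QuadGen K L x where
  notMem : x ∉ K

namespace QuadExt

variable {K L : IntermediateField ℚ ℂ} {x : ℂ} (h : QuadExt K L x)
include h

lemma finrank_eq_two : letI := h.alg
    finrank K L = 2 := by
  let _ := h.alg
  have := h.finite
  refine le_antisymm h.finrank_le_two ?_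
  by_contra! hlt
  have h1 : finrank K L = 1 := by
    have : 0 < finrank K L := finrank_pos
    omega
  obtain ⟨c, hc⟩ := (finrank_eq_one_iff_of_nonzero' (1 : L) one_ne_zero).1 h1 ⟨x, h.mem⟩
  apply h.notMem
  have h2 : (c : ℂ) * 1 = x := congrArg (fun y : L => (y : ℂ)) hc
  rw [← h2, mul_one]
  exact c.2

lemma exists_conj [NumberField K] : letI := h.alg
    ∃ σ : L ≃ₐ[K] L, IsQuadInvol σ ∧ σ ⟨x, h.mem⟩ = - ⟨x, h.mem⟩ := by
  let _ := h.alg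
  have := h.finite
  have := h.toQuadGen.numberField
  have hq : Algebra.IsQuadraticExtension K L := ⟨h.finrank_eq_two⟩
  have h1 : Nat.card (L ≃ₐ[K] L) = 2 := by rw [IsGalois.card_aut_eq_finrank, h.finrank_eq_two]
  have : Nontrivial (L ≃ₐ[K] L) := by
    rw [← Finite.one_lt_card_iff_nontrivial, h1]; norm_num
  obtain ⟨σ, hσ⟩ := exists_ne (1 : L ≃ₐ[K] L)
  have hdec : ∀ y : L, ∃ a b : K, y = algebraMap K L a + algebraMap K L b * ⟨x, h.mem⟩ := by
    rintro ⟨y, hy⟩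
    obtain ⟨a, ha, b, hb, rfl⟩ := h.exists_eq y hy
    exact ⟨⟨a, ha⟩, ⟨b, hb⟩, rfl⟩
  have hx : σ ⟨x, h.mem⟩ = - ⟨x, h.mem⟩ := by
    have h2 : (σ ⟨x, h.mem⟩) ^ 2 = (⟨x, h.mem⟩ : L) ^ 2 := by
      have h3 : (⟨x, h.mem⟩ : L) ^ 2 = algebraMap K L ⟨x ^ 2, h.sq_mem⟩ := rfl
      rw [← map_pow, h3, AlgEquiv.commutes]
    rcases sq_eq_sq_iff_eq_or_eq_neg.1 h2 with h3 | h3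
    · exfalso
      apply hσ
      ext1 y
      obtain ⟨a, b, rfl⟩ := hdec y
      simp [h3]
    · exact h3
  refine ⟨σ, ⟨fun y => ?_, fun y hy => ?_, h.finrank_eq_two⟩, hx⟩
  · obtain ⟨a, b, rfl⟩ := hdec y
    simp [hx]
  · obtain ⟨a, b, rfl⟩ := hdec y
    rw [map_add, map_mul, hx, AlgEquiv.commutes, AlgEquiv.commutes] at hy
    refine ⟨a, ?_⟩
    have h3 : (2 : L) * (algebraMap K L b * ⟨x, h.mem⟩) = 0 := by linear_combination -hy
    have h4 := (mul_eq_zero.1 h3).resolve_left two_ne_zero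
    rw [h4, add_zero]

/-- The conjugation `x ↦ -x` of `L / K`. -/
def conj [NumberField K] : letI := h.alg
    L ≃ₐ[K] L :=
  letI := h.alg
  h.exists_conj.choose

lemma isQuadInvol_conj [NumberField K] : letI := h.alg
    IsQuadInvol h.conj :=
  letI := h.alg
  h.exists_conj.choose_spec.1

lemma conj_gen [NumberField K] : letI := h.alg
    h.conj ⟨x, h.mem⟩ = - ⟨x, h.mem⟩ :=
  letI := h.alg
  h.exists_conj.choose_spec.2

lemma conj_eq [NumberField K] (y : L) {a b : ℂ} (ha : a ∈ K) (hb : b ∈ K)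
    (hy : (y : ℂ) = a + b * x) : letI := h.alg
    (h.conj y : ℂ) = a - b * x := by
  let _ := h.alg
  have h1 : y = algebraMap K L ⟨a, ha⟩ + algebraMap K L ⟨b, hb⟩ * ⟨x, h.mem⟩ := Subtype.ext hy
  rw [h1, map_add, map_mul, AlgEquiv.commutes, AlgEquiv.commutes, h.conj_gen]
  change a + b * -x = _
  ring

lemma conj_fix [NumberField K] (y : L) (hy : (y : ℂ) ∈ K) : letI := h.alg
    h.conj y = y :=
  Subtype.ext (by rw [h.conj_eq y hy K.zero_mem (by ring)]; ring)

lemma conj_neg [NumberField K] (y : L) {b : ℂ} (hb : b ∈ K) (hy : (y : ℂ) = b * x) :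
    letI := h.alg
    h.conj y = -y :=
  Subtype.ext (by
    rw [h.conj_eq y K.zero_mem hb (by rw [hy]; ring)]
    change _ = -(y : ℂ)
    rw [hy]; ring)

end QuadExt

end ConcreteQuadratic

section IntegersOfSubfields

open Module

/-- The algebraic integer of `L` with a given complex value. -/
def intOf (L : IntermediateField ℚ ℂ) (y : ℂ) (hy : y ∈ L) (hi : IsIntegral ℤ y) : 𝓞 L :=
  ⟨⟨y, hy⟩, (isIntegral_algHom_iff (L.val.restrictScalars ℤ) L.val.injective).1 hi⟩

lemma ringOfIntegers_ext {L : IntermediateField ℚ ℂ} {a b : 𝓞 L}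
    (h : ((a : L) : ℂ) = ((b : L) : ℂ)) : a = b :=
  RingOfIntegers.ext (Subtype.ext h)

lemma isIntegral_coe {L : IntermediateField ℚ ℂ} (a : 𝓞 L) : IsIntegral ℤ ((a : L) : ℂ) :=
  (isIntegral_algHom_iff (L.val.restrictScalars ℤ) L.val.injective).2 a.2

lemma isIntegral_of_quadratic {w : ℂ} (b c : ℤ) (hw : w ^ 2 + b * w + c = 0) :
    IsIntegral ℤ w := by
  refine ⟨Polynomial.X ^ 2 + Polynomial.C b * Polynomial.X + Polynomial.C c, by monicity!, ?_⟩
  simpa [-eq_intCast, -map_intCast] using hw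

lemma isIntegral_of_sq {w : ℂ} (c : ℤ) (hw : w ^ 2 = c) : IsIntegral ℤ w :=
  isIntegral_of_quadratic 0 (-c) (by rw [hw]; push_cast; ring)

lemma isIntegral_int (c : ℤ) : IsIntegral ℤ (c : ℂ) := isIntegral_algebraMap (x := c)

end IntegersOfSubfields

namespace QuadExt

open Module IsDedekindDomain

variable {K L : IntermediateField ℚ ℂ} {x : ℂ} [NumberField K] [NumberField L]

/-- The prime `P` of `L = K(x)` contains all discriminants of integers of `L`. -/
def DiscMem (K : IntermediateField ℚ ℂ) {L : IntermediateField ℚ ℂ} (x : ℂ)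
    (P : HeightOneSpectrum (𝓞 L)) : Prop :=
  ∀ a ∈ K, ∀ b ∈ K, ∀ n : ℤ, IsIntegral ℤ (a + b * x) → (2 * b * x) ^ 2 = n → (n : 𝓞 L) ∈ P.asIdeal

section
variable (h : QuadExt K L x)

/-- The 2-adic valuation of the number of ambiguous classes. -/
def amb : ℕ := letI := h.alg; amb2 h.conj

/-- The number of ramified primes. -/
def ram : ℕ := letI := h.alg; (ramPrimes K L).ncard

/-- The 2-adic valuation of the index of the unit norms. -/
def idx : ℕ := letI := h.alg; (normUnits h.conj).index.factorization 2

include h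

lemma ambiguous_class_number :
    h.amb + h.idx + Units.rank L = cl2 K + (h.ram + 2 * Units.rank K) :=
  let _ := h.alg; h.isQuadInvol_conj.amb2_add

lemma finrank_eq : finrank ℚ L = 2 * finrank ℚ K := by
  let _ := h.alg
  have := h.finite
  have := h.isScalarTower
  rw [← finrank_mul_finrank ℚ K L, h.finrank_eq_two, mul_comm]

lemma mul_conj (y : L) {a b : ℂ} (ha : a ∈ K) (hb : b ∈ K) (hy : (y : ℂ) = a + b * x) :
    let _ := h.alg
    ((y * h.conj y : L) : ℂ) = a ^ 2 - x ^ 2 * b ^ 2 := by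
  let _ := h.alg
  change (y : ℂ) * (h.conj y : ℂ) = _
  rw [h.conj_eq y ha hb hy, hy]
  ring

lemma mem_normUnits_iff (u : (𝓞 K)ˣ) : letI := h.alg
    u ∈ normUnits h.conj ↔ ∃ a ∈ K, ∃ b ∈ K, a ^ 2 - x ^ 2 * b ^ 2 = ((u : K) : ℂ) := by
  let _ := h.alg
  rw [mem_normUnits]
  constructor
  · rintro ⟨y, hy⟩
    obtain ⟨a, ha, b, hb, hab⟩ := h.exists_eq y y.2
    refine ⟨a, ha, b, hb, ?_⟩
    rw [← h.mul_conj y ha hb hab, hy]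
    rfl
  · rintro ⟨a, ha, b, hb, hab⟩
    refine ⟨⟨a + b * x, L.add_mem (h.le ha) (L.mul_mem (h.le hb) h.mem)⟩, Subtype.ext ?_⟩
    rw [h.mul_conj _ ha hb rfl, hab]
    rfl

lemma idx_le {a b : ℂ} (ha : a ∈ K) (hb : b ∈ K) (hab : a ^ 2 - x ^ 2 * b ^ 2 = -1)
    (hi : Complex.I ∉ K) : h.idx ≤ Units.rank K := by
  let _ := h.alg
  refine h.isQuadInvol_conj.index_le_of_neg_one
    ((h.mem_normUnits_iff _).2 ⟨a, ha, b, hb, by simpa using hab⟩) fun y hy => ?_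
  have h1 : (y : ℂ) ^ 2 = Complex.I ^ 2 := by
    rw [Complex.I_sq]
    exact congrArg (fun z : K => (z : ℂ)) hy
  rcases sq_eq_sq_iff_eq_or_eq_neg.1 h1 with h2 | h2
  · exact hi (h2 ▸ y.2)
  · exact hi (by rw [← neg_neg Complex.I, ← h2]; exact K.neg_mem y.2)

lemma one_le_idx {u v : ℂ} (hu : u ∈ K) (hui : IsIntegral ℤ u) (hv : v ∈ K)
    (hvi : IsIntegral ℤ v) (huv : u * v = 1)
    (hn : ∀ a ∈ K, ∀ b ∈ K, a ^ 2 - x ^ 2 * b ^ 2 ≠ u) : 1 ≤ h.idx := by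
  let _ := h.alg
  have h1 : intOf K u hu hui * intOf K v hv hvi = 1 := ringOfIntegers_ext huv
  refine h.isQuadInvol_conj.one_le_index ⟨_, _, h1, by rw [mul_comm, h1]⟩ fun hm => ?_
  obtain ⟨a, ha, b, hb, hab⟩ := (h.mem_normUnits_iff _).1 hm
  exact hn a ha b hb hab

lemma one_le_idx_of_neg_one (hn : ∀ a ∈ K, ∀ b ∈ K, a ^ 2 - x ^ 2 * b ^ 2 ≠ -1) : 1 ≤ h.idx :=
  h.one_le_idx (K.neg_mem K.one_mem) (by simpa using isIntegral_int (-1))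
    (K.neg_mem K.one_mem) (by simpa using isIntegral_int (-1)) (by ring) hn

lemma cl2_eq_zero (h0 : h.amb = 0) : cl2 L = 0 :=
  let _ := h.alg; h.isQuadInvol_conj.cl2_eq_zero h0

lemma amb_le : h.amb ≤ cl2 L :=
  let _ := h.alg; h.isQuadInvol_conj.amb2_le

lemma isCyclic_sylow (h0 : cl2 K = 0) (h1 : h.amb ≤ 1) (P : Sylow 2 (ClassGroup (𝓞 L))) :
    IsCyclic P :=
  let _ := h.alg; h.isQuadInvol_conj.isCyclic_sylow h0 h1 P

lemma card_sylow (m : ℕ) (hm : 2 ≤ m) (hK : cl2 K ≤ m - 1) (hF : m ≤ h.amb)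
    (P : Sylow 2 (ClassGroup (𝓞 L))) (hP : IsCyclic P) : Nat.card P = 2 ^ m :=
  let _ := h.alg; h.isQuadInvol_conj.card_sylow m hm hK hF P hP

lemma amb_eq {K' K'' : IntermediateField ℚ ℂ} {x' x'' : ℂ} [NumberField K'] [NumberField K'']
    (h' : QuadExt K' L x') (h'' : QuadExt K'' L x'') (h0' : cl2 K' = 0) (h0'' : cl2 K'' = 0)
    {T : Set ℂ} (hT : L = adjoin ℚ T)
    (hc : ∀ t : L, (t : ℂ) ∈ T → h'.conj (h''.conj t) = h.conj t) : h.amb = cl2 L := by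
  subst hT
  have key : ∀ t, h'.conj (h''.conj t) = h.conj t := by
    rintro ⟨t, ht⟩
    induction ht using adjoin_induction with
    | mem t ht => exact hc ⟨t, subset_adjoin ℚ T ht⟩ ht
    | algebraMap r =>
      rw [h.conj_fix _ (K.algebraMap_mem r), h''.conj_fix _ (K''.algebraMap_mem r),
        h'.conj_fix _ (K'.algebraMap_mem r)]
    | add y z hy hz h1 h2 =>
      let _ := h.alg
      have e : (⟨y + z, add_mem hy hz⟩ : adjoin ℚ T) = ⟨y, hy⟩ + ⟨z, hz⟩ := rfl
      rw [e]
      simp only [map_add, h1, h2]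
    | mul y z hy hz h1 h2 =>
      have e : (⟨y * z, mul_mem hy hz⟩ : adjoin ℚ T) = ⟨y, hy⟩ * ⟨z, hz⟩ := rfl
      rw [e]
      simp only [map_mul, h1, h2]
    | inv y hy h1 =>
      have e : (⟨y⁻¹, inv_mem hy⟩ : adjoin ℚ T) = ⟨y, hy⟩⁻¹ := rfl
      rw [e]
      simp only [map_inv₀, h1]
  let _ := h.alg
  let _ := h'.alg
  let _ := h''.alg
  exact h.isQuadInvol_conj.amb2_eq h'.isQuadInvol_conj h''.isQuadInvol_conj h0' h0'' key

lemma idx_le_two {F M : IntermediateField ℚ ℂ} [NumberField F] [NumberField M]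
    (h₀ : QuadExt F M x) (hFK : F ≤ K) (hML : M ≤ L) (hr : Units.rank F = Units.rank K)
    (hidx : h₀.idx ≤ 1)
    (hsq : ∀ u ∈ F, ∀ y ∈ K, y ^ 2 = u → ∃ a ∈ F, a ^ 2 = u ∨ a ^ 2 = -u) : h.idx ≤ 2 := by
  let _ := h.alg
  let _ := h₀.alg
  let _ : Algebra F K := (inclusion hFK).toRingHom.toAlgebra
  refine index_normUnits_le_two (F := F) (M := M) h.isQuadInvol_conj h₀.isQuadInvol_conj
    (inclusion hML).toRingHom (fun _ => rfl) (fun y => ?_) hr hidx ?_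
  · obtain ⟨a, ha, b, hb, hab⟩ := h₀.exists_eq y y.2
    apply Subtype.ext
    rw [h.conj_eq ((inclusion hML).toRingHom y) (hFK ha) (hFK hb) hab]
    exact h₀.conj_eq y ha hb hab
  · rintro ⟨u, hu⟩ ⟨y, hy⟩ huy
    obtain ⟨a, ha, h1⟩ := hsq u hu y hy (congrArg (fun z : K => (z : ℂ)) huy)
    refine ⟨⟨a, ha⟩, h1.imp (fun h2 => Subtype.ext h2) (fun h2 => Subtype.ext h2)⟩

lemma discMem_of_ram {P : HeightOneSpectrum (𝓞 L)} (hP : letI := h.alg; P ∈ ramPrimes K L) :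
    DiscMem K x P := by
  let _ := h.alg
  intro a ha b hb n hi hn
  refine h.isQuadInvol_conj.mem_of_ram hP
    (intOf L (a + b * x) (L.add_mem (h.le ha) (L.mul_mem (h.le hb) h.mem)) hi) _
    (ringOfIntegers_ext ?_)
  have h1 := h.conj_eq (⟨a + b * x, L.add_mem (h.le ha) (L.mul_mem (h.le hb) h.mem)⟩ : L) ha hb rfl
  change ((h.conj (⟨a + b * x, L.add_mem (h.le ha) (L.mul_mem (h.le hb) h.mem)⟩ : L) : ℂ) -
    (a + b * x)) ^ 2 = (n : ℂ)
  rw [h1, ← hn]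
  ring

lemma ram_le {ℓ : ℕ} (hℓ : ℓ ≠ 0)
    (H : ∀ P : HeightOneSpectrum (𝓞 L), DiscMem K x P → (ℓ : 𝓞 L) ∈ P.asIdeal) :
    h.ram ≤ (primesAbove K ℓ).ncard := by
  let _ := h.alg
  exact ncard_ramPrimes_le_primesAbove hℓ fun P hP => H P (h.discMem_of_ram hP)

lemma ram_le_add {ℓ ℓ' : ℕ} (hℓ : ℓ ≠ 0) (hℓ' : ℓ' ≠ 0)
    (H : ∀ P : HeightOneSpectrum (𝓞 L), DiscMem K x P →
      (ℓ : 𝓞 L) ∈ P.asIdeal ∨ (ℓ' : 𝓞 L) ∈ P.asIdeal) :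
    h.ram ≤ (primesAbove K ℓ).ncard + (primesAbove K ℓ').ncard := by
  let _ := h.alg
  refine (ncard_ramPrimes_le ((primesAbove_finite hℓ).union (primesAbove_finite hℓ'))
    fun P hP => ?_).trans (Set.ncard_union_le _ _)
  exact (H P (h.discMem_of_ram hP)).imp conPrime_mem.2 conPrime_mem.2

lemma ram_eq_zero (H : ∀ P : HeightOneSpectrum (𝓞 L), ¬ DiscMem K x P) : h.ram = 0 := by
  let _ := h.alg
  change (ramPrimes K L).ncard = 0
  rw [Set.eq_empty_of_forall_notMem fun P hP => H P (h.discMem_of_ram hP), Set.ncard_empty]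

lemma le_ram {ℓ : ℕ} (e : ℕ) (hK : ∀ P ∈ primesAbove K ℓ, (ℓ : 𝓞 K) ∉ P.asIdeal ^ e)
    (hL : ∀ P ∈ primesAbove L ℓ, (ℓ : 𝓞 L) ∈ P.asIdeal ^ e) :
    (primesAbove K ℓ).ncard ≤ h.ram :=
  let _ := h.alg; h.isQuadInvol_conj.le_ncard_ramPrimes e hK hL

lemma ncard_primesAbove_mono {ℓ : ℕ} (hℓ : ℓ ≠ 0) :
    (primesAbove K ℓ).ncard ≤ (primesAbove L ℓ).ncard :=
  let _ := h.alg; _root_.ncard_primesAbove_mono hℓ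

lemma two_mul_ncard_le {ℓ : ℕ} (hℓ : ℓ.Prime) {a b : ℂ} (ha : a ∈ K) (hb : b ∈ K) (B C n : ℤ)
    (hz : (a + b * x) ^ 2 + B * (a + b * x) + C = 0) (hn : (ℓ : ℤ) ∣ n ^ 2 + B * n + C)
    (hd : (2 * b * x) ^ 2 = (B ^ 2 - 4 * C : ℤ)) (hdl : ¬ (ℓ : ℤ) ∣ B ^ 2 - 4 * C) :
    2 * (primesAbove K ℓ).ncard ≤ (primesAbove L ℓ).ncard := by
  let _ := h.alg
  have hm : a + b * x ∈ L := L.add_mem (h.le ha) (L.mul_mem (h.le hb) h.mem)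
  have hi : IsIntegral ℤ (a + b * x) := isIntegral_of_quadratic B C hz
  refine h.isQuadInvol_conj.two_mul_ncard_le hℓ.ne_zero (intOf L _ hm hi) fun Q hQ => ⟨?_, ?_⟩
  · obtain ⟨k, hk⟩ := hn
    have h1 : (intOf L _ hm hi - (n : ℤ)) * (intOf L _ hm hi - ((-n - B : ℤ) : 𝓞 L)) ∈
        Q.asIdeal := by
      have : (intOf L _ hm hi - (n : ℤ)) * (intOf L _ hm hi - ((-n - B : ℤ) : 𝓞 L)) =
          (ℓ : 𝓞 L) * ((-k : ℤ) : 𝓞 L) := by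
        apply ringOfIntegers_ext
        have hk' : (n : ℂ) ^ 2 + B * n + C = ℓ * k := by exact_mod_cast hk
        change (a + b * x - (n : ℂ)) * (a + b * x - ((-n - B : ℤ) : ℂ)) = (ℓ : ℂ) * ((-k : ℤ) : ℂ)
        push_cast
        linear_combination hz - hk'
      rw [this]
      exact Ideal.mul_mem_right _ _ hQ
    rcases Q.isPrime.mem_or_mem h1 with h2 | h2
    · exact ⟨n, h2⟩
    · exact ⟨_, h2⟩
  · intro hQ2
    have h1 : ((B ^ 2 - 4 * C : ℤ) : 𝓞 L) ∈ Q.asIdeal := by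
      have h2 := Ideal.pow_mem_of_mem _ hQ2 2 two_pos
      convert h2 using 1
      apply ringOfIntegers_ext
      have h1 := h.conj_eq (⟨a + b * x, hm⟩ : L) ha hb rfl
      change ((B ^ 2 - 4 * C : ℤ) : ℂ) = ((h.conj (⟨a + b * x, hm⟩ : L) : ℂ) - (a + b * x)) ^ 2
      rw [h1, ← hd]
      ring
    have hcop : IsCoprime (ℓ : ℤ) (B ^ 2 - 4 * C) :=
      (Prime.coprime_iff_not_dvd (Nat.prime_iff_prime_int.1 hℓ)).2 hdl
    obtain ⟨r, s, hrs⟩ := hcop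
    apply Q.isPrime.ne_top
    rw [Ideal.eq_top_iff_one]
    have h3 : (1 : 𝓞 L) = (r : 𝓞 L) * (ℓ : 𝓞 L) + s * ((B ^ 2 - 4 * C : ℤ) : 𝓞 L) := by
      have := congrArg (Int.cast (R := 𝓞 L)) hrs
      push_cast at this ⊢
      exact this.symm
    rw [h3]
    exact Q.asIdeal.add_mem (Ideal.mul_mem_left _ _ hQ) (Ideal.mul_mem_left _ _ h1)

end

end QuadExt

section PrimesOfSubfields

open Module IsDedekindDomain

lemma intCast_mem_of_dvd_pow {R : Type*} [CommRing R] {P : Ideal R} [P.IsPrime] {n : ℤ} {ℓ : ℕ}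
    (k : ℕ) (hn : (n : R) ∈ P) (hd : n ∣ (ℓ : ℤ) ^ k) : (ℓ : R) ∈ P := by
  obtain ⟨c, hc⟩ := hd
  have h1 : (ℓ : R) ^ k = n * c := by exact_mod_cast congrArg (Int.cast (R := R)) hc
  exact Ideal.IsPrime.mem_of_pow_mem ‹_› k (h1 ▸ Ideal.mul_mem_right _ _ hn)

lemma false_of_isCoprime {R : Type*} [CommRing R] {P : Ideal R} [hP : P.IsPrime] {m n : ℤ}
    (hm : (m : R) ∈ P) (hn : (n : R) ∈ P) (h : IsCoprime m n) : False := by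
  obtain ⟨a, b, hab⟩ := h
  apply hP.ne_top
  rw [Ideal.eq_top_iff_one]
  have h1 : (1 : R) = a * m + b * n := by exact_mod_cast (congrArg (Int.cast (R := R)) hab).symm
  rw [h1]
  exact P.add_mem (Ideal.mul_mem_left _ _ hm) (Ideal.mul_mem_left _ _ hn)

lemma intCast_notMem {K : Type*} [Field K] [NumberField K] {ℓ : ℕ} (hℓ : ℓ.Prime)
    {P : HeightOneSpectrum (𝓞 K)} (hP : P ∈ primesAbove K ℓ) {n : ℤ} (hn : ¬ (ℓ : ℤ) ∣ n) :
    (n : 𝓞 K) ∉ P.asIdeal := fun h =>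
  have := P.isPrime
  false_of_isCoprime (m := (ℓ : ℤ)) (by rw [Int.cast_natCast]; exact hP) h
    ((Prime.coprime_iff_not_dvd (Nat.prime_iff_prime_int.1 hℓ)).2 hn)

variable {K : IntermediateField ℚ ℂ} [NumberField K]

lemma sq_le_absNorm_of_root {ℓ : ℕ} (hℓ : ℓ.Prime) {P : HeightOneSpectrum (𝓞 K)}
    (hP : P ∈ primesAbove K ℓ) {w : ℂ} (hwK : w ∈ K) (b c : ℤ) (hw : w ^ 2 + b * w + c = 0)
    (hbc : ∀ n : ℤ, ¬ (ℓ : ℤ) ∣ n ^ 2 + b * n + c) : ℓ ^ 2 ≤ P.asIdeal.absNorm :=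
  sq_le_absNorm hℓ hP (intOf K w hwK (isIntegral_of_quadratic b c hw)) b c
    (ringOfIntegers_ext hw) hbc

/-- If `ℓ` is `y ^ k` up to an element prime to `ℓ`, then all ramification indices over `ℓ` are
at least `k`. -/
lemma natCast_mem_pow_of_eq {ℓ : ℕ} (hℓ : ℓ.Prime) {P : HeightOneSpectrum (𝓞 K)}
    (hP : P ∈ primesAbove K ℓ) (k : ℕ) {y c c' : ℂ} (hy : y ∈ K) (hc : c ∈ K) (hc' : c' ∈ K)
    (hyi : IsIntegral ℤ y) (hci : IsIntegral ℤ c) (hci' : IsIntegral ℤ c') {n n' : ℤ}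
    (hn : ¬ (ℓ : ℤ) ∣ n) (hn' : ¬ (ℓ : ℤ) ∣ n') (h : y ^ k * c = n * ℓ) (h' : c * c' = n') :
    (ℓ : 𝓞 K) ∈ P.asIdeal ^ k := by
  have hprime := P.isPrime
  have h1 : intOf K y hy hyi ^ k * intOf K c hc hci = (n : 𝓞 K) * (ℓ : 𝓞 K) :=
    ringOfIntegers_ext h
  have h2 : intOf K c hc hci * intOf K c' hc' hci' = (n' : 𝓞 K) := ringOfIntegers_ext h'
  have h3 : intOf K c hc hci ∉ P.asIdeal := fun h3 =>
    intCast_notMem hℓ hP hn' (h2 ▸ Ideal.mul_mem_right _ _ h3)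
  have h4 : intOf K y hy hyi ∈ P.asIdeal := by
    have h5 : intOf K y hy hyi ^ k * intOf K c hc hci ∈ P.asIdeal :=
      h1 ▸ Ideal.mul_mem_left _ _ hP
    exact hprime.mem_of_pow_mem k ((hprime.mem_or_mem h5).resolve_right h3)
  have h5 : (n : 𝓞 K) * (ℓ : 𝓞 K) ∈ P.asIdeal ^ k :=
    h1 ▸ Ideal.mul_mem_right _ _ (Ideal.pow_mem_pow h4 k)
  exact (Ideal.IsPrime.mul_mem_pow P.asIdeal h5).resolve_left (intCast_notMem hℓ hP hn)

/-- Local obstruction to being a norm at a tamely ramified prime. -/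
lemma sq_sub_ne {ℓ : ℕ} (hℓ : ℓ.Prime) (hℓ2 : ℓ ≠ 2) (P : HeightOneSpectrum (𝓞 K))
    (hP : P ∈ primesAbove K ℓ) {d u : 𝓞 K} (hd : d ∈ P.asIdeal) (hd2 : d ∉ P.asIdeal ^ 2)
    {t : ℕ} (ht : P.asIdeal.absNorm = 2 * t + 1) (hu : u ^ t + 1 ∈ P.asIdeal) {a b : ℂ}
    (ha : a ∈ K) (hb : b ∈ K) : a ^ 2 - ((d : K) : ℂ) * b ^ 2 ≠ ((u : K) : ℂ) := by
  intro hab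
  have hprime := P.isPrime
  have h2 : ((2 : ℤ) : 𝓞 K) ∉ P.asIdeal := by
    refine intCast_notMem hℓ hP fun h => hℓ2 ?_
    exact (Nat.prime_dvd_prime_iff_eq hℓ Nat.prime_two).1 (by exact_mod_cast h)
  have ht0 : t ≠ 0 := by
    rintro rfl
    have := two_le_absNorm P
    omega
  have hu0 : u ∉ P.asIdeal := by
    intro hu0
    apply hprime.ne_top
    rw [Ideal.eq_top_iff_one]
    have := P.asIdeal.sub_mem hu (Ideal.pow_mem_of_mem _ hu0 t (Nat.pos_of_ne_zero ht0))
    simpa using this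
  have h3 := pow_sub_one_mem P hd hd2 hu0 (a := (⟨a, ha⟩ : K)) (b := ⟨b, hb⟩)
    (Subtype.ext hab) ht
  apply h2
  have := P.asIdeal.sub_mem hu h3
  have h4 : u ^ t + 1 - (u ^ t - 1) = ((2 : ℤ) : 𝓞 K) := by push_cast; ring
  rwa [h4] at this

end PrimesOfSubfields

section UnitRanks

open Module InfinitePlace

lemma rank_of_real {K : IntermediateField ℚ ℂ} [NumberField K] {T : Set ℂ} (hK : K = adjoin ℚ T)
    (hT : ∀ t ∈ T, ∃ r : ℝ, 0 ≤ r ∧ ∃ q : ℚ, (q : ℝ) = r ∧ t ^ 2 = r) :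
    Units.rank K + 1 = finrank ℚ K := by
  have h1 : IsTotallyReal K := by
    refine ⟨fun v => ?_⟩
    rw [← mk_embedding v, isReal_mk_iff]
    subst hK
    ext ⟨y, hy⟩
    rw [ComplexEmbedding.conjugate_coe_eq]
    induction hy using adjoin_induction with
    | mem t ht =>
      obtain ⟨r, hr, q, hq, htr⟩ := hT t ht
      have h2 : (v.embedding ⟨t, subset_adjoin ℚ T ht⟩) ^ 2 = ((Real.sqrt r : ℝ) : ℂ) ^ 2 := by
        rw [← Complex.ofReal_pow, Real.sq_sqrt hr, ← map_pow]
        have : (⟨t, subset_adjoin ℚ T ht⟩ : adjoin ℚ T) ^ 2 = algebraMap ℚ _ q := by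
          apply Subtype.ext
          change t ^ 2 = algebraMap ℚ ℂ q
          rw [htr, ← hq]
          simp
        rw [this, ← hq]
        simp
      rcases sq_eq_sq_iff_eq_or_eq_neg.1 h2 with h3 | h3 <;> rw [h3] <;> simp
    | algebraMap r =>
      have : (⟨algebraMap ℚ ℂ r, _root_.algebraMap_mem _ r⟩ : adjoin ℚ T) = algebraMap ℚ _ r := rfl
      rw [this]
      simp
    | add y z hy hz h1 h2 =>
      have e : (⟨y + z, add_mem hy hz⟩ : adjoin ℚ T) = ⟨y, hy⟩ + ⟨z, hz⟩ := rfl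
      rw [e]
      simp only [map_add, h1, h2]
    | mul y z hy hz h1 h2 =>
      have e : (⟨y * z, mul_mem hy hz⟩ : adjoin ℚ T) = ⟨y, hy⟩ * ⟨z, hz⟩ := rfl
      rw [e]
      simp only [map_mul, h1, h2]
    | inv y hy h1 =>
      have e : (⟨y⁻¹, inv_mem hy⟩ : adjoin ℚ T) = ⟨y, hy⟩⁻¹ := rfl
      rw [e]
      simp only [map_inv₀, h1]
  have h2 := IsTotallyReal.finrank K
  have h3 := card_eq_nrRealPlaces_add_nrComplexPlaces K
  rw [IsTotallyReal.nrComplexPlaces_eq_zero] at h3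
  have h4 : 0 < finrank ℚ K := finrank_pos
  unfold Units.rank
  omega

lemma rank_of_complex {K : IntermediateField ℚ ℂ} [NumberField K] {z : ℂ} (hz : z ∈ K) {r : ℚ}
    (hr : r < 0) (hzr : z ^ 2 = r) : 2 * (Units.rank K + 1) = finrank ℚ K := by
  have h1 : IsTotallyComplex K := by
    refine ⟨fun v => ?_⟩
    rw [← mk_embedding v, ← not_isReal_iff_isComplex, isReal_mk_iff]
    intro h
    have h2 : (v.embedding ⟨z, hz⟩) ^ 2 = r := by
      rw [← map_pow]
      have : (⟨z, hz⟩ : K) ^ 2 = algebraMap ℚ _ r := by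
        apply Subtype.ext
        change z ^ 2 = algebraMap ℚ ℂ r
        rw [hzr]; simp
      rw [this]
      simp
    have h3 := h.coe_embedding_apply ⟨z, hz⟩
    rw [← h3] at h2
    have h4 : (h.embedding ⟨z, hz⟩) ^ 2 = (r : ℝ) := by exact_mod_cast h2
    have h5 : (r : ℝ) < 0 := by exact_mod_cast hr
    nlinarith [sq_nonneg (h.embedding ⟨z, hz⟩)]
  have h2 := IsTotallyComplex.finrank K
  have h3 := card_eq_nrRealPlaces_add_nrComplexPlaces K
  rw [IsTotallyComplex.nrRealPlaces_eq_zero] at h3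
  have h4 : 0 < finrank ℚ K := finrank_pos
  unfold Units.rank
  omega

end UnitRanks

section Fields

open Module

open Complex (I)

/-- The nonnegative square root of a natural number, as a complex number. -/
def rt (n : ℕ) : ℂ := ((Real.sqrt n : ℝ) : ℂ)

lemma rt_sq (n : ℕ) : rt n ^ 2 = n := by
  rw [rt, ← Complex.ofReal_pow, Real.sq_sqrt (Nat.cast_nonneg n), Complex.ofReal_natCast]

lemma isIntegral_rt (n : ℕ) : IsIntegral ℤ (rt n) :=
  isIntegral_of_sq n (by rw [rt_sq]; simp)

lemma isIntegral_I : IsIntegral ℤ I := isIntegral_of_sq (-1) (by simp)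

/-- Rational numbers with a squarefree part are not squares. -/
lemma sq_ne_of_dvd {ℓ N : ℕ} (hℓ : ℓ.Prime) (h1 : ℓ ∣ N) (h2 : ¬ ℓ ^ 2 ∣ N) {y : ℂ}
    (hy : y ∈ (⊥ : IntermediateField ℚ ℂ)) : y ^ 2 ≠ N := by
  intro h
  obtain ⟨r, rfl⟩ := mem_bot.1 hy
  have h3 : r ^ 2 = N := by
    have : (algebraMap ℚ ℂ) (r ^ 2) = algebraMap ℚ ℂ N := by simpa using h
    exact (algebraMap ℚ ℂ).injective this
  have h4 : r.num ^ 2 = N * r.den ^ 2 := by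
    have h5 : (r.num : ℚ) = r * r.den := (Rat.mul_den_eq_num r).symm
    have : ((r.num ^ 2 : ℤ) : ℚ) = ((N * r.den ^ 2 : ℤ) : ℚ) := by
      push_cast
      rw [h5, ← h3]
      ring
    exact_mod_cast this
  have hℓ' := Nat.prime_iff_prime_int.1 hℓ
  have h5 : (ℓ : ℤ) ∣ r.num := by
    apply hℓ'.dvd_of_dvd_pow (n := 2)
    rw [h4]
    exact (Int.natCast_dvd_natCast.2 h1).mul_right _
  have h6 : ¬ (ℓ : ℤ) ∣ r.den := by
    intro h6
    have h7 : (ℓ : ℕ) ∣ r.num.natAbs := Int.natCast_dvd.1 h5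
    have h8 := Nat.dvd_gcd h7 (Int.natCast_dvd_natCast.1 h6)
    rw [r.reduced] at h8
    exact hℓ.one_lt.ne' (Nat.dvd_one.1 h8)
  have h7 : (ℓ : ℤ) ^ 2 ∣ N * r.den ^ 2 := h4 ▸ pow_dvd_pow_of_dvd h5 2
  have h8 : IsCoprime ((ℓ : ℤ) ^ 2) ((r.den : ℤ) ^ 2) :=
    ((Prime.coprime_iff_not_dvd hℓ').2 h6).pow
  have h9 := h8.dvd_of_dvd_mul_right h7
  exact h2 (by exact_mod_cast h9)

/-- The Gaussian field `ℚ(i)`. -/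
abbrev Qi : IntermediateField ℚ ℂ := adjoin ℚ {I}
/-- The field `ℚ(√2)`. -/
abbrev Q2 : IntermediateField ℚ ℂ := adjoin ℚ {rt 2}
/-- The field `ℚ(√-q)`. -/
abbrev Qnq (q : ℕ) : IntermediateField ℚ ℂ := adjoin ℚ {I * rt q}
/-- The field `ℚ(√(2q))`. -/
abbrev Q2q (q : ℕ) : IntermediateField ℚ ℂ := adjoin ℚ {rt 2 * rt q}
/-- The field `ℚ(√q)`. -/
abbrev Qq (q : ℕ) : IntermediateField ℚ ℂ := adjoin ℚ {rt q}
/-- The field `ℚ(√(-2q))`. -/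
abbrev Qn2q (q : ℕ) : IntermediateField ℚ ℂ := adjoin ℚ {I * (rt 2 * rt q)}
/-- The field `ℚ(i, √2)`. -/
abbrev QiR2 : IntermediateField ℚ ℂ := adjoin ℚ {I, rt 2}
/-- The field `ℚ(i, √p)`. -/
abbrev QiRp (p : ℕ) : IntermediateField ℚ ℂ := adjoin ℚ {I, rt p}
/-- The field `ℚ(√2, √q)`. -/
abbrev Q2Rq (q : ℕ) : IntermediateField ℚ ℂ := adjoin ℚ {rt 2, rt q}
/-- The field `ℚ(√2, √-q)`. -/
abbrev Q2Rnq (q : ℕ) : IntermediateField ℚ ℂ := adjoin ℚ {rt 2, I * rt q}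
/-- The field `ℚ(√2, √q, i)`. -/
abbrev Q2qi (q : ℕ) : IntermediateField ℚ ℂ := adjoin ℚ {rt 2, rt q, I}
/-- The field `ℚ(i, √p, √q)`. -/
abbrev Qipq (p q : ℕ) : IntermediateField ℚ ℂ := adjoin ℚ {I, rt p, rt q}
/-- The field `ℚ(√2, √p, √q)`. -/
abbrev Q2pq (p q : ℕ) : IntermediateField ℚ ℂ := adjoin ℚ {rt 2, rt p, rt q}
/-- The field `ℚ(√2, √p, √q, i)`. -/
abbrev Q2pqi (p q : ℕ) : IntermediateField ℚ ℂ := adjoin ℚ {rt 2, rt p, rt q, I}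

lemma mem_adjoin_of_mem {T : Set ℂ} {t : ℂ} (h : t ∈ T) : t ∈ adjoin ℚ T := subset_adjoin ℚ T h

lemma adjoin_le_adjoin {S T : Set ℂ} (h : ∀ s ∈ S, s ∈ adjoin ℚ T) : adjoin ℚ S ≤ adjoin ℚ T :=
  adjoin_le_iff.2 h

/-- A generator contained in the base field. -/
lemma exists_eq_of_mem {K : IntermediateField ℚ ℂ} {t : ℂ} (x : ℂ) (h : t ∈ K) :
    ∃ a ∈ K, ∃ b ∈ K, t = a + b * x := ⟨t, h, 0, K.zero_mem, by ring⟩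

/-- A generator that is a multiple of `x`. -/
lemma exists_eq_of_mul {K : IntermediateField ℚ ℂ} {t x : ℂ} {b : ℂ} (h : b ∈ K) (ht : t = b * x) :
    ∃ a ∈ K, ∃ b ∈ K, t = a + b * x := ⟨0, K.zero_mem, b, h, by rw [ht]; ring⟩

lemma quadGen_simple {x : ℂ} (n : ℤ) (hn : x ^ 2 = n) : QuadGen ⊥ (adjoin ℚ {x}) x :=
  quadGen_of_adjoin bot_le (mem_adjoin_of_mem rfl) (hn ▸ intCast_mem _ n)
    (by rintro t rfl; exact exists_eq_of_mul (one_mem _) (by ring))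

lemma I_mul_rt_sq (n : ℕ) : (I * rt n) ^ 2 = -n := by rw [mul_pow, rt_sq, Complex.I_sq]; ring

lemma rt_two_mul_rt_sq (n : ℕ) : (rt 2 * rt n) ^ 2 = 2 * n := by
  rw [mul_pow, rt_sq, rt_sq]; norm_num

lemma I_mul_rt_two_mul_rt_sq (n : ℕ) : (I * (rt 2 * rt n)) ^ 2 = -(2 * n) := by
  rw [mul_pow, rt_two_mul_rt_sq, Complex.I_sq]; ring

lemma quadGen_bot_Qi : QuadGen ⊥ Qi I := quadGen_simple (-1) (by simp)

lemma quadGen_bot_rt (n : ℕ) : QuadGen ⊥ (Qq n) (rt n) := quadGen_simple n (by simp [rt_sq])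

lemma quadGen_bot_Qnq (q : ℕ) : QuadGen ⊥ (Qnq q) (I * rt q) :=
  quadGen_simple (-q) (by simp [I_mul_rt_sq])

lemma quadGen_bot_Q2q (q : ℕ) : QuadGen ⊥ (Q2q q) (rt 2 * rt q) :=
  quadGen_simple (2 * q) (by simp [rt_two_mul_rt_sq])

lemma quadGen_bot_Qn2q (q : ℕ) : QuadGen ⊥ (Qn2q q) (I * (rt 2 * rt q)) :=
  quadGen_simple (-(2 * q)) (by simp [I_mul_rt_two_mul_rt_sq])

lemma rt_sq_mem (K : IntermediateField ℚ ℂ) (n : ℕ) : rt n ^ 2 ∈ K :=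
  rt_sq n ▸ _root_.natCast_mem K n

lemma I_sq_mem (K : IntermediateField ℚ ℂ) : I ^ 2 ∈ K := by
  rw [Complex.I_sq]; exact K.neg_mem K.one_mem

lemma quadGen_Qi_QiR2 : QuadGen Qi QiR2 (rt 2) := by
  refine quadGen_of_adjoin (adjoin_le_adjoin ?_) (mem_adjoin_of_mem (by simp)) (rt_sq_mem _ 2) ?_
  · rintro t rfl; exact mem_adjoin_of_mem (by simp)
  · rintro t (rfl | rfl)
    · exact exists_eq_of_mem _ (mem_adjoin_of_mem (by simp))
    · exact exists_eq_of_mul (one_mem _) (by ring)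

lemma quadGen_Qi_QiRp (p : ℕ) : QuadGen Qi (QiRp p) (rt p) := by
  refine quadGen_of_adjoin (adjoin_le_adjoin ?_) (mem_adjoin_of_mem (by simp)) (rt_sq_mem _ p) ?_
  · rintro t rfl; exact mem_adjoin_of_mem (by simp)
  · rintro t (rfl | rfl)
    · exact exists_eq_of_mem _ (mem_adjoin_of_mem (by simp))
    · exact exists_eq_of_mul (one_mem _) (by ring)

lemma quadGen_Qq_Q2Rq (q : ℕ) : QuadGen (Qq q) (Q2Rq q) (rt 2) := by
  refine quadGen_of_adjoin (adjoin_le_adjoin ?_) (mem_adjoin_of_mem (by simp)) (rt_sq_mem _ 2) ?_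
  · rintro t rfl; exact mem_adjoin_of_mem (by simp)
  · rintro t (rfl | rfl)
    · exact exists_eq_of_mul (one_mem _) (by ring)
    · exact exists_eq_of_mem _ (mem_adjoin_of_mem (by simp))

lemma quadGen_Q2_Q2Rq (q : ℕ) : QuadGen Q2 (Q2Rq q) (rt q) := by
  refine quadGen_of_adjoin (adjoin_le_adjoin ?_) (mem_adjoin_of_mem (by simp)) (rt_sq_mem _ q) ?_
  · rintro t rfl; exact mem_adjoin_of_mem (by simp)
  · rintro t (rfl | rfl)
    · exact exists_eq_of_mem _ (mem_adjoin_of_mem (by simp))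
    · exact exists_eq_of_mul (one_mem _) (by ring)

lemma quadGen_Qn2q_Q2Rnq (q : ℕ) : QuadGen (Qn2q q) (Q2Rnq q) (rt 2) := by
  have h2 := rt_sq 2
  refine quadGen_of_adjoin (adjoin_le_adjoin ?_) (mem_adjoin_of_mem (by simp)) (rt_sq_mem _ 2) ?_
  · rintro t rfl
    have : I * (rt 2 * rt q) = rt 2 * (I * rt q) := by ring
    rw [this]
    exact mul_mem (mem_adjoin_of_mem (by simp)) (mem_adjoin_of_mem (by simp))
  · rintro t (rfl | rfl)
    · exact exists_eq_of_mul (one_mem _) (by ring)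
    · refine exists_eq_of_mul (b := I * (rt 2 * rt q) / (2 : ℕ))
        (div_mem (mem_adjoin_of_mem (by simp)) (_root_.natCast_mem _ 2)) ?_
      push_cast at h2 ⊢
      linear_combination -(I * rt q / 2) * h2

lemma quadGen_Qnq_Q2Rnq (q : ℕ) : QuadGen (Qnq q) (Q2Rnq q) (rt 2) := by
  refine quadGen_of_adjoin (adjoin_le_adjoin ?_) (mem_adjoin_of_mem (by simp)) (rt_sq_mem _ 2) ?_
  · rintro t rfl; exact mem_adjoin_of_mem (by simp)
  · rintro t (rfl | rfl)
    · exact exists_eq_of_mul (one_mem _) (by ring)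
    · exact exists_eq_of_mem _ (mem_adjoin_of_mem (by simp))

lemma quadGen_Q2_Q2Rnq (q : ℕ) : QuadGen Q2 (Q2Rnq q) (I * rt q) := by
  refine quadGen_of_adjoin (adjoin_le_adjoin ?_) (mem_adjoin_of_mem (by simp)) ?_ ?_
  · rintro t rfl; exact mem_adjoin_of_mem (by simp)
  · rw [I_mul_rt_sq]; exact neg_mem (_root_.natCast_mem _ q)
  · rintro t (rfl | rfl)
    · exact exists_eq_of_mem _ (mem_adjoin_of_mem (by simp))
    · exact exists_eq_of_mul (one_mem _) (by ring)

lemma quadGen_Q2Rnq_Q2qi (q : ℕ) : QuadGen (Q2Rnq q) (Q2qi q) I := by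
  have hI := Complex.I_sq
  refine quadGen_of_adjoin (adjoin_le_adjoin ?_) (mem_adjoin_of_mem (by simp)) (I_sq_mem _) ?_
  · rintro t (rfl | rfl)
    · exact mem_adjoin_of_mem (by simp)
    · exact mul_mem (mem_adjoin_of_mem (by simp)) (mem_adjoin_of_mem (by simp))
  · rintro t (rfl | rfl | rfl)
    · exact exists_eq_of_mem _ (mem_adjoin_of_mem (by simp))
    · exact exists_eq_of_mul (b := -(I * rt q)) (neg_mem (mem_adjoin_of_mem (by simp)))
        (by linear_combination (rt q) * hI)
    · exact exists_eq_of_mul (one_mem _) (by ring)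

lemma quadGen_QiR2_Q2qi (q : ℕ) : QuadGen QiR2 (Q2qi q) (rt q) := by
  refine quadGen_of_adjoin (adjoin_le_adjoin ?_) (mem_adjoin_of_mem (by simp)) (rt_sq_mem _ q) ?_
  · rintro t (rfl | rfl) <;> exact mem_adjoin_of_mem (by simp)
  · rintro t (rfl | rfl | rfl)
    · exact exists_eq_of_mem _ (mem_adjoin_of_mem (by simp))
    · exact exists_eq_of_mul (one_mem _) (by ring)
    · exact exists_eq_of_mem _ (mem_adjoin_of_mem (by simp))

lemma quadGen_Q2Rq_Q2qi (q : ℕ) : QuadGen (Q2Rq q) (Q2qi q) I := by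
  refine quadGen_of_adjoin (adjoin_le_adjoin ?_) (mem_adjoin_of_mem (by simp)) (I_sq_mem _) ?_
  · rintro t (rfl | rfl) <;> exact mem_adjoin_of_mem (by simp)
  · rintro t (rfl | rfl | rfl)
    · exact exists_eq_of_mem _ (mem_adjoin_of_mem (by simp))
    · exact exists_eq_of_mem _ (mem_adjoin_of_mem (by simp))
    · exact exists_eq_of_mul (one_mem _) (by ring)

lemma quadGen_QiRp_Qipq (p q : ℕ) : QuadGen (QiRp p) (Qipq p q) (I * rt q) := by
  have hI := Complex.I_sq
  refine quadGen_of_adjoin (adjoin_le_adjoin ?_)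
    (mul_mem (mem_adjoin_of_mem (by simp)) (mem_adjoin_of_mem (by simp))) ?_ ?_
  · rintro t (rfl | rfl) <;> exact mem_adjoin_of_mem (by simp)
  · rw [I_mul_rt_sq]; exact neg_mem (_root_.natCast_mem _ q)
  · rintro t (rfl | rfl | rfl)
    · exact exists_eq_of_mem _ (mem_adjoin_of_mem (by simp))
    · exact exists_eq_of_mem _ (mem_adjoin_of_mem (by simp))
    · exact exists_eq_of_mul (b := -I) (neg_mem (mem_adjoin_of_mem (by simp)))
        (by linear_combination (rt q) * hI)

lemma quadGen_Q2Rq_Q2pq (p q : ℕ) : QuadGen (Q2Rq q) (Q2pq p q) (rt p) := by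
  refine quadGen_of_adjoin (adjoin_le_adjoin ?_) (mem_adjoin_of_mem (by simp)) (rt_sq_mem _ p) ?_
  · rintro t (rfl | rfl) <;> exact mem_adjoin_of_mem (by simp)
  · rintro t (rfl | rfl | rfl)
    · exact exists_eq_of_mem _ (mem_adjoin_of_mem (by simp))
    · exact exists_eq_of_mul (one_mem _) (by ring)
    · exact exists_eq_of_mem _ (mem_adjoin_of_mem (by simp))

lemma quadGen_Q2qi_Q2pqi (p q : ℕ) : QuadGen (Q2qi q) (Q2pqi p q) (rt p) := by
  refine quadGen_of_adjoin (adjoin_le_adjoin ?_) (mem_adjoin_of_mem (by simp)) (rt_sq_mem _ p) ?_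
  · rintro t (rfl | rfl | rfl) <;> exact mem_adjoin_of_mem (by simp)
  · rintro t (rfl | rfl | rfl | rfl)
    · exact exists_eq_of_mem _ (mem_adjoin_of_mem (by simp))
    · exact exists_eq_of_mul (one_mem _) (by ring)
    · exact exists_eq_of_mem _ (mem_adjoin_of_mem (by simp))
    · exact exists_eq_of_mem _ (mem_adjoin_of_mem (by simp))

lemma quadGen_Qipq_Q2pqi (p q : ℕ) : QuadGen (Qipq p q) (Q2pqi p q) (rt 2) := by
  refine quadGen_of_adjoin (adjoin_le_adjoin ?_) (mem_adjoin_of_mem (by simp)) (rt_sq_mem _ 2) ?_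
  · rintro t (rfl | rfl | rfl) <;> exact mem_adjoin_of_mem (by simp)
  · rintro t (rfl | rfl | rfl | rfl)
    · exact exists_eq_of_mul (one_mem _) (by ring)
    · exact exists_eq_of_mem _ (mem_adjoin_of_mem (by simp))
    · exact exists_eq_of_mem _ (mem_adjoin_of_mem (by simp))
    · exact exists_eq_of_mem _ (mem_adjoin_of_mem (by simp))

lemma quadGen_Q2pq_Q2pqi (p q : ℕ) : QuadGen (Q2pq p q) (Q2pqi p q) I := by
  refine quadGen_of_adjoin (adjoin_le_adjoin ?_) (mem_adjoin_of_mem (by simp)) (I_sq_mem _) ?_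
  · rintro t (rfl | rfl | rfl) <;> exact mem_adjoin_of_mem (by simp)
  · rintro t (rfl | rfl | rfl | rfl)
    · exact exists_eq_of_mem _ (mem_adjoin_of_mem (by simp))
    · exact exists_eq_of_mem _ (mem_adjoin_of_mem (by simp))
    · exact exists_eq_of_mem _ (mem_adjoin_of_mem (by simp))
    · exact exists_eq_of_mul (one_mem _) (by ring)

instance : NumberField (⊥ : IntermediateField ℚ ℂ) where
  to_charZero := inferInstance
  to_finiteDimensional := inferInstance

instance : NumberField Qi := quadGen_bot_Qi.numberField
instance (n : ℕ) : NumberField (Qq n) := (quadGen_bot_rt n).numberField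
instance (q : ℕ) : NumberField (Qnq q) := (quadGen_bot_Qnq q).numberField
instance (q : ℕ) : NumberField (Q2q q) := (quadGen_bot_Q2q q).numberField
instance (q : ℕ) : NumberField (Qn2q q) := (quadGen_bot_Qn2q q).numberField
instance : NumberField QiR2 := quadGen_Qi_QiR2.numberField
instance (p : ℕ) : NumberField (QiRp p) := (quadGen_Qi_QiRp p).numberField
instance (q : ℕ) : NumberField (Q2Rq q) := (quadGen_Qq_Q2Rq q).numberField
instance (q : ℕ) : NumberField (Q2Rnq q) := (quadGen_Qnq_Q2Rnq q).numberField
instance (q : ℕ) : NumberField (Q2qi q) := (quadGen_QiR2_Q2qi q).numberField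
instance (p q : ℕ) : NumberField (Qipq p q) := (quadGen_QiRp_Qipq p q).numberField
instance (p q : ℕ) : NumberField (Q2pq p q) := (quadGen_Q2Rq_Q2pq p q).numberField
instance (p q : ℕ) : NumberField (Q2pqi p q) := (quadGen_Q2qi_Q2pqi p q).numberField

end Fields

section Residues

lemma isSquare_zmod_iff (ℓ : ℕ) [NeZero ℓ] (a : ℤ) :
    IsSquare (a : ZMod ℓ) ↔ ∃ n : ℤ, (ℓ : ℤ) ∣ n ^ 2 - a := by
  constructor
  · rintro ⟨x, hx⟩
    obtain ⟨n, rfl⟩ := ZMod.intCast_surjective x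
    refine ⟨n, ?_⟩
    rw [← ZMod.intCast_zmod_eq_zero_iff_dvd]
    push_cast
    rw [hx]; ring
  · rintro ⟨n, hn⟩
    rw [← ZMod.intCast_zmod_eq_zero_iff_dvd] at hn
    push_cast at hn
    exact ⟨n, by linear_combination -hn⟩

lemma exists_dvd_sq_sub_of_jacobiSym {ℓ : ℕ} (hℓ : ℓ.Prime) {a : ℤ} (h : jacobiSym a ℓ = 1) :
    ∃ n : ℤ, (ℓ : ℤ) ∣ n ^ 2 - a := by
  have := Fact.mk hℓ
  rw [← jacobiSym.legendreSym.to_jacobiSym] at h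
  rw [← isSquare_zmod_iff, ← legendreSym.eq_one_iff]
  · exact h
  · intro h0
    rw [← legendreSym.eq_zero_iff] at h0
    omega

lemma not_dvd_sq_sub_of_jacobiSym {ℓ : ℕ} (hℓ : ℓ.Prime) {a : ℤ} (h : jacobiSym a ℓ = -1)
    (n : ℤ) : ¬ (ℓ : ℤ) ∣ n ^ 2 - a := by
  have := Fact.mk hℓ
  rw [← jacobiSym.legendreSym.to_jacobiSym, legendreSym.eq_neg_one_iff, isSquare_zmod_iff] at h
  exact fun hn => h ⟨n, hn⟩

/-- The common content of the two sets of conditions on `p` and `q`. -/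
structure PQ (p q : ℕ) : Prop where
  hp : p.Prime
  hq : q.Prime
  hp8 : p % 8 = 5 ∨ p % 8 = 3
  hq8 : q % 8 = 7
  jac : jacobiSym (p : ℤ) q = -1

lemma jacobiSym_two_eq {n : ℕ} (hn : n % 2 = 1) :
    jacobiSym 2 n = if n % 8 = 1 ∨ n % 8 = 7 then 1 else -1 := by
  rw [jacobiSym.at_two (Nat.odd_iff.2 hn), ZMod.χ₈_nat_eq_if_mod_eight, if_neg (by omega)]

namespace PQ

variable {p q : ℕ} (h : PQ p q)
include h

lemma ne : p ≠ q := by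
  have := h.hp8
  have := h.hq8
  omega

lemma p_odd : p % 2 = 1 := by
  have := h.hp8
  omega

lemma q_odd : q % 2 = 1 := by
  have := h.hq8
  omega

lemma jac_two : jacobiSym 2 p = -1 := by
  have := h.hp8
  rw [jacobiSym_two_eq h.p_odd, if_neg (by omega)]

lemma p_two (n : ℤ) : ¬ (p : ℤ) ∣ n ^ 2 - 2 := not_dvd_sq_sub_of_jacobiSym h.hp h.jac_two n

lemma jac_neg_one : jacobiSym (-1) q = -1 := by
  have := h.hq8
  rw [jacobiSym.at_neg_one (Nat.odd_iff.2 h.q_odd), ZMod.χ₄_nat_three_mod_four (by omega)]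

lemma q_one (n : ℤ) : ¬ (q : ℤ) ∣ n ^ 2 + 1 := by
  simpa using not_dvd_sq_sub_of_jacobiSym h.hq h.jac_neg_one n

lemma p_one (h5 : p % 8 = 5) : ∃ n : ℤ, (p : ℤ) ∣ n ^ 2 + 1 := by
  have h1 : jacobiSym (-1) p = 1 := by
    rw [jacobiSym.at_neg_one (Nat.odd_iff.2 h.p_odd), ZMod.χ₄_nat_one_mod_four (by omega)]
  obtain ⟨n, hn⟩ := exists_dvd_sq_sub_of_jacobiSym h.hp h1
  exact ⟨n, by simpa using hn⟩

lemma p_two_q (h5 : p % 8 = 5) : ∃ n : ℤ, (p : ℤ) ∣ n ^ 2 - 2 * q := by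
  have h1 : jacobiSym (2 * q) p = 1 := by
    rw [jacobiSym.mul_left, h.jac_two, ← jacobiSym.quadratic_reciprocity_one_mod_four (by omega)
      (Nat.odd_iff.2 h.q_odd), h.jac]; norm_num
  exact exists_dvd_sq_sub_of_jacobiSym h.hp h1

lemma jac_neg_one_p (h3 : p % 8 = 3) : jacobiSym (-1) p = -1 := by
  rw [jacobiSym.at_neg_one (Nat.odd_iff.2 h.p_odd), ZMod.χ₄_nat_three_mod_four (by omega)]

lemma p_neg_one (h3 : p % 8 = 3) (n : ℤ) : ¬ (p : ℤ) ∣ n ^ 2 + 1 := by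
  simpa using not_dvd_sq_sub_of_jacobiSym h.hp (h.jac_neg_one_p h3) n

lemma p_neg_two (h3 : p % 8 = 3) : ∃ n : ℤ, (p : ℤ) ∣ n ^ 2 + 2 := by
  have h1 : jacobiSym (-1 * 2) p = 1 := by
    rw [jacobiSym.mul_left, h.jac_two, h.jac_neg_one_p h3]; norm_num
  obtain ⟨n, hn⟩ := exists_dvd_sq_sub_of_jacobiSym h.hp h1
  exact ⟨n, by simpa using hn⟩

lemma p_q (h3 : p % 8 = 3) : ∃ n : ℤ, (p : ℤ) ∣ n ^ 2 - q := by
  have h8 := h.hq8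
  have h1 : jacobiSym q p = 1 := by
    rw [jacobiSym.quadratic_reciprocity_three_mod_four (by omega) (by omega), h.jac]; norm_num
  exact exists_dvd_sq_sub_of_jacobiSym h.hp h1

end PQ

end Residues

section Degrees

open Module
open Complex (I)

lemma finrank_bot_field : finrank ℚ (⊥ : IntermediateField ℚ ℂ) = 1 := IntermediateField.finrank_bot

lemma rt_notMem_bot {ℓ N : ℕ} (hℓ : ℓ.Prime) (h1 : ℓ ∣ N) (h2 : ¬ ℓ ^ 2 ∣ N) :
    rt N ∉ (⊥ : IntermediateField ℚ ℂ) := fun h => sq_ne_of_dvd hℓ h1 h2 h (rt_sq N)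

/-- A quadratic extension is generated by a non-element. -/
lemma QuadGen.ext {K L : IntermediateField ℚ ℂ} {x : ℂ} (h : QuadGen K L x) (hx : x ∉ K) :
    QuadExt K L x := { h with notMem := hx }

lemma QuadGen.ext_of_finrank {K L : IntermediateField ℚ ℂ} {x : ℂ} [NumberField K]
    (h : QuadGen K L x) (hf : finrank ℚ L = 2 * finrank ℚ K) : QuadExt K L x :=
  h.ext (h.notMem hf)

lemma Nat.not_sq_dvd_mul {ℓ n : ℕ} (hℓ : ℓ.Prime) (hn : ¬ ℓ ∣ n) : ¬ ℓ ^ 2 ∣ ℓ * n := by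
  rw [sq]
  exact fun h => hn (Nat.dvd_of_mul_dvd_mul_left hℓ.pos h)

/-- Subfields of `ℂ` generated by real numbers do not contain `I`. -/
lemma I_notMem_of_real {T : Set ℂ} (hT : ∀ t ∈ T, ∃ r : ℝ, (r : ℂ) = t) : I ∉ adjoin ℚ T := by
  intro h
  have hle : adjoin ℚ T ≤ (Complex.ofRealAm.restrictScalars ℚ).fieldRange :=
    adjoin_le_iff.2 fun t ht => by
      obtain ⟨r, rfl⟩ := hT t ht
      exact ⟨r, rfl⟩
  obtain ⟨r, hr⟩ := hle h
  have := congrArg Complex.im hr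
  simp at this

lemma ext_bot_Q2 : QuadExt ⊥ Q2 (rt 2) :=
  (quadGen_bot_rt 2).ext (rt_notMem_bot Nat.prime_two (dvd_refl 2) (by norm_num))

namespace PQ

variable {p q : ℕ} (h : PQ p q)
include h

lemma ext_bot_Qq : QuadExt ⊥ (Qq q) (rt q) :=
  (quadGen_bot_rt q).ext (rt_notMem_bot h.hq (dvd_refl q)
    (by simpa using Nat.not_sq_dvd_mul h.hq h.hq.not_dvd_one))

lemma ext_Q2_Q2Rq : QuadExt Q2 (Q2Rq q) (rt q) := by
  refine (quadGen_Q2_Q2Rq q).ext fun hx => ?_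
  rcases (quadGen_bot_rt 2).mem_or_mul_mem hx (rt_sq_mem _ q) with h1 | h1
  · exact h.ext_bot_Qq.notMem h1
  · have h2 : ¬ q ∣ 2 := fun h2 => by
      have := (Nat.prime_dvd_prime_iff_eq h.hq Nat.prime_two).1 h2
      have := h.hq8
      omega
    refine sq_ne_of_dvd (N := q * 2) h.hq (dvd_mul_right _ _) (Nat.not_sq_dvd_mul h.hq h2) h1 ?_
    rw [mul_pow, rt_sq, rt_sq]; push_cast; ring

lemma ext_Q2Rq_Q2pq : QuadExt (Q2Rq q) (Q2pq p q) (rt p) := by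
  have hpq : ¬ p ∣ q := fun h2 => h.ne ((Nat.prime_dvd_prime_iff_eq h.hp h.hq).1 h2)
  have hp2 : ¬ p ∣ 2 := fun h2 => by
    have := (Nat.prime_dvd_prime_iff_eq h.hp Nat.prime_two).1 h2
    have := h.p_odd
    omega
  have key : ∀ (n : ℕ) (y : ℂ), ¬ p ∣ n → y ^ 2 = (p * n : ℕ) →
      y ∉ (⊥ : IntermediateField ℚ ℂ) := fun n y hn h1 h2 =>
    sq_ne_of_dvd h.hp (dvd_mul_right _ _) (Nat.not_sq_dvd_mul h.hp hn) h2 h1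
  refine (quadGen_Q2Rq_Q2pq p q).ext fun hx => ?_
  rcases (quadGen_Q2_Q2Rq q).mem_or_mul_mem hx (rt_sq_mem _ p) with h1 | h1
  · rcases (quadGen_bot_rt 2).mem_or_mul_mem h1 (rt_sq_mem _ p) with h2 | h2
    · exact key 1 _ h.hp.not_dvd_one (by simp [rt_sq]) h2
    · exact key 2 _ hp2 (by rw [mul_pow, rt_sq, rt_sq]; push_cast; ring) h2
  · have h3 : (rt p * rt q) ^ 2 = ((p * q : ℕ) : ℂ) := by rw [mul_pow, rt_sq, rt_sq]; push_cast; ring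
    rcases (quadGen_bot_rt 2).mem_or_mul_mem h1 (by rw [h3]; exact _root_.natCast_mem _ _)
      with h2 | h2
    · exact key q _ hpq h3 h2
    · exact key (q * 2) _ (h.hp.not_dvd_mul hpq hp2)
        (by rw [mul_pow, h3, rt_sq]; push_cast; ring) h2

lemma ext_Q2pq_Q2pqi : QuadExt (Q2pq p q) (Q2pqi p q) I := by
  refine (quadGen_Q2pq_Q2pqi p q).ext (I_notMem_of_real ?_)
  rintro t (rfl | rfl | rfl) <;> exact ⟨_, rfl⟩

end PQ

end Degrees

section Degrees

open Module
open Complex (I)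

lemma rank_bot_field : Units.rank (⊥ : IntermediateField ℚ ℂ) = 0 := by
  have h1 := rank_of_real (K := (⊥ : IntermediateField ℚ ℂ)) (T := ∅) (adjoin_empty ℚ ℂ).symm
    (by simp)
  rw [finrank_bot_field] at h1
  omega

lemma cl2_bot_field : cl2 (⊥ : IntermediateField ℚ ℂ) = 0 := by
  have e : 𝓞 (⊥ : IntermediateField ℚ ℂ) ≃+* ℤ :=
    (RingOfIntegers.mapRingEquiv (IntermediateField.botEquiv ℚ ℂ).toRingEquiv).trans
      Rat.ringOfIntegersEquiv
  have h1 : IsPrincipalIdealRing (𝓞 (⊥ : IntermediateField ℚ ℂ)) :=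
    IsPrincipalIdealRing.of_surjective e.symm.toRingHom e.symm.surjective
  have h2 : Nat.card (ClassGroup (𝓞 (⊥ : IntermediateField ℚ ℂ))) = 1 := by
    rw [@Nat.card_eq_fintype_card _ instFintypeClassGroupOfIsPrincipalIdealRing]
    exact card_classGroup_eq_one (R := 𝓞 (⊥ : IntermediateField ℚ ℂ))
  rw [cl2, h2]
  simp

/-- The rank of the unit group of a field generated by square roots of natural numbers. -/
lemma rank_of_rt {K : IntermediateField ℚ ℂ} [NumberField K] {T : Set ℂ} (hK : K = adjoin ℚ T)
    (hT : ∀ t ∈ T, ∃ n : ℕ, t ^ 2 = n) : Units.rank K + 1 = finrank ℚ K :=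
  rank_of_real hK fun t ht => by
    obtain ⟨n, hn⟩ := hT t ht
    exact ⟨n, Nat.cast_nonneg n, n, by simp, by simpa using hn⟩

lemma rank_of_I {K : IntermediateField ℚ ℂ} [NumberField K] (hI : I ∈ K) :
    2 * (Units.rank K + 1) = finrank ℚ K :=
  rank_of_complex hI (r := -1) (by norm_num) (by simp)

namespace PQ

variable {p q : ℕ} (h : PQ p q)
include h

lemma finrank_Q2 : finrank ℚ Q2 = 2 := by rw [ext_bot_Q2.finrank_eq, finrank_bot_field]

lemma finrank_Qq : finrank ℚ (Qq q) = 2 := by rw [h.ext_bot_Qq.finrank_eq, finrank_bot_field]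

lemma finrank_Q2Rq : finrank ℚ (Q2Rq q) = 4 := by rw [h.ext_Q2_Q2Rq.finrank_eq, h.finrank_Q2]

lemma finrank_Q2pq : finrank ℚ (Q2pq p q) = 8 := by rw [h.ext_Q2Rq_Q2pq.finrank_eq, h.finrank_Q2Rq]

lemma finrank_Q2pqi : finrank ℚ (Q2pqi p q) = 16 := by
  rw [h.ext_Q2pq_Q2pqi.finrank_eq, h.finrank_Q2pq]

lemma finrank_Q2qi : finrank ℚ (Q2qi q) = 8 := by
  have h1 := (quadGen_Q2qi_Q2pqi p q).finrank_le
  have h2 := (quadGen_Q2Rq_Q2qi q).finrank_le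
  rw [h.finrank_Q2pqi] at h1
  rw [h.finrank_Q2Rq] at h2
  omega

lemma finrank_QiR2_and : finrank ℚ QiR2 = 4 ∧ finrank ℚ Qi = 2 := by
  have h1 := (quadGen_QiR2_Q2qi q).finrank_le
  have h2 := quadGen_Qi_QiR2.finrank_le
  have h3 := quadGen_bot_Qi.finrank_le
  rw [h.finrank_Q2qi] at h1
  rw [finrank_bot_field] at h3
  omega

lemma finrank_QiR2 : finrank ℚ QiR2 = 4 := h.finrank_QiR2_and.1

lemma finrank_Qi : finrank ℚ Qi = 2 := h.finrank_QiR2_and.2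

lemma finrank_Q2Rnq_and : finrank ℚ (Q2Rnq q) = 4 ∧ finrank ℚ (Qnq q) = 2 := by
  have h1 := (quadGen_Q2Rnq_Q2qi q).finrank_le
  have h2 := (quadGen_Qnq_Q2Rnq q).finrank_le
  have h3 := (quadGen_bot_Qnq q).finrank_le
  rw [h.finrank_Q2qi] at h1
  rw [finrank_bot_field] at h3
  omega

lemma finrank_Q2Rnq : finrank ℚ (Q2Rnq q) = 4 := h.finrank_Q2Rnq_and.1

lemma finrank_Qnq : finrank ℚ (Qnq q) = 2 := h.finrank_Q2Rnq_and.2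

lemma finrank_Qn2q : finrank ℚ (Qn2q q) = 2 := by
  have h2 := (quadGen_Qn2q_Q2Rnq q).finrank_le
  have h3 := (quadGen_bot_Qn2q q).finrank_le
  rw [h.finrank_Q2Rnq] at h2
  rw [finrank_bot_field] at h3
  omega

lemma finrank_Qipq_and : finrank ℚ (Qipq p q) = 8 ∧ finrank ℚ (QiRp p) = 4 := by
  have h1 := (quadGen_Qipq_Q2pqi p q).finrank_le
  have h2 := (quadGen_QiRp_Qipq p q).finrank_le
  have h3 := (quadGen_Qi_QiRp p).finrank_le
  rw [h.finrank_Q2pqi] at h1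
  rw [h.finrank_Qi] at h3
  omega

lemma finrank_Qipq : finrank ℚ (Qipq p q) = 8 := h.finrank_Qipq_and.1

lemma finrank_QiRp : finrank ℚ (QiRp p) = 4 := h.finrank_Qipq_and.2

lemma ext_bot_Q2q : QuadExt ⊥ (Q2q q) (rt 2 * rt q) := by
  refine (quadGen_bot_Q2q q).ext fun h1 => ?_
  have h2 : ¬ q ∣ 2 := fun h2 => by
    have := (Nat.prime_dvd_prime_iff_eq h.hq Nat.prime_two).1 h2
    have := h.hq8
    omega
  refine sq_ne_of_dvd (N := q * 2) h.hq (dvd_mul_right _ _) (Nat.not_sq_dvd_mul h.hq h2) h1 ?_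
  rw [mul_pow, rt_sq, rt_sq]; push_cast; ring

lemma finrank_Q2q : finrank ℚ (Q2q q) = 2 := by rw [h.ext_bot_Q2q.finrank_eq, finrank_bot_field]

lemma ext_bot_Qi : QuadExt ⊥ Qi I :=
  quadGen_bot_Qi.ext_of_finrank (by rw [h.finrank_Qi, finrank_bot_field])

lemma ext_bot_Qnq : QuadExt ⊥ (Qnq q) (I * rt q) :=
  (quadGen_bot_Qnq q).ext_of_finrank (by rw [h.finrank_Qnq, finrank_bot_field])

lemma ext_Qi_QiR2 : QuadExt Qi QiR2 (rt 2) :=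
  quadGen_Qi_QiR2.ext_of_finrank (by rw [h.finrank_QiR2, h.finrank_Qi])

lemma ext_Qi_QiRp : QuadExt Qi (QiRp p) (rt p) :=
  (quadGen_Qi_QiRp p).ext_of_finrank (by rw [h.finrank_QiRp, h.finrank_Qi])

lemma ext_Qq_Q2Rq : QuadExt (Qq q) (Q2Rq q) (rt 2) :=
  (quadGen_Qq_Q2Rq q).ext_of_finrank (by rw [h.finrank_Q2Rq, h.finrank_Qq])

lemma ext_Qn2q_Q2Rnq : QuadExt (Qn2q q) (Q2Rnq q) (rt 2) :=
  (quadGen_Qn2q_Q2Rnq q).ext_of_finrank (by rw [h.finrank_Q2Rnq, h.finrank_Qn2q])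

lemma ext_Qnq_Q2Rnq : QuadExt (Qnq q) (Q2Rnq q) (rt 2) :=
  (quadGen_Qnq_Q2Rnq q).ext_of_finrank (by rw [h.finrank_Q2Rnq, h.finrank_Qnq])

lemma ext_Q2_Q2Rnq : QuadExt Q2 (Q2Rnq q) (I * rt q) :=
  (quadGen_Q2_Q2Rnq q).ext_of_finrank (by rw [h.finrank_Q2Rnq, h.finrank_Q2])

lemma ext_Q2Rnq_Q2qi : QuadExt (Q2Rnq q) (Q2qi q) I :=
  (quadGen_Q2Rnq_Q2qi q).ext_of_finrank (by rw [h.finrank_Q2qi, h.finrank_Q2Rnq])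

lemma ext_QiR2_Q2qi : QuadExt QiR2 (Q2qi q) (rt q) :=
  (quadGen_QiR2_Q2qi q).ext_of_finrank (by rw [h.finrank_Q2qi, h.finrank_QiR2])

lemma ext_Q2Rq_Q2qi : QuadExt (Q2Rq q) (Q2qi q) I :=
  (quadGen_Q2Rq_Q2qi q).ext_of_finrank (by rw [h.finrank_Q2qi, h.finrank_Q2Rq])

lemma ext_QiRp_Qipq : QuadExt (QiRp p) (Qipq p q) (I * rt q) :=
  (quadGen_QiRp_Qipq p q).ext_of_finrank (by rw [h.finrank_Qipq, h.finrank_QiRp])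

lemma ext_Q2qi_Q2pqi : QuadExt (Q2qi q) (Q2pqi p q) (rt p) :=
  (quadGen_Q2qi_Q2pqi p q).ext_of_finrank (by rw [h.finrank_Q2pqi, h.finrank_Q2qi])

lemma ext_Qipq_Q2pqi : QuadExt (Qipq p q) (Q2pqi p q) (rt 2) :=
  (quadGen_Qipq_Q2pqi p q).ext_of_finrank (by rw [h.finrank_Q2pqi, h.finrank_Qipq])

lemma rank_Q2 : Units.rank Q2 = 1 := by
  have h1 := rank_of_rt (K := Q2) rfl (by rintro t rfl; exact ⟨2, rt_sq 2⟩)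
  have h2 := h.finrank_Q2
  omega

lemma rank_Qq : Units.rank (Qq q) = 1 := by
  have h1 := rank_of_rt (K := Qq q) rfl (by rintro t rfl; exact ⟨q, rt_sq q⟩)
  have h2 := h.finrank_Qq
  omega

lemma rank_Q2q : Units.rank (Q2q q) = 1 := by
  have h1 := rank_of_rt (K := Q2q q) rfl
    (by rintro t rfl; exact ⟨2 * q, by rw [rt_two_mul_rt_sq]; push_cast; ring⟩)
  have h2 := h.finrank_Q2q
  omega

lemma rank_Q2Rq : Units.rank (Q2Rq q) = 3 := by
  have h1 := rank_of_rt (K := Q2Rq q) rfl (by rintro t (rfl | rfl) <;> exact ⟨_, rt_sq _⟩)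
  have h2 := h.finrank_Q2Rq
  omega

lemma rank_Q2pq : Units.rank (Q2pq p q) = 7 := by
  have h1 := rank_of_rt (K := Q2pq p q) rfl
    (by rintro t (rfl | rfl | rfl) <;> exact ⟨_, rt_sq _⟩)
  have h2 := h.finrank_Q2pq
  omega

lemma rank_Qi : Units.rank Qi = 0 := by
  have h1 := rank_of_I (K := Qi) (mem_adjoin_of_mem (by simp))
  have h2 := h.finrank_Qi
  omega

lemma rank_QiR2 : Units.rank QiR2 = 1 := by
  have h1 := rank_of_I (K := QiR2) (mem_adjoin_of_mem (by simp))
  have h2 := h.finrank_QiR2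
  omega

lemma rank_QiRp : Units.rank (QiRp p) = 1 := by
  have h1 := rank_of_I (K := QiRp p) (mem_adjoin_of_mem (by simp))
  have h2 := h.finrank_QiRp
  omega

lemma rank_Q2qi : Units.rank (Q2qi q) = 3 := by
  have h1 := rank_of_I (K := Q2qi q) (mem_adjoin_of_mem (by simp))
  have h2 := h.finrank_Q2qi
  omega

lemma rank_Qipq : Units.rank (Qipq p q) = 3 := by
  have h1 := rank_of_I (K := Qipq p q) (mem_adjoin_of_mem (by simp))
  have h2 := h.finrank_Qipq
  omega

lemma rank_Q2pqi : Units.rank (Q2pqi p q) = 7 := by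
  have h1 := rank_of_I (K := Q2pqi p q) (mem_adjoin_of_mem (by simp))
  have h2 := h.finrank_Q2pqi
  omega

lemma q_pos : (0 : ℚ) < q := by exact_mod_cast h.hq.pos

lemma rank_Qnq : Units.rank (Qnq q) = 0 := by
  have h1 := rank_of_complex (K := Qnq q) (mem_adjoin_of_mem rfl) (r := -q)
    (neg_lt_zero.2 h.q_pos) (by rw [I_mul_rt_sq]; push_cast; rfl)
  have h2 := h.finrank_Qnq
  omega

lemma rank_Q2Rnq : Units.rank (Q2Rnq q) = 1 := by
  have h1 := rank_of_complex (K := Q2Rnq q) (z := I * rt q) (mem_adjoin_of_mem (by simp)) (r := -q)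
    (neg_lt_zero.2 h.q_pos) (by rw [I_mul_rt_sq]; push_cast; rfl)
  have h2 := h.finrank_Q2Rnq
  omega

lemma rank_Qn2q : Units.rank (Qn2q q) = 0 := by
  have h1 := rank_of_complex (K := Qn2q q) (mem_adjoin_of_mem rfl) (r := -(2 * q))
    (neg_lt_zero.2 (mul_pos two_pos h.q_pos)) (by rw [I_mul_rt_two_mul_rt_sq]; push_cast; rfl)
  have h2 := h.finrank_Qn2q
  omega

end PQ

end Degrees

section Odd

open Module IsDedekindDomain
open Complex (I)

namespace QuadExt.DiscMem

variable {K L : IntermediateField ℚ ℂ} {x : ℂ} {P : HeightOneSpectrum (𝓞 L)}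

lemma four_mul (h : DiscMem K x P) {b : ℂ} (hb : b ∈ K) {n : ℤ} (hn : (b * x) ^ 2 = n) :
    ((4 * n : ℤ) : 𝓞 L) ∈ P.asIdeal := by
  refine h 0 K.zero_mem b hb _ ?_ (by push_cast; rw [← hn]; ring)
  rw [zero_add]
  exact isIntegral_of_sq n hn

lemma four_mul_add_one (h : DiscMem K x P) {b : ℂ} (hb : b ∈ K) {n k : ℤ} (hn : (b * x) ^ 2 = n)
    (hk : n = 4 * k + 1) : (n : 𝓞 L) ∈ P.asIdeal := by
  subst hk
  have h2 : ((2 : ℕ) : ℂ) ∈ K := _root_.natCast_mem K 2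
  refine h (1 / (2 : ℕ)) (K.div_mem K.one_mem h2) (b / (2 : ℕ)) (K.div_mem hb h2) _ ?_ ?_
  · refine isIntegral_of_quadratic (-1) (-k) ?_
    push_cast at hn ⊢
    linear_combination (1 / 4) * hn
  · rw [← hn]
    push_cast
    ring

end QuadExt.DiscMem

variable {K : IntermediateField ℚ ℂ} [NumberField K]

/-- Bounding the number of primes above `ℓ` by ramification. -/
lemma ncard_primesAbove_mul_le {ℓ : ℕ} (hℓ : ℓ.Prime) {e n : ℕ} (hn : finrank ℚ K = n)
    (he : ∀ P ∈ primesAbove K ℓ, (ℓ : 𝓞 K) ∈ P.asIdeal ^ e) :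
    (primesAbove K ℓ).ncard * e ≤ n := by
  have := ncard_primesAbove_le hℓ e 1 he (fun P hP => le_absNorm hℓ hP)
  rwa [hn, one_mul] at this

lemma ncard_primesAbove_bot_le {ℓ : ℕ} (hℓ : ℓ.Prime) :
    (primesAbove (⊥ : IntermediateField ℚ ℂ) ℓ).ncard ≤ 1 := by
  have := ncard_primesAbove_mul_le hℓ (e := 1) finrank_bot_field
    (fun P hP => by rw [pow_one]; exact hP)
  omega

lemma two_mem_sq_of_I (hI : I ∈ K) {P : HeightOneSpectrum (𝓞 K)} (hP : P ∈ primesAbove K 2) :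
    ((2 : ℕ) : 𝓞 K) ∈ P.asIdeal ^ 2 := by
  have h2 := Complex.I_sq
  refine natCast_mem_pow_of_eq Nat.prime_two hP 2 (y := 1 + I) (c := -I) (c' := I) (n := 1)
    (n' := 1) (K.add_mem K.one_mem hI) (K.neg_mem hI) hI (isIntegral_one.add isIntegral_I)
    isIntegral_I.neg isIntegral_I (by norm_num) (by norm_num) ?_ ?_
  · push_cast
    linear_combination (-I - 2) * h2
  · push_cast
    linear_combination -h2

lemma two_mem_sq_of_rt_two (hI : rt 2 ∈ K) {P : HeightOneSpectrum (𝓞 K)}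
    (hP : P ∈ primesAbove K 2) : ((2 : ℕ) : 𝓞 K) ∈ P.asIdeal ^ 2 := by
  refine natCast_mem_pow_of_eq Nat.prime_two hP 2 (y := rt 2) (c := 1) (c' := 1) (n := 1)
    (n' := 1) hI K.one_mem K.one_mem (isIntegral_rt 2) isIntegral_one isIntegral_one
    (by norm_num) (by norm_num) ?_ ?_
  · rw [rt_sq]; push_cast; ring
  · norm_num

lemma exists_rat_of_mem_bot {a : ℂ} (ha : a ∈ (⊥ : IntermediateField ℚ ℂ)) : ∃ r : ℚ, (r : ℂ) = a :=
  mem_bot.1 ha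

lemma sq_add_ne_neg_one {n : ℕ} {a b : ℂ} (ha : a ∈ (⊥ : IntermediateField ℚ ℂ))
    (hb : b ∈ (⊥ : IntermediateField ℚ ℂ)) : a ^ 2 + n * b ^ 2 ≠ -1 := by
  obtain ⟨r, rfl⟩ := exists_rat_of_mem_bot ha
  obtain ⟨s, rfl⟩ := exists_rat_of_mem_bot hb
  intro h
  have h1 : r ^ 2 + n * s ^ 2 = -1 := by exact_mod_cast h
  have h2 : 0 ≤ (n : ℚ) * s ^ 2 := by positivity
  nlinarith [sq_nonneg r]

lemma sq_sub_ne_neg_one {n ℓ : ℕ} (hℓ : ℓ.Prime) (h4 : ℓ % 4 = 3) (hn : ¬ ℓ ∣ n) {a b : ℂ}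
    (ha : a ∈ (⊥ : IntermediateField ℚ ℂ)) (hb : b ∈ (⊥ : IntermediateField ℚ ℂ)) :
    a ^ 2 - (ℓ * n : ℕ) * b ^ 2 ≠ -1 := by
  obtain ⟨r, rfl⟩ := exists_rat_of_mem_bot ha
  obtain ⟨s, rfl⟩ := exists_rat_of_mem_bot hb
  intro h
  have h1 : r ^ 2 - (ℓ * n : ℕ) * s ^ 2 = -1 := by exact_mod_cast h
  have h2 : (r.num * s.den) ^ 2 + (r.den * s.den) ^ 2 = ((ℓ * n : ℕ) : ℤ) * (s.num * r.den) ^ 2 := by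
    have hr := Rat.mul_den_eq_num r
    have hs := Rat.mul_den_eq_num s
    qify
    rw [← hr, ← hs]
    push_cast at h1 ⊢
    linear_combination (r.den : ℚ) ^ 2 * s.den ^ 2 * h1
  have h3 : (r.num * s.den).natAbs ^ 2 + (r.den * s.den) ^ 2 =
      (ℓ * n) * (s.num * r.den).natAbs ^ 2 := by
    zify
    rw [sq_abs, sq_abs]
    exact_mod_cast h2
  have hZ : 0 < r.den * s.den := Nat.mul_pos r.den_pos s.den_pos
  have hN : (ℓ * n) * (s.num * r.den).natAbs ^ 2 ≠ 0 := by
    rw [← h3]; positivity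
  have hn0 : n ≠ 0 := fun h0 => hn (h0 ▸ dvd_zero ℓ)
  have hY : (s.num * r.den).natAbs ≠ 0 := fun h0 => hN (by rw [h0]; ring)
  have h5 := (Nat.eq_sq_add_sq_iff (n := (ℓ * n) * (s.num * r.den).natAbs ^ 2)).1 ⟨_, _, h3.symm⟩
    (q := ℓ) (Nat.mem_primeFactors.2 ⟨hℓ, ⟨n * (s.num * r.den).natAbs ^ 2, by ring⟩, hN⟩) h4
  have := Fact.mk hℓ
  rw [padicValNat.mul (mul_ne_zero hℓ.ne_zero hn0) (pow_ne_zero _ hY),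
    padicValNat.mul hℓ.ne_zero hn0, padicValNat.self hℓ.one_lt, padicValNat.pow,
    padicValNat.eq_zero_of_not_dvd hn] at h5
  rw [Nat.even_iff] at h5
  omega

namespace PQ

variable {p q : ℕ} (h : PQ p q)
include h

lemma cl2_Qi : cl2 Qi = 0 := by
  refine h.ext_bot_Qi.cl2_eq_zero ?_
  have h1 := h.ext_bot_Qi.ambiguous_class_number
  rw [h.rank_Qi, rank_bot_field, cl2_bot_field] at h1
  have h2 : h.ext_bot_Qi.ram ≤ _ := h.ext_bot_Qi.ram_le two_ne_zero fun P hP =>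
    intCast_mem_of_dvd_pow 2 (hP.four_mul (one_mem _) (n := -1) (by simp)) (by norm_num)
  have h3 := ncard_primesAbove_bot_le Nat.prime_two
  have h4 := h.ext_bot_Qi.one_le_idx_of_neg_one fun a ha b hb h5 =>
    sq_add_ne_neg_one (n := 1) ha hb (by rw [← h5, Complex.I_sq]; push_cast; ring)
  omega

lemma cl2_Q2 : cl2 Q2 = 0 := by
  refine ext_bot_Q2.cl2_eq_zero ?_
  have h1 := ext_bot_Q2.ambiguous_class_number
  rw [h.rank_Q2, rank_bot_field, cl2_bot_field] at h1
  have h2 : ext_bot_Q2.ram ≤ _ := ext_bot_Q2.ram_le two_ne_zero fun P hP =>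
    intCast_mem_of_dvd_pow 3 (hP.four_mul (one_mem _) (n := 2) (by rw [one_mul, rt_sq]; norm_num))
      (by norm_num)
  have h3 := ncard_primesAbove_bot_le Nat.prime_two
  omega

/-- Discriminants for `x = √-q`. -/
lemma q_mem_of_discMem {K L : IntermediateField ℚ ℂ} {P : HeightOneSpectrum (𝓞 L)}
    (hP : QuadExt.DiscMem K (I * rt q) P) : (q : 𝓞 L) ∈ P.asIdeal := by
  have h8 := h.hq8
  have h1 := hP.four_mul_add_one (one_mem _) (n := -q) (k := -((q + 1) / 4))
    (by rw [one_mul, I_mul_rt_sq]; push_cast; ring) (by omega)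
  exact intCast_mem_of_dvd_pow 1 h1 (by simp)

lemma cl2_Qnq : cl2 (Qnq q) = 0 := by
  refine h.ext_bot_Qnq.cl2_eq_zero ?_
  have h1 := h.ext_bot_Qnq.ambiguous_class_number
  rw [h.rank_Qnq, rank_bot_field, cl2_bot_field] at h1
  have h2 : h.ext_bot_Qnq.ram ≤ _ := h.ext_bot_Qnq.ram_le h.hq.ne_zero fun P hP =>
    h.q_mem_of_discMem hP
  have h3 := ncard_primesAbove_bot_le h.hq
  have h4 := h.ext_bot_Qnq.one_le_idx_of_neg_one fun a ha b hb h5 =>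
    sq_add_ne_neg_one (n := q) ha hb (by rw [← h5, I_mul_rt_sq]; ring)
  omega

lemma cl2_QiR2 : cl2 QiR2 = 0 := by
  refine h.ext_Qi_QiR2.cl2_eq_zero ?_
  have h1 := h.ext_Qi_QiR2.ambiguous_class_number
  rw [h.rank_QiR2, h.rank_Qi, h.cl2_Qi] at h1
  have h2 : h.ext_Qi_QiR2.ram ≤ _ := h.ext_Qi_QiR2.ram_le two_ne_zero fun P hP =>
    intCast_mem_of_dvd_pow 3 (hP.four_mul (one_mem _) (n := 2) (by rw [one_mul, rt_sq]; norm_num))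
      (by norm_num)
  have h3 := ncard_primesAbove_mul_le Nat.prime_two h.finrank_Qi
    fun P hP => two_mem_sq_of_I (mem_adjoin_of_mem (by simp)) hP
  omega

lemma cl2_Qq : cl2 (Qq q) = 0 := by
  have h8 := h.hq8
  refine h.ext_bot_Qq.cl2_eq_zero ?_
  have h1 := h.ext_bot_Qq.ambiguous_class_number
  rw [h.rank_Qq, rank_bot_field, cl2_bot_field] at h1
  have h2 : h.ext_bot_Qq.ram ≤ _ := h.ext_bot_Qq.ram_le_add two_ne_zero h.hq.ne_zero fun P hP => by
    have h3 := hP.four_mul (one_mem _) (n := q) (by rw [one_mul, rt_sq]; norm_num)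
    have h4 : (((2 : ℕ) : 𝓞 (Qq q)) * ((2 : ℕ) : 𝓞 (Qq q))) * (q : 𝓞 (Qq q)) ∈ P.asIdeal := by
      push_cast at h3 ⊢
      convert h3 using 1
      ring
    rcases P.isPrime.mem_or_mem h4 with h5 | h5
    · exact Or.inl ((P.isPrime.mem_or_mem h5).elim id id)
    · exact Or.inr h5
  have h3 := ncard_primesAbove_bot_le Nat.prime_two
  have h4 := ncard_primesAbove_bot_le h.hq
  have h5 := h.ext_bot_Qq.one_le_idx_of_neg_one fun a ha b hb h5 =>
    sq_sub_ne_neg_one (n := 1) h.hq (by omega) h.hq.not_dvd_one ha hb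
      (by rw [← h5, rt_sq]; push_cast; ring)
  omega

lemma q_not_dvd_two : ¬ q ∣ 2 := fun h2 => by
  have := (Nat.prime_dvd_prime_iff_eq h.hq Nat.prime_two).1 h2
  have := h.hq8
  omega

lemma cl2_Q2q : cl2 (Q2q q) = 0 := by
  have h8 := h.hq8
  refine h.ext_bot_Q2q.cl2_eq_zero ?_
  have h1 := h.ext_bot_Q2q.ambiguous_class_number
  rw [h.rank_Q2q, rank_bot_field, cl2_bot_field] at h1
  have h2 : h.ext_bot_Q2q.ram ≤ _ :=
    h.ext_bot_Q2q.ram_le_add two_ne_zero h.hq.ne_zero fun P hP => by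
    have h3 := hP.four_mul (one_mem _) (n := 2 * q)
      (by rw [one_mul, rt_two_mul_rt_sq]; push_cast; rfl)
    have h4 : ((2 : ℕ) : 𝓞 (Q2q q)) ^ 3 * (q : 𝓞 (Q2q q)) ∈ P.asIdeal := by
      push_cast at h3 ⊢
      convert h3 using 1
      ring
    exact (P.isPrime.mem_or_mem h4).imp_left (P.isPrime.mem_of_pow_mem 3)
  have h3 := ncard_primesAbove_bot_le Nat.prime_two
  have h4 := ncard_primesAbove_bot_le h.hq
  have h5 := h.ext_bot_Q2q.one_le_idx_of_neg_one fun a ha b hb h5 =>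
    sq_sub_ne_neg_one (n := 2) h.hq (by omega) h.q_not_dvd_two ha hb
      (by rw [← h5, rt_two_mul_rt_sq]; push_cast; ring)
  omega

/-- The prime `2` ramifies in `ℚ(√q)`. -/
lemma two_mem_sq_of_rt_q {K : IntermediateField ℚ ℂ} [NumberField K] (hK : rt q ∈ K)
    {P : HeightOneSpectrum (𝓞 K)} (hP : P ∈ primesAbove K 2) :
    ((2 : ℕ) : 𝓞 K) ∈ P.asIdeal ^ 2 := by
  have h8 := h.hq8
  obtain ⟨k, hk⟩ : ∃ k : ℕ, q = 8 * k + 7 := ⟨q / 8, by omega⟩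
  have h2 := rt_sq q
  have h3 : (q : ℂ) = 8 * k + 7 := by exact_mod_cast hk
  have hc : ((4 * k + 4 : ℕ) : ℂ) ∈ K := _root_.natCast_mem K _
  have hci : IsIntegral ℤ ((4 * k + 4 : ℕ) : ℂ) := by
    simpa using isIntegral_int ((4 * k + 4 : ℕ) : ℤ)
  set N : ℤ := (4 * k + 4) ^ 2 - (8 * k + 7) with hN
  have hodd : ¬ (2 : ℤ) ∣ N := by
    rw [hN]
    have : ((4 : ℤ) * k + 4) ^ 2 - (8 * k + 7) = 2 * (8 * k ^ 2 + 12 * k + 4) + 1 := by ring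
    omega
  have h5 : (((4 * k + 4 : ℕ) : ℂ) - rt q) * (((4 * k + 4 : ℕ) : ℂ) + rt q) = N := by
    rw [hN]
    push_cast
    linear_combination -h2 - h3
  refine natCast_mem_pow_of_eq Nat.prime_two hP 2 (y := 1 + rt q)
    (c := ((4 * k + 4 : ℕ) : ℂ) - rt q) (c' := ((4 * k + 4 : ℕ) : ℂ) + rt q) (n := N)
    (n' := N) (K.add_mem K.one_mem hK) (K.sub_mem hc hK) (K.add_mem hc hK)
    (isIntegral_one.add (isIntegral_rt q)) (hci.sub (isIntegral_rt q))
    (hci.add (isIntegral_rt q)) hodd hodd ?_ h5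
  rw [← h5]
  push_cast
  linear_combination (4 * (k : ℂ) + 4 - rt q) * (h2 + h3)

lemma cl2_Q2Rq : cl2 (Q2Rq q) = 0 := by
  refine h.ext_Qq_Q2Rq.cl2_eq_zero ?_
  have h1 := h.ext_Qq_Q2Rq.ambiguous_class_number
  rw [h.rank_Q2Rq, h.rank_Qq, h.cl2_Qq] at h1
  have h2 : h.ext_Qq_Q2Rq.ram ≤ _ := h.ext_Qq_Q2Rq.ram_le two_ne_zero fun P hP =>
    intCast_mem_of_dvd_pow 3 (hP.four_mul (one_mem _) (n := 2) (by rw [one_mul, rt_sq]; norm_num))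
      (by norm_num)
  have h3 := ncard_primesAbove_mul_le Nat.prime_two h.finrank_Qq
    fun P hP => h.two_mem_sq_of_rt_q (mem_adjoin_of_mem (by simp)) hP
  omega

end PQ

end Odd

section PellNegative

lemma exists_sq_of_mul_eq_prime_mul_sq {p : ℕ} (hp : p.Prime) {A B v : ℤ} (hA : 0 < A) (hB : 0 < B)
    (hAB : IsCoprime A B) (hv : A * B = p * v ^ 2) :
    (∃ a b : ℤ, A = p * a ^ 2 ∧ B = b ^ 2) ∨ ∃ a b : ℤ, A = b ^ 2 ∧ B = p * a ^ 2 := by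
  have key : ∀ A B : ℤ, 0 < A → 0 < B → IsCoprime A B → A * B = p * v ^ 2 → (p : ℤ) ∣ A →
      ∃ a b : ℤ, A = p * a ^ 2 ∧ B = b ^ 2 := by
    rintro A B hA hB hAB hv ⟨C, rfl⟩
    have hp0 : (0 : ℤ) < p := by exact_mod_cast hp.pos
    have hC : 0 < C := pos_of_mul_pos_right hA hp0.le
    have h1 : C * B = v ^ 2 := by
      apply mul_left_cancel₀ hp0.ne'
      rw [← hv]; ring
    have h2 : IsCoprime C B := hAB.of_mul_left_right
    obtain ⟨a, ha⟩ := Int.sq_of_isCoprime h2 h1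
    obtain ⟨b, hb⟩ := Int.sq_of_isCoprime h2.symm (by rw [mul_comm]; exact h1)
    refine ⟨a, b, ?_, ?_⟩
    · rcases ha with rfl | rfl
      · rfl
      · nlinarith [sq_nonneg a]
    · rcases hb with rfl | rfl
      · rfl
      · nlinarith [sq_nonneg b]
  rcases (Nat.prime_iff_prime_int.1 hp).dvd_or_dvd (Dvd.intro _ hv.symm) with h1 | h1
  · exact Or.inl (key A B hA hB hAB hv h1)
  · obtain ⟨a, b, h2, h3⟩ := key B A hB hA hAB.symm (by rw [mul_comm]; exact hv) h1
    exact Or.inr ⟨a, b, h3, h2⟩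

lemma Nat.Prime.not_isSquare_int {p : ℕ} (hp : p.Prime) : ¬ IsSquare (p : ℤ) :=
  (Nat.prime_iff_prime_int.1 hp).irreducible.not_isSquare

/-- Splitting the fundamental solution of the Pell equation of a prime. -/
lemma exists_pell_split {p : ℕ} (hp : p.Prime) :
    (∃ a b : ℤ, p * a ^ 2 - b ^ 2 = 1) ∨
      ((p % 4 = 1 → False) ∧ ∃ a b : ℤ, p * a ^ 2 - b ^ 2 = 2 ∨ b ^ 2 - p * a ^ 2 = 2) := by
  obtain ⟨s, hs⟩ := Pell.IsFundamental.exists_of_not_isSquare (d := p)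
    (by exact_mod_cast hp.pos) hp.not_isSquare_int
  have hprop := s.prop
  have hx := hs.1
  have hmin : ∀ b : Pell.Solution₁ (p : ℤ), 1 < b.x → s.x ≤ b.x := fun b hb => hs.2.2 hb
  set u := s.x
  set v := s.y
  rcases Int.even_or_odd' u with ⟨k, hk | hk⟩
  · right
    refine ⟨fun h4 => ?_, ?_⟩
    · have h5 : (p : ℤ) * v ^ 2 = 4 * k ^ 2 - 1 := by rw [hk] at hprop; linarith
      obtain ⟨t, ht⟩ : ∃ t : ℤ, (p : ℤ) = 4 * t + 1 := ⟨p / 4, by omega⟩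
      rcases Int.even_or_odd' v with ⟨j, hj | hj⟩
      · rw [hj] at h5
        have : (4 : ℤ) * (p * j ^ 2 - k ^ 2) = -1 := by linarith
        omega
      · rw [hj, ht] at h5
        have : (4 : ℤ) * ((4 * t + 1) * (j ^ 2 + j) + t - k ^ 2) = -2 := by linarith
        omega
    · have h5 : (u - 1) * (u + 1) = p * v ^ 2 := by linarith
      rcases exists_sq_of_mul_eq_prime_mul_sq hp (by omega) (by omega)
        (⟨k, 1 - k, by rw [hk]; ring⟩ : IsCoprime (u - 1) (u + 1)) h5 with
        ⟨a, b, h6, h7⟩ | ⟨a, b, h6, h7⟩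
      · exact ⟨a, b, Or.inr (by linarith)⟩
      · exact ⟨a, b, Or.inl (by linarith)⟩
  · left
    have hv : Even v := by
      by_contra hv
      rw [Int.not_even_iff_odd] at hv
      have hp2 : p ≠ 2 := by
        rintro rfl
        obtain ⟨j, hj⟩ := hv
        rw [hk, hj] at hprop
        push_cast at hprop
        have h9 : (2 : ℤ) * (k ^ 2 + k) = (2 * j + 1) ^ 2 := by linarith
        have : (2 : ℤ) * (k ^ 2 + k - 2 * j ^ 2 - 2 * j) = 1 := by linarith
        omega
      obtain ⟨i, hi⟩ := hp.odd_of_ne_two hp2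
      obtain ⟨j, hj⟩ := hv
      rw [hk, hj, hi] at hprop
      push_cast at hprop
      have : (2 : ℤ) * (2 * (k ^ 2 + k) - (2 * i + 1) * (2 * j ^ 2 + 2 * j) - i) = 1 := by linarith
      omega
    obtain ⟨j, hj⟩ := hv
    have h5 : k * (k + 1) = p * j ^ 2 := by
      rw [hk, hj] at hprop
      linarith
    rcases exists_sq_of_mul_eq_prime_mul_sq hp (by omega) (by omega)
      (⟨-1, 1, by ring⟩ : IsCoprime k (k + 1)) h5 with ⟨a, b, h6, h7⟩ | ⟨a, b, h6, h7⟩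
    · exfalso
      have h8 : |b| ^ 2 - p * a ^ 2 = 1 := by rw [sq_abs]; linarith
      have h9 : 1 < |b| := by
        by_contra! h9
        have : |b| ^ 2 ≤ 1 := by nlinarith [abs_nonneg b]
        rw [sq_abs] at this
        omega
      have h10 : u ≤ |b| := hmin (Pell.Solution₁.mk |b| a h8) h9
      have : |b| ^ 2 = k + 1 := by rw [sq_abs]; exact h7.symm
      nlinarith
    · exact ⟨a, b, by linarith⟩

lemma exists_sq_sub_eq_neg_one {p : ℕ} (hp : p.Prime) (h4 : p % 4 = 1) :
    ∃ x y : ℤ, x ^ 2 - p * y ^ 2 = -1 := by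
  rcases exists_pell_split hp with ⟨a, b, h⟩ | ⟨h, -⟩
  · exact ⟨b, a, by linarith⟩
  · exact (h h4).elim

lemma PQ.exists_sq_sub_eq_neg_two {p q : ℕ} (h : PQ p q) (h3 : p % 8 = 3) :
    ∃ x y : ℤ, x ^ 2 - p * y ^ 2 = -2 := by
  rcases exists_pell_split h.hp with ⟨a, b, h1⟩ | ⟨-, a, b, h1 | h1⟩
  · exact (h.p_neg_one h3 b ⟨a ^ 2, by linarith⟩).elim
  · exact ⟨b, a, by linarith⟩
  · exact (h.p_two b ⟨a ^ 2, by linarith⟩).elim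

end PellNegative

section Frobenius

/-- The Frobenius on a square root of a nonresidue. -/
lemma pow_char_eq_neg {F : Type*} [CommRing F] {q : ℕ} [Fact q.Prime] [CharP F q] (hq : q % 2 = 1)
    {a : ℤ} (ha : jacobiSym a q = -1) {s : F} (hs : s ^ 2 = a) : s ^ q = -s := by
  have h1 : (a : F) ^ (q / 2) = -1 := by
    rw [← jacobiSym.legendreSym.to_jacobiSym] at ha
    have h2 := legendreSym.eq_pow q a
    rw [ha] at h2
    have h3 := congrArg (ZMod.castHom (dvd_refl q) F) h2
    rw [map_pow, map_intCast, map_intCast] at h3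
    rw [← h3]
    simp
  have h4 : q = 2 * (q / 2) + 1 := by omega
  rw [h4, pow_succ, pow_mul, hs, h1]
  ring

lemma intCast_pow_char {F : Type*} [CommRing F] {q : ℕ} [Fact q.Prime] [CharP F q] (n : ℤ) :
    (n : F) ^ q = n := by
  have h := congrArg (ZMod.castHom (dvd_refl q) F) (ZMod.pow_card (n : ZMod q))
  rwa [map_pow, map_intCast] at h

lemma intCast_add_mul_pow_char {F : Type*} [CommRing F] {q : ℕ} [Fact q.Prime] [CharP F q]
    (hq : q % 2 = 1) {a : ℤ} (ha : jacobiSym a q = -1) {s : F} (hs : s ^ 2 = a) (x y : ℤ) :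
    (x + y * s) ^ q = x - y * s := by
  rw [add_pow_char, mul_pow, intCast_pow_char, intCast_pow_char, pow_char_eq_neg hq ha hs]
  ring

end Frobenius

section OddTwo

open Module IsDedekindDomain
open Complex (I)

/-- The residue ring has characteristic `ℓ`. -/
lemma charP_quotient {K : Type*} [Field K] [NumberField K] {ℓ : ℕ} (hℓ : ℓ.Prime)
    {P : HeightOneSpectrum (𝓞 K)} (hP : P ∈ primesAbove K ℓ) : CharP (𝓞 K ⧸ P.asIdeal) ℓ := by
  have : Nontrivial (𝓞 K ⧸ P.asIdeal) := Ideal.Quotient.nontrivial_iff.2 P.isPrime.ne_top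
  refine (CharP.charP_iff_prime_eq_zero hℓ).2 ?_
  rw [← map_natCast (Ideal.Quotient.mk P.asIdeal)]
  exact Ideal.Quotient.eq_zero_iff_mem.2 hP

lemma pow_add_one_mem_of_I {K : Type*} [Field K] [NumberField K] {P : HeightOneSpectrum (𝓞 K)}
    {i : 𝓞 K} (hi : i ^ 2 = -1) {t : ℕ} (ht : t % 4 = 2) : i ^ t + 1 ∈ P.asIdeal := by
  have h1 : t = 2 * (2 * (t / 4) + 1) := by omega
  rw [h1, pow_mul, hi, pow_succ, pow_mul]
  simp

/-- An element whose Frobenius conjugate is its negative inverse. -/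
lemma pow_add_one_mem_of_char {K : Type*} [Field K] [NumberField K] {q : ℕ} (hq4 : q % 4 = 3)
    {P : HeightOneSpectrum (𝓞 K)} {u : 𝓞 K}
    (hu : (Ideal.Quotient.mk P.asIdeal u) ^ (q + 1) = -1) {t : ℕ} (ht : q ^ 2 = 2 * t + 1) :
    u ^ t + 1 ∈ P.asIdeal := by
  obtain ⟨k, rfl⟩ : ∃ k, q = 4 * k + 3 := ⟨q / 4, by omega⟩
  have h1 : t = (4 * k + 3 + 1) * (2 * k + 1) := by
    have h2 : (4 * k + 3) ^ 2 = 2 * ((4 * k + 3 + 1) * (2 * k + 1)) + 1 := by ring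
    omega
  rw [← Ideal.Quotient.eq_zero_iff_mem, map_add, map_pow, h1, pow_mul, hu, pow_succ, pow_mul]
  simp

namespace PQ

variable {p q : ℕ} (h : PQ p q)
include h

lemma p_mem_of_discMem {K L : IntermediateField ℚ ℂ} (hI : I ∈ K) {P : HeightOneSpectrum (𝓞 L)}
    (hP : QuadExt.DiscMem K (rt p) P) : (p : 𝓞 L) ∈ P.asIdeal := by
  rcases h.hp8 with h8 | h8
  · have h1 := hP.four_mul_add_one K.one_mem (n := p) (k := p / 4)
      (by rw [one_mul, rt_sq]; push_cast; ring) (by omega)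
    exact intCast_mem_of_dvd_pow 1 h1 (by simp)
  · have h1 := hP.four_mul_add_one hI (n := -p) (k := -((p + 1) / 4))
      (by rw [I_mul_rt_sq]; push_cast; ring) (by omega)
    exact intCast_mem_of_dvd_pow 1 h1 (by simp)

lemma cl2_QiRp : cl2 (QiRp p) = 0 := by
  refine h.ext_Qi_QiRp.cl2_eq_zero ?_
  have hI : I ∈ Qi := mem_adjoin_of_mem rfl
  have h1 := h.ext_Qi_QiRp.ambiguous_class_number
  rw [h.rank_QiRp, h.rank_Qi, h.cl2_Qi] at h1
  have h2 : h.ext_Qi_QiRp.ram ≤ _ := h.ext_Qi_QiRp.ram_le h.hp.ne_zero fun P hP =>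
    h.p_mem_of_discMem hI hP
  rcases h.hp8 with h8 | h8
  · have h3 := ncard_primesAbove_mul_le (K := Qi) (e := 1) h.hp h.finrank_Qi
      (fun P hP => by rw [pow_one]; exact hP)
    by_contra h0
    have h4 : (primesAbove Qi p).ncard = 2 := by omega
    obtain ⟨P, hP⟩ : (primesAbove Qi p).Nonempty := by
      rw [Set.nonempty_iff_ne_empty]
      intro h5
      rw [h5, Set.ncard_empty] at h4
      omega
    obtain ⟨h5, h6⟩ := notMem_sq_of_le_ncard h.hp 1 (fun P hP => le_absNorm h.hp hP)
      (by rw [h.finrank_Qi, h4]) hP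
    have h7 := h.ext_Qi_QiRp.one_le_idx (u := I) (v := -I) hI isIntegral_I (Qi.neg_mem hI)
      isIntegral_I.neg (by linear_combination -Complex.I_sq) fun a ha b hb h8 => by
        refine sq_sub_ne h.hp (by rintro rfl; omega) P hP (d := (p : 𝓞 Qi))
          (u := intOf Qi I hI isIntegral_I) hP h5 (t := p / 2) (by rw [h6, pow_one]; omega)
          (pow_add_one_mem_of_I (ringOfIntegers_ext ?_) (by omega)) ha hb ?_
        · exact Complex.I_sq
        · rw [rt_sq] at h8
          exact h8
    omega
  · have h3 := ncard_primesAbove_le (K := Qi) h.hp 1 2 (fun P hP => by rw [pow_one]; exact hP)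
      fun P hP => sq_le_absNorm_of_root h.hp hP hI 0 1 (by simp) fun n => by
        simpa using h.p_neg_one h8 n
    rw [h.finrank_Qi] at h3
    omega

/-- A unit of `ℚ(i, √p)` that is not a local norm at the primes above `q`. -/
lemma exists_unit_pow_char : ∃ u v : 𝓞 (QiRp p), u * v = 1 ∧
    ∀ P ∈ primesAbove (QiRp p) q, (Ideal.Quotient.mk P.asIdeal u) ^ (q + 1) = -1 := by
  have hI : I ∈ QiRp p := mem_adjoin_of_mem (by simp)
  have hs : rt p ∈ QiRp p := mem_adjoin_of_mem (by simp)
  have h8 := h.hq8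
  have hsq : (intOf (QiRp p) (rt p) hs (isIntegral_rt p)) ^ 2 = p := ringOfIntegers_ext (rt_sq p)
  have hIsq : (intOf (QiRp p) I hI isIntegral_I) ^ 2 = -1 := ringOfIntegers_ext Complex.I_sq
  have := Fact.mk h.hq
  set s := intOf (QiRp p) (rt p) hs (isIntegral_rt p)
  set i := intOf (QiRp p) I hI isIntegral_I
  rcases h.hp8 with h5 | h5
  · obtain ⟨x, y, hxy⟩ := exists_sq_sub_eq_neg_one h.hp (by omega)
    have hxy' : (x : 𝓞 (QiRp p)) ^ 2 - p * y ^ 2 = -1 := by exact_mod_cast hxy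
    refine ⟨x + y * s, -(x - y * s), ?_, fun P hP => ?_⟩
    · linear_combination -hxy' + (y : 𝓞 (QiRp p)) ^ 2 * hsq
    · have := charP_quotient h.hq hP
      have h1 := congrArg (Ideal.Quotient.mk P.asIdeal) hsq
      have h2 := congrArg (Ideal.Quotient.mk P.asIdeal) hxy'
      simp only [map_pow, map_natCast, map_sub, map_mul, map_intCast, map_neg, map_one] at h1 h2
      rw [map_add, map_mul, map_intCast, map_intCast, pow_succ,
        intCast_add_mul_pow_char h.q_odd h.jac (by rw [h1]; simp)]
      linear_combination h2 - (y : 𝓞 (QiRp p) ⧸ P.asIdeal) ^ 2 * h1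
  · obtain ⟨x, y, hxy⟩ := h.exists_sq_sub_eq_neg_two h5
    have hodd : ∃ x' y' : ℤ, x = 2 * x' + 1 ∧ y = 2 * y' + 1 := by
      obtain ⟨k, hk⟩ : ∃ k : ℕ, p = 8 * k + 3 := ⟨p / 8, by omega⟩
      rw [hk] at hxy
      push_cast at hxy
      rcases Int.even_or_odd' x with ⟨x', rfl | rfl⟩ <;>
      rcases Int.even_or_odd' y with ⟨y', rfl | rfl⟩
      · have : (4 : ℤ) * (x' ^ 2 - (8 * k + 3) * y' ^ 2) = -2 := by linarith
        omega
      · have : (2 : ℤ) * (2 * x' ^ 2 - (8 * k + 3) * (2 * y' ^ 2 + 2 * y') - 4 * k) = 1 := by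
          linarith
        omega
      · have : (2 : ℤ) * (2 * x' ^ 2 + 2 * x' - (8 * k + 3) * (2 * y' ^ 2)) = -3 := by linarith
        omega
      · exact ⟨x', y', rfl, rfl⟩
    have hxy' : (x : 𝓞 (QiRp p)) ^ 2 - p * y ^ 2 = -2 := by exact_mod_cast hxy
    obtain ⟨w, hw⟩ : ∃ w : 𝓞 (QiRp p), 2 * w = 1 + i * s := by
      have h2 : (2 : ℂ) ∈ QiRp p := _root_.natCast_mem (QiRp p) 2
      obtain ⟨k, hk⟩ : ∃ k : ℕ, p = 4 * k + 3 := ⟨p / 4, by omega⟩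
      refine ⟨intOf (QiRp p) ((1 + I * rt p) / 2)
        ((QiRp p).div_mem ((QiRp p).add_mem (QiRp p).one_mem ((QiRp p).mul_mem hI hs)) h2)
        (isIntegral_of_quadratic (-1) (k + 1) ?_), ringOfIntegers_ext ?_⟩
      · have h3 := I_mul_rt_sq p
        have h4 : (p : ℂ) = 4 * k + 3 := by exact_mod_cast hk
        push_cast
        linear_combination (1 / 4) * h3 - (1 / 4) * h4
      · exact mul_div_cancel₀ (1 + I * rt p) (two_ne_zero' ℂ)
    obtain ⟨x', y', hx', hy'⟩ := hodd
    have hx2 : (x : 𝓞 (QiRp p)) = 2 * x' + 1 := by exact_mod_cast hx'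
    have hy2 : (y : 𝓞 (QiRp p)) = 2 * y' + 1 := by exact_mod_cast hy'
    obtain ⟨u, hu⟩ : ∃ u : 𝓞 (QiRp p), 2 * u = (1 + i) * (x + y * s) :=
      ⟨(1 + i) * (x' + y' * s) + w + i * (1 - w), by
        rw [hx2, hy2]
        linear_combination (1 - i) * hw - s * hIsq⟩
    obtain ⟨u', hu'⟩ : ∃ u' : 𝓞 (QiRp p), 2 * u' = (1 - i) * (x - y * s) :=
      ⟨(1 - i) * (x' - y' * s) + w - i * (1 - w), by
        rw [hx2, hy2]
        linear_combination (1 + i) * hw + s * hIsq⟩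
    have h20 : (2 : 𝓞 (QiRp p)) ≠ 0 := two_ne_zero
    refine ⟨u, -u', ?_, fun P hP => ?_⟩
    · have h4 : (4 : 𝓞 (QiRp p)) ≠ 0 := by norm_num
      apply mul_left_cancel₀ h4
      linear_combination -(2 * u') * hu - ((1 + i) * (x + y * s)) * hu' - 2 * hxy'
        + 2 * (y : 𝓞 (QiRp p)) ^ 2 * hsq + (x + y * s) * (x - y * s) * hIsq
    · have := charP_quotient h.hq hP
      have h1 := congrArg (Ideal.Quotient.mk P.asIdeal) hsq
      have h2 := congrArg (Ideal.Quotient.mk P.asIdeal) hxy'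
      have h3 := congrArg (Ideal.Quotient.mk P.asIdeal) hu
      have h4 := congrArg (Ideal.Quotient.mk P.asIdeal) hIsq
      have h6 : (2 : 𝓞 (QiRp p) ⧸ P.asIdeal) ≠ 0 := by
        intro h7
        have h9 : ((2 : ℤ) : 𝓞 (QiRp p)) ∈ P.asIdeal :=
          Ideal.Quotient.eq_zero_iff_mem.1 (by rw [map_intCast]; exact_mod_cast h7)
        refine intCast_notMem h.hq hP (fun h10 => h.q_not_dvd_two ?_) h9
        exact_mod_cast h10
      have hdom : IsDomain (𝓞 (QiRp p) ⧸ P.asIdeal) := Ideal.Quotient.isDomain _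
      simp only [map_pow, map_natCast, map_sub, map_mul, map_intCast, map_neg, map_one, map_add,
        map_ofNat] at h1 h2 h3 h4
      set U := Ideal.Quotient.mk P.asIdeal u
      set S := Ideal.Quotient.mk P.asIdeal s
      set J := Ideal.Quotient.mk P.asIdeal i
      have h7 := congrArg (· ^ q) h3
      have h9 := intCast_pow_char (F := 𝓞 (QiRp p) ⧸ P.asIdeal) (q := q) 2
      have h10 := intCast_add_mul_pow_char (F := 𝓞 (QiRp p) ⧸ P.asIdeal) h.q_odd h.jac_neg_one
        (s := J) (by rw [h4]; simp) 1 1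
      rw [Int.cast_one, one_mul] at h10
      push_cast at h9
      simp only [mul_pow] at h7
      rw [h9, h10, intCast_add_mul_pow_char h.q_odd h.jac (by rw [h1]; simp)] at h7
      apply mul_left_cancel₀ (mul_ne_zero h6 h6)
      rw [pow_succ]
      linear_combination (2 * U) * h7 + ((1 - J) * (x - y * S)) * h3 + 2 * h2
        - 2 * (y : 𝓞 (QiRp p) ⧸ P.asIdeal) ^ 2 * h1 - (x + y * S) * (x - y * S) * h4

lemma cl2_Qipq : cl2 (Qipq p q) = 0 := by
  have h8 := h.hq8
  refine h.ext_QiRp_Qipq.cl2_eq_zero ?_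
  have hI : I ∈ QiRp p := mem_adjoin_of_mem (by simp)
  have h1 := h.ext_QiRp_Qipq.ambiguous_class_number
  rw [h.rank_QiRp, h.rank_Qipq, h.cl2_QiRp] at h1
  have h2 : h.ext_QiRp_Qipq.ram ≤ _ := h.ext_QiRp_Qipq.ram_le h.hq.ne_zero fun P hP =>
    h.q_mem_of_discMem hP
  have hf : ∀ P ∈ primesAbove (QiRp p) q, q ^ 2 ≤ P.asIdeal.absNorm := fun P hP =>
    sq_le_absNorm_of_root h.hq hP hI 0 1 (by simp) fun n => by simpa using h.q_one n
  have h3 := ncard_primesAbove_le h.hq 1 2 (fun P hP => by rw [pow_one]; exact hP) hf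
  rw [h.finrank_QiRp] at h3
  by_contra h0
  have h4 : (primesAbove (QiRp p) q).ncard = 2 := by omega
  obtain ⟨P, hP⟩ : (primesAbove (QiRp p) q).Nonempty := by
    rw [Set.nonempty_iff_ne_empty]
    intro h5
    rw [h5, Set.ncard_empty] at h4
    omega
  obtain ⟨h5, h6⟩ := notMem_sq_of_le_ncard h.hq 2 hf (by rw [h.finrank_QiRp, h4]) hP
  obtain ⟨u, v, huv, hu⟩ := h.exists_unit_pow_char
  obtain ⟨t, ht⟩ : ∃ t, q ^ 2 = 2 * t + 1 := by
    obtain ⟨k, hk⟩ : ∃ k, q = 2 * k + 1 := ⟨q / 2, by omega⟩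
    exact ⟨2 * k ^ 2 + 2 * k, by rw [hk]; ring⟩
  have h7 := h.ext_QiRp_Qipq.one_le_idx (u := ((u : QiRp p) : ℂ)) (v := ((v : QiRp p) : ℂ))
    (u : QiRp p).2 (isIntegral_coe u) (v : QiRp p).2 (isIntegral_coe v)
    (congrArg (fun z : 𝓞 (QiRp p) => ((z : QiRp p) : ℂ)) huv) fun a ha b hb h9 => by
      refine sq_sub_ne h.hq (by rintro rfl; omega) P hP (d := -(q : 𝓞 (QiRp p))) (u := u)
        (P.asIdeal.neg_mem hP) (fun h10 => h5 (by simpa using Ideal.neg_mem_iff _ |>.1 h10)) (t := t)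
        (by rw [h6, ht]) (pow_add_one_mem_of_char (by omega) (hu P hP) ht) ha hb ?_
      rw [I_mul_rt_sq] at h9
      exact h9
  omega

end PQ

end OddTwo

section LowerLayers

open Module IsDedekindDomain
open Complex (I)

lemma one_le_ncard_primesAbove (K : Type*) [Field K] [NumberField K] {ℓ : ℕ} (hℓ : ℓ.Prime) :
    1 ≤ (primesAbove K ℓ).ncard := by
  have h1 : Ideal.span {(ℓ : 𝓞 K)} ≠ ⊤ := by
    intro h2
    have h3 := Ideal.absNorm_span_natCast (S := 𝓞 K) ℓ
    rw [h2, Ideal.absNorm_top, RingOfIntegers.rank] at h3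
    exact (Nat.one_lt_pow (finrank_pos (R := ℚ) (M := K)).ne' hℓ.one_lt).ne h3
  obtain ⟨M, hM, hle⟩ := Ideal.exists_le_maximal _ h1
  have h2 : (ℓ : 𝓞 K) ∈ M := hle (Ideal.mem_span_singleton_self _)
  have h3 : M ≠ ⊥ := by
    rintro rfl
    exact hℓ.ne_zero (Nat.cast_eq_zero.1 (Ideal.mem_bot.1 h2))
  exact (Set.ncard_pos (primesAbove_finite hℓ.ne_zero)).2 ⟨⟨M, hM.isPrime, h3⟩, h2⟩

lemma one_sq_sub_rt_two_sq_mul : (1 : ℂ) ^ 2 - rt 2 ^ 2 * 1 ^ 2 = -1 := by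
  rw [rt_sq]; norm_num

namespace PQ

variable {p q : ℕ} (h : PQ p q)
include h

lemma I_notMem_Q2Rnq : I ∉ Q2Rnq q := h.ext_Q2Rnq_Q2qi.notMem

/-- The extension `ℚ(√2, √-q)/ℚ(√(-2q))` is unramified. -/
lemma ram_Qn2q_Q2Rnq : h.ext_Qn2q_Q2Rnq.ram = 0 := by
  refine h.ext_Qn2q_Q2Rnq.ram_eq_zero fun P hP => ?_
  have h8 := h.hq8
  have hq4 : -(q : ℤ) = 4 * (-((q + 1) / 4 : ℤ)) + 1 := by omega
  have h1 := hP.four_mul (one_mem _) (n := 2) (by rw [one_mul, rt_sq]; norm_num)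
  have h2 := hP.four_mul_add_one (b := I * (rt 2 * rt q) / 2) (n := -q)
    ((Qn2q q).div_mem (mem_adjoin_of_mem rfl) (_root_.natCast_mem (Qn2q q) 2)) ?_ hq4
  · refine false_of_isCoprime (hP := P.isPrime) h1 h2 ?_
    rw [Int.isCoprime_iff_gcd_eq_one]
    have h3 : Nat.Coprime (2 ^ 3) q := Nat.Coprime.pow_left 3
      (Nat.coprime_two_left.2 (Nat.odd_iff.2 (by omega)))
    have h4 : (4 * 2 : ℤ).gcd (-q) = Nat.gcd 8 q := by simp [Int.gcd]
    rw [h4]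
    exact h3
  · have h3 : I * (rt 2 * rt q) / 2 * rt 2 = I * rt q := by
      have h4 := rt_sq 2
      push_cast at h4
      linear_combination (I * rt q / 2) * h4
    rw [h3, I_mul_rt_sq]
    push_cast
    rfl

lemma amb_Qn2q_Q2Rnq : h.ext_Qn2q_Q2Rnq.amb = cl2 (Q2Rnq q) := by
  refine h.ext_Qn2q_Q2Rnq.amb_eq h.ext_Q2_Q2Rnq h.ext_Qnq_Q2Rnq h.cl2_Q2 h.cl2_Qnq rfl ?_
  have h2 : rt 2 ∈ Q2 := mem_adjoin_of_mem rfl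
  have hq : I * rt q ∈ Qnq q := mem_adjoin_of_mem rfl
  rintro t (ht | ht)
  · rw [h.ext_Qnq_Q2Rnq.conj_neg t (one_mem _) (by rw [one_mul]; exact ht), map_neg,
      h.ext_Q2_Q2Rnq.conj_fix t (by rw [ht]; exact h2),
      h.ext_Qn2q_Q2Rnq.conj_neg t (one_mem _) (by rw [one_mul]; exact ht)]
  · have ht' : (t : ℂ) = I * rt q := ht
    rw [h.ext_Qnq_Q2Rnq.conj_fix t (by rw [ht']; exact hq),
      h.ext_Q2_Q2Rnq.conj_neg t (one_mem _) (by rw [one_mul]; exact ht),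
      h.ext_Qn2q_Q2Rnq.conj_neg t (b := I * (rt 2 * rt q) / 2)
        ((Qn2q q).div_mem (mem_adjoin_of_mem rfl) (_root_.natCast_mem (Qn2q q) 2)) ?_]
    have h4 := rt_sq 2
    push_cast at h4
    rw [ht']
    linear_combination -(I * rt q / 2) * h4

lemma I_notMem_Qn2q : I ∉ Qn2q q := fun hI =>
  h.I_notMem_Q2Rnq (h.ext_Qn2q_Q2Rnq.le hI)

lemma I_notMem_Qnq : I ∉ Qnq q := fun hI =>
  h.I_notMem_Q2Rnq (h.ext_Qnq_Q2Rnq.le hI)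

lemma cl2_Q2Rnq_add_one : cl2 (Q2Rnq q) + 1 = cl2 (Qn2q q) := by
  have h1 := h.ext_Qn2q_Q2Rnq.ambiguous_class_number
  have h2 := h.ext_Qn2q_Q2Rnq.idx_le (one_mem _) (one_mem _) one_sq_sub_rt_two_sq_mul h.I_notMem_Qn2q
  rw [h.rank_Qn2q, h.rank_Q2Rnq, h.ram_Qn2q_Q2Rnq, h.amb_Qn2q_Q2Rnq] at h1
  rw [h.rank_Qn2q] at h2
  omega

lemma two_le_ncard_Qnq : 2 ≤ (primesAbove (Qnq q) 2).ncard := by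
  have h8 := h.hq8
  obtain ⟨k, hk⟩ : ∃ k : ℤ, (q : ℤ) = 8 * k + 7 := ⟨q / 8, by omega⟩
  have hkC : (q : ℂ) = 8 * k + 7 := by exact_mod_cast hk
  have hm : (2⁻¹ : ℂ) ∈ (⊥ : IntermediateField ℚ ℂ) :=
    (⊥ : IntermediateField ℚ ℂ).inv_mem (_root_.natCast_mem (⊥ : IntermediateField ℚ ℂ) 2)
  have h3 := I_mul_rt_sq q
  have h1 := h.ext_bot_Qnq.two_mul_ncard_le Nat.prime_two hm hm (-1) (2 * k + 2) 0
    (by push_cast; linear_combination (1 / 4) * h3 - (1 / 4) * hkC)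
    (by push_cast; exact ⟨k + 1, by ring⟩)
    (by push_cast; linear_combination h3 - hkC)
    (by push_cast; omega)
  have h2 := one_le_ncard_primesAbove (⊥ : IntermediateField ℚ ℂ) Nat.prime_two
  omega

lemma one_le_cl2_Q2Rnq : 1 ≤ cl2 (Q2Rnq q) := by
  have h1 := h.ext_Qnq_Q2Rnq.ambiguous_class_number
  have h2 := h.ext_Qnq_Q2Rnq.idx_le (one_mem _) (one_mem _) one_sq_sub_rt_two_sq_mul h.I_notMem_Qnq
  have h3 := h.ext_Qnq_Q2Rnq.amb_le
  have h4 := h.ext_Qnq_Q2Rnq.le_ram (ℓ := 2) 2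
    (fun P hP => (notMem_sq_of_le_ncard Nat.prime_two 1 (fun P hP => le_absNorm Nat.prime_two hP)
      (by rw [h.finrank_Qnq, mul_one]; exact h.two_le_ncard_Qnq) hP).1)
    fun P hP => two_mem_sq_of_rt_two (mem_adjoin_of_mem (by simp)) hP
  have h5 := h.two_le_ncard_Qnq
  rw [h.rank_Qnq, h.rank_Q2Rnq] at h1
  rw [h.rank_Qnq] at h2
  omega

end PQ

end LowerLayers

section SumOfTwoSquares

open Module IsDedekindDomain nonZeroDivisors
open Complex (I)

/-- The norm form of a quadratic field on an integral generator of an ideal. -/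
lemma QuadExt.sq_sub_eq_or {L : IntermediateField ℚ ℂ} {x : ℂ} [NumberField L] (h : QuadExt ⊥ L x)
    (α : 𝓞 L) {a b : ℂ} (ha : a ∈ (⊥ : IntermediateField ℚ ℂ))
    (hb : b ∈ (⊥ : IntermediateField ℚ ℂ)) (hα : ((α : L) : ℂ) = a + b * x) :
    a ^ 2 - x ^ 2 * b ^ 2 = (Ideal.absNorm (Ideal.span {α}) : ℂ) ∨
      a ^ 2 - x ^ 2 * b ^ 2 = -(Ideal.absNorm (Ideal.span {α}) : ℂ) := by
  let _ := h.alg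
  have htower : IsScalarTower ℚ (⊥ : IntermediateField ℚ ℂ) L :=
    IsScalarTower.of_algebraMap_eq fun q => rfl
  have h1 := h.conj_eq (α : L) ha hb hα
  obtain ⟨N, hN⟩ := exists_rat_of_mem_bot (a := a ^ 2 - x ^ 2 * b ^ 2)
    (sub_mem (pow_mem ha 2) (mul_mem h.sq_mem (pow_mem hb 2)))
  have h2 : (α : L) * h.conj (α : L) = algebraMap ℚ L N := by
    refine Subtype.ext ?_
    change ((α : L) : ℂ) * (h.conj (α : L) : ℂ) = (N : ℂ)
    rw [hN, h1, hα]
    ring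
  have h3 : Algebra.norm ℚ (h.conj (α : L)) = Algebra.norm ℚ (α : L) :=
    Algebra.norm_eq_of_algEquiv (h.conj.restrictScalars ℚ) _
  have h4 := congrArg (Algebra.norm ℚ) h2
  rw [map_mul, h3, Algebra.norm_algebraMap, h.finrank_eq, finrank_bot_field] at h4
  have h5 : (Algebra.norm ℤ α : ℚ) = Algebra.norm ℚ (α : L) := Algebra.coe_norm_int α
  have h6 : (Ideal.absNorm (Ideal.span {α}) : ℚ) = |(Algebra.norm ℤ α : ℚ)| := by
    rw [Ideal.absNorm_span_singleton, Nat.cast_natAbs, Int.cast_abs]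
  have h7 : N ^ 2 = (Ideal.absNorm (Ideal.span {α}) : ℚ) ^ 2 := by
    rw [h6, sq_abs, h5]
    linear_combination -h4
  rw [← hN]
  rcases sq_eq_sq_iff_eq_or_eq_neg.1 h7 with h8 | h8
  · left; rw [h8]; push_cast; rfl
  · right; rw [h8]; push_cast; rfl

namespace PQ

variable {p q : ℕ} (h : PQ p q)
include h

lemma exists_prime_modEq : ∃ r : ℕ, r.Prime ∧ r % 8 = 5 ∧ q ∣ r + 1 := by
  have h8 := h.hq8
  have hco : Nat.Coprime 8 q := Nat.Coprime.pow_left 3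
      (Nat.coprime_two_left.2 (Nat.odd_iff.2 h.q_odd) : Nat.Coprime 2 q)
  obtain ⟨a, ha8, haq⟩ := Nat.chineseRemainder hco 5 (q - 1)
  have hq1 := h.hq.one_lt
  have ha : a.Coprime (8 * q) := by
    refine Nat.Coprime.mul_right ?_ ?_
    · rw [Nat.Coprime, ha8.gcd_eq]; rfl
    · rw [Nat.Coprime, haq.gcd_eq]
      exact (Nat.coprime_self_sub_left hq1.le).2 (Nat.coprime_one_left q)
  obtain ⟨r, -, hr, hra⟩ := Nat.forall_exists_prime_gt_and_modEq 0 (q := 8 * q) (by omega) ha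
  refine ⟨r, hr, ((hra.of_mul_right q).trans ha8), ?_⟩
  have h1 : r ≡ q - 1 [MOD q] := (hra.of_mul_left 8).trans haq
  have h2 := h1.add_right 1
  rw [Nat.sub_add_cancel hq1.le] at h2
  exact (Nat.modEq_zero_iff_dvd.1 (h2.trans (by simp [Nat.ModEq])))

lemma exists_dvd_sq_sub_of_modEq {r : ℕ} (hr : r.Prime) (hr8 : r % 8 = 5) (hrq : q ∣ r + 1) :
    ∃ n : ℤ, (r : ℤ) ∣ n ^ 2 - 2 * q := by
  have h8 := h.hq8
  refine exists_dvd_sq_sub_of_jacobiSym hr ?_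
  have h1 : jacobiSym (r : ℤ) q = -1 := by
    have h2 : (r : ℤ) % q = -1 % q := by
      exact ((Int.modEq_iff_dvd (n := q)).2 (by
        rw [sub_neg_eq_add]; exact_mod_cast hrq)).symm
    rw [jacobiSym.mod_left, h2, ← jacobiSym.mod_left, h.jac_neg_one]
  rw [jacobiSym.mul_left, jacobiSym_two_eq (by omega),
    ← jacobiSym.quadratic_reciprocity_one_mod_four (by omega) (Nat.odd_iff.2 h.q_odd), h1]
  simp [hr8]

lemma sq_sub_ne_of_dvd {r : ℕ} (hrq : q ∣ r + 1) {a b : ℂ}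
    (ha : a ∈ (⊥ : IntermediateField ℚ ℂ)) (hb : b ∈ (⊥ : IntermediateField ℚ ℂ)) :
    a ^ 2 - 2 * q * b ^ 2 ≠ r := by
  have h8 := h.hq8
  have h1 := one_le_ncard_primesAbove (⊥ : IntermediateField ℚ ℂ) h.hq
  obtain ⟨P, hP⟩ : (primesAbove (⊥ : IntermediateField ℚ ℂ) q).Nonempty :=
    (Set.ncard_pos (primesAbove_finite h.hq.ne_zero)).1 h1
  obtain ⟨h2, h3⟩ := notMem_sq_of_le_ncard h.hq 1 (fun P hP => le_absNorm h.hq hP)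
    (by rw [finrank_bot_field]; omega) hP
  have hP' : (q : 𝓞 (⊥ : IntermediateField ℚ ℂ)) ∈ P.asIdeal := hP
  have h4 := sq_sub_ne h.hq (by omega) P hP (d := 2 * q) (u := r) (P.asIdeal.mul_mem_left _ hP')
    (fun h5 => h2 ?_) (t := q / 2) (by rw [h3, pow_one]; omega) ?_ ha hb
  · intro h5
    exact h4 h5
  · obtain ⟨k, hk⟩ : ∃ k, q = 2 * k + 1 := ⟨q / 2, by omega⟩
    have h6 : (q : 𝓞 (⊥ : IntermediateField ℚ ℂ)) = q * q - k * (2 * q) := by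
      have h7 : (q : 𝓞 (⊥ : IntermediateField ℚ ℂ)) = 2 * k + 1 := by exact_mod_cast hk
      linear_combination -(q : 𝓞 (⊥ : IntermediateField ℚ ℂ)) * h7
    rw [h6]
    refine sub_mem ?_ (Ideal.mul_mem_left _ _ h5)
    rw [sq]
    exact Ideal.mul_mem_mul hP' hP'
  · have h5 : (q : ℤ) ∣ (r : ℤ) ^ (q / 2) + 1 := by
      have h6 : Odd (q / 2) := Nat.odd_iff.2 (by omega)
      have h7 := h6.add_dvd_pow_add_pow (r : ℤ) 1
      rw [one_pow] at h7
      exact dvd_trans (by exact_mod_cast hrq) h7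
    obtain ⟨c, hc⟩ := h5
    have h7 : (r : 𝓞 (⊥ : IntermediateField ℚ ℂ)) ^ (q / 2) + 1 = c * q := by
      have := congrArg (Int.cast : ℤ → 𝓞 (⊥ : IntermediateField ℚ ℂ)) hc
      push_cast at this
      rw [this, mul_comm]
    rw [h7]
    exact P.asIdeal.mul_mem_left _ hP'

/-- The norm form of `ℚ(√(2q))` represents `-r` for suitable primes `r`. -/
lemma exists_sq_sub_eq_neg {r : ℕ} (hr : r.Prime) (hr8 : r % 8 = 5) (hrq : q ∣ r + 1) :
    ∃ a ∈ (⊥ : IntermediateField ℚ ℂ), ∃ b ∈ (⊥ : IntermediateField ℚ ℂ),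
      a ^ 2 - 2 * q * b ^ 2 = -r := by
  have h8 := h.hq8
  obtain ⟨n, hn⟩ := h.exists_dvd_sq_sub_of_modEq hr hr8 hrq
  have hrq' : ¬ r ∣ 2 * q := by
    intro h1
    rcases hr.dvd_mul.1 h1 with h2 | h2
    · rw [Nat.prime_dvd_prime_iff_eq hr Nat.prime_two] at h2; omega
    · rw [Nat.prime_dvd_prime_iff_eq hr h.hq] at h2; omega
  have h1 := h.ext_bot_Q2q.two_mul_ncard_le hr (zero_mem _) (one_mem _) 0 (-(2 * q : ℤ)) n
    (by push_cast; linear_combination rt_two_mul_rt_sq q) (by simpa [← sub_eq_add_neg] using hn)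
    (by push_cast; linear_combination 4 * rt_two_mul_rt_sq q) (by
      intro h2
      have h3 : (r : ℤ) ∣ (2 * 2 * (2 * q) : ℕ) := by
        push_cast
        convert h2 using 1
        ring
      rcases hr.dvd_mul.1 (Int.natCast_dvd_natCast.1 h3) with h2 | h2
      · have := (Nat.prime_dvd_prime_iff_eq hr Nat.prime_two).1
          ((hr.dvd_mul.1 h2).elim id id)
        omega
      · exact hrq' h2)
  have h2 := one_le_ncard_primesAbove (⊥ : IntermediateField ℚ ℂ) hr
  obtain ⟨P, hP⟩ : (primesAbove (Q2q q) r).Nonempty :=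
    (Set.ncard_pos (primesAbove_finite hr.ne_zero)).1 (by omega)
  obtain ⟨-, h3⟩ := notMem_sq_of_le_ncard hr 1 (fun P hP => le_absNorm hr hP)
    (by rw [h.finrank_Q2q]; omega) hP
  have h4 : Odd (Nat.card (ClassGroup (𝓞 (Q2q q)))) := by
    have h5 := h.cl2_Q2q
    rw [cl2, Nat.factorization_eq_zero_iff] at h5
    rw [Nat.odd_iff]
    have h6 : Nat.card (ClassGroup (𝓞 (Q2q q))) ≠ 0 := Nat.card_pos.ne'
    have : ¬ 2 ∣ Nat.card (ClassGroup (𝓞 (Q2q q))) := by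
      rcases h5 with h5 | h5 | h5
      · exact absurd Nat.prime_two h5
      · exact h5
      · exact absurd h5 h6
    omega
  obtain ⟨k, hk⟩ := h4
  set J : (Ideal (𝓞 (Q2q q)))⁰ := ⟨P.asIdeal, mem_nonZeroDivisors_of_ne_zero P.ne_bot⟩
  have h5 : ClassGroup.mk0 (J ^ (2 * k + 1)) = 1 := by
    rw [map_pow, ← hk]
    exact pow_card_eq_one'
  obtain ⟨α, hα⟩ := ((ClassGroup.mk0_eq_one_iff _).1 h5).principal
  have hα' : P.asIdeal ^ (2 * k + 1) = Ideal.span {α} := hα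
  obtain ⟨a, ha, b, hb, hab⟩ := h.ext_bot_Q2q.exists_eq _ (α : Q2q q).2
  have h6 := h.ext_bot_Q2q.sq_sub_eq_or α ha hb hab
  rw [← hα', map_pow, h3, rt_two_mul_rt_sq, pow_one] at h6
  push_cast at h6
  have hr0 : (r : ℂ) ^ k ≠ 0 := pow_ne_zero _ (Nat.cast_ne_zero.2 hr.ne_zero)
  have hrk : (r : ℂ) ^ k ∈ (⊥ : IntermediateField ℚ ℂ) :=
    pow_mem (_root_.natCast_mem (⊥ : IntermediateField ℚ ℂ) r) k
  have h7 : (a / (r : ℂ) ^ k) ^ 2 - 2 * q * (b / (r : ℂ) ^ k) ^ 2 =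
      (a ^ 2 - 2 * q * b ^ 2) / ((r : ℂ) ^ k) ^ 2 := by
    field_simp
  have h8 : (r : ℂ) ^ (2 * k + 1) / ((r : ℂ) ^ k) ^ 2 = r := by
    rw [div_eq_iff (pow_ne_zero 2 hr0)]; ring
  rcases h6 with h6 | h6
  · refine absurd ?_ (h.sq_sub_ne_of_dvd hrq (div_mem ha hrk) (div_mem hb hrk))
    rw [h7, h6, h8]
  · exact ⟨_, div_mem ha hrk, _, div_mem hb hrk, by rw [h7, h6, neg_div, h8]⟩

/-- `-1` is a sum of two squares in `ℚ(√(-2q))`. -/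
lemma exists_sq_add_sq_eq_neg_one : ∃ a ∈ Qn2q q, ∃ b ∈ Qn2q q, a ^ 2 + b ^ 2 = -1 := by
  obtain ⟨r, hr, hr8, hrq⟩ := h.exists_prime_modEq
  obtain ⟨a, ha, b, hb, hab⟩ := h.exists_sq_sub_eq_neg hr hr8 hrq
  have := Fact.mk hr
  obtain ⟨u, v, huv⟩ := Nat.Prime.sq_add_sq (p := r) (by omega)
  have huvC : (u : ℂ) ^ 2 + v ^ 2 = r := by exact_mod_cast huv
  set w := I * (rt 2 * rt q)
  have hw : w ∈ Qn2q q := mem_adjoin_of_mem rfl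
  have hw2 : w ^ 2 = -(2 * q) := I_mul_rt_two_mul_rt_sq q
  have ha' : a ∈ Qn2q q := bot_le (a := Qn2q q) ha
  have hb' : b ∈ Qn2q q := bot_le (a := Qn2q q) hb
  have hu : (u : ℂ) ∈ Qn2q q := _root_.natCast_mem (Qn2q q) u
  have hv : (v : ℂ) ∈ Qn2q q := _root_.natCast_mem (Qn2q q) v
  have hD : (v : ℂ) ^ 2 + (w * b) ^ 2 ≠ 0 := by
    intro h0
    obtain ⟨a', rfl⟩ := exists_rat_of_mem_bot ha
    have h1 : (a' : ℂ) ^ 2 + u ^ 2 = 0 := by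
      linear_combination hab + huvC - h0 + b ^ 2 * hw2
    have h2 : a' ^ 2 + (u : ℚ) ^ 2 = 0 := by exact_mod_cast h1
    have h3 : (u : ℚ) = 0 := by nlinarith [sq_nonneg a', sq_nonneg (u : ℚ)]
    have h4 : u = 0 := by exact_mod_cast h3
    rw [h4] at huv
    exact hr.prime.not_isSquare ⟨v, by rw [← huv]; ring⟩
  have hDK : (v : ℂ) ^ 2 + (w * b) ^ 2 ∈ Qn2q q := add_mem (pow_mem hv 2) (pow_mem (mul_mem hw hb') 2)
  refine ⟨(a * v - u * (w * b)) / (v ^ 2 + (w * b) ^ 2),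
    div_mem (sub_mem (mul_mem ha' hv) (mul_mem hu (mul_mem hw hb'))) hDK,
    (a * (w * b) + u * v) / (v ^ 2 + (w * b) ^ 2),
    div_mem (add_mem (mul_mem ha' (mul_mem hw hb')) (mul_mem hu hv)) hDK, ?_⟩
  rw [div_pow, div_pow, ← add_div, div_eq_iff (pow_ne_zero 2 hD)]
  linear_combination ((v : ℂ) ^ 2 + (w * b) ^ 2) * (hab + huvC + b ^ 2 * hw2)

end PQ

end SumOfTwoSquares

section UnitObstruction

open Module IsDedekindDomain
open Complex (I)

/-- An integer congruent to `7` modulo `8` is not a sum of three squares of rational numbers. -/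
lemma mul_sq_ne_sum_three_sq {n : ℤ} (hn : n % 8 = 7) (w : ℕ) (hw : w ≠ 0) (x y z : ℤ) :
    n * (w : ℤ) ^ 2 ≠ x ^ 2 + y ^ 2 + z ^ 2 := by
  have hsq : ∀ a : ℤ, (a % 2 = 0 ∧ (a ^ 2) % 4 = 0 ∧ ((a ^ 2) % 8 = 0 ∨ (a ^ 2) % 8 = 4)) ∨
      (a % 2 = 1 ∧ (a ^ 2) % 4 = 1 ∧ (a ^ 2) % 8 = 1) := by
    intro a
    have h1 : a % 8 = 0 ∨ a % 8 = 1 ∨ a % 8 = 2 ∨ a % 8 = 3 ∨ a % 8 = 4 ∨ a % 8 = 5 ∨ a % 8 = 6 ∨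
      a % 8 = 7 := by omega
    have h2 : (a ^ 2) % 8 = ((a % 8) ^ 2) % 8 :=
      ((Int.mod_modEq a 8).pow 2).symm
    have h3 : (a ^ 2) % 4 = ((a ^ 2) % 8) % 4 := (Int.emod_emod_of_dvd _ (by norm_num)).symm
    rcases h1 with h1 | h1 | h1 | h1 | h1 | h1 | h1 | h1 <;> rw [h1] at h2 <;> omega
  induction w using Nat.strong_induction_on generalizing x y z with
  | _ w ih =>
    intro h
    have h1 := hsq x
    have h2 := hsq y
    have h3 := hsq z
    have h4 := hsq w
    have h5 : (n * (w : ℤ) ^ 2) % 8 = (7 * (((w : ℤ) ^ 2) % 8)) % 8 := by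
      rw [Int.mul_emod, hn]
    rcases h4 with ⟨h4, h6, h7⟩ | ⟨h4, h6, h7⟩
    · obtain ⟨hx, hy, hz⟩ : x % 2 = 0 ∧ y % 2 = 0 ∧ z % 2 = 0 := by omega
      obtain ⟨x', rfl⟩ := Int.dvd_of_emod_eq_zero hx
      obtain ⟨y', rfl⟩ := Int.dvd_of_emod_eq_zero hy
      obtain ⟨z', rfl⟩ := Int.dvd_of_emod_eq_zero hz
      obtain ⟨w', rfl⟩ : ∃ w', w = 2 * w' := ⟨w / 2, by omega⟩
      refine ih w' (by omega) (by omega) x' y' z' ?_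
      push_cast at h
      linarith
    · omega

lemma rat_sq_add_sq_add_sq_ne {n : ℤ} (hn : n % 8 = 7) {w : ℚ} (hw : w ≠ 0) (x y z : ℚ) :
    n * w ^ 2 ≠ x ^ 2 + y ^ 2 + z ^ 2 := by
  intro h
  have hxd : (x.den : ℚ) ≠ 0 := Nat.cast_ne_zero.2 x.den_ne_zero
  have hyd : (y.den : ℚ) ≠ 0 := Nat.cast_ne_zero.2 y.den_ne_zero
  have hzd : (z.den : ℚ) ≠ 0 := Nat.cast_ne_zero.2 z.den_ne_zero
  refine mul_sq_ne_sum_three_sq hn (w.num.natAbs * (x.den * y.den * z.den)) ?_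
    (x.num * (w.den * y.den * z.den)) (y.num * (w.den * x.den * z.den))
    (z.num * (w.den * x.den * y.den)) ?_
  · have := Int.natAbs_ne_zero.2 (Rat.num_ne_zero.2 hw)
    have := x.den_ne_zero
    have := y.den_ne_zero
    have := z.den_ne_zero
    positivity
  · have h1 : ((w.num.natAbs : ℤ) : ℚ) ^ 2 = (w * w.den) ^ 2 := by
      rw [Rat.mul_den_eq_num, Int.natCast_natAbs, Int.cast_abs, sq_abs]
    qify
    rw [← Rat.mul_den_eq_num x, ← Rat.mul_den_eq_num y, ← Rat.mul_den_eq_num z]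
    push_cast at h1 ⊢
    linear_combination (w.den * x.den * y.den * z.den : ℚ) ^ 2 * h +
      n * (x.den * y.den * z.den : ℚ) ^ 2 * h1

/-- `-1` is not a sum of two squares in `ℚ(√-q)` for `q ≡ 7 mod 8`. -/
lemma QuadExt.sq_add_sq_ne_neg_one {L : IntermediateField ℚ ℂ} {x : ℂ} (h : QuadExt ⊥ L x)
    {n : ℤ} (hn : n % 8 = 7) (hx : x ^ 2 = -n) {a b : ℂ} (ha : a ∈ L) (hb : b ∈ L) :
    a ^ 2 + b ^ 2 ≠ -1 := by
  intro hab
  obtain ⟨a0, ha0, a1, ha1, rfl⟩ := h.exists_eq a ha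
  obtain ⟨b0, hb0, b1, hb1, rfl⟩ := h.exists_eq b hb
  obtain ⟨a0, rfl⟩ := exists_rat_of_mem_bot ha0
  obtain ⟨a1, rfl⟩ := exists_rat_of_mem_bot ha1
  obtain ⟨b0, rfl⟩ := exists_rat_of_mem_bot hb0
  obtain ⟨b1, rfl⟩ := exists_rat_of_mem_bot hb1
  have h1 : (2 * (a0 * a1 + b0 * b1) : ℚ) = 0 := by
    by_contra h0
    have h0' : ((2 * (a0 * a1 + b0 * b1) : ℚ) : ℂ) ≠ 0 := by exact_mod_cast h0
    refine h.notMem (mem_bot.2 ⟨(-1 - (a0 ^ 2 + b0 ^ 2) + n * (a1 ^ 2 + b1 ^ 2)) /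
      (2 * (a0 * a1 + b0 * b1)), ?_⟩)
    rw [map_div₀, div_eq_iff (by exact h0')]
    simp only [eq_ratCast]
    push_cast
    linear_combination -hab + (a1 ^ 2 + b1 ^ 2 : ℂ) * hx
  have h2 : (a0 ^ 2 + b0 ^ 2 : ℚ) - n * (a1 ^ 2 + b1 ^ 2) = -1 := by
    have h3 : (2 * (a0 * a1 + b0 * b1) : ℂ) = 0 := by exact_mod_cast h1
    have h4 : (a0 ^ 2 + b0 ^ 2 : ℂ) - n * (a1 ^ 2 + b1 ^ 2) = -1 := by
      linear_combination hab - (a1 ^ 2 + b1 ^ 2 : ℂ) * hx - x * h3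
    exact_mod_cast h4
  refine rat_sq_add_sq_add_sq_ne hn (w := a1 ^ 2 + b1 ^ 2) ?_ (a0 * b1 - a1 * b0) a1 b1 ?_
  · intro h3
    rw [h3] at h2
    nlinarith [sq_nonneg a0, sq_nonneg b0]
  · linear_combination -(a1 ^ 2 + b1 ^ 2) * h2 + (a0 * a1 + b0 * b1) / 2 * h1

lemma QuadExt.sq_add_sq_ne {K L : IntermediateField ℚ ℂ} (h : QuadExt K L (rt 2))
    (hK : ∀ a ∈ K, ∀ b ∈ K, a ^ 2 + b ^ 2 ≠ -1) {a b : ℂ} (ha : a ∈ L) (hb : b ∈ L) :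
    a ^ 2 + b ^ 2 ≠ 1 + rt 2 := by
  intro hab
  obtain ⟨a0, ha0, a1, ha1, rfl⟩ := h.exists_eq a ha
  obtain ⟨b0, hb0, b1, hb1, rfl⟩ := h.exists_eq b hb
  have h2 := rt_sq 2
  push_cast at h2
  have h2K : (2 : ℂ) ∈ K := _root_.natCast_mem K 2
  have h4K : (4 : ℂ) ∈ K := _root_.natCast_mem K 4
  have h1 : 2 * (a0 * a1 + b0 * b1) = 1 := by
    by_contra h0
    have h0' : 2 * (a0 * a1 + b0 * b1) - 1 ≠ 0 := sub_ne_zero.2 h0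
    refine h.notMem ?_
    have h3 : rt 2 = (1 - (a0 ^ 2 + 2 * a1 ^ 2 + b0 ^ 2 + 2 * b1 ^ 2)) /
        (2 * (a0 * a1 + b0 * b1) - 1) := by
      rw [eq_div_iff h0']
      linear_combination hab - (a1 ^ 2 + b1 ^ 2) * h2
    rw [h3]
    exact div_mem (sub_mem (one_mem _) (add_mem (add_mem (add_mem (pow_mem ha0 2)
      (mul_mem h2K (pow_mem ha1 2))) (pow_mem hb0 2)) (mul_mem h2K (pow_mem hb1 2))))
      (sub_mem (mul_mem h2K (add_mem (mul_mem ha0 ha1) (mul_mem hb0 hb1))) (one_mem _))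
  have h3 : a0 ^ 2 + 2 * a1 ^ 2 + b0 ^ 2 + 2 * b1 ^ 2 = 1 := by
    linear_combination hab - (a1 ^ 2 + b1 ^ 2) * h2 - rt 2 * h1
  refine hK (a0 ^ 2 - 2 * a1 ^ 2 - (b0 ^ 2 - 2 * b1 ^ 2))
    (sub_mem (sub_mem (pow_mem ha0 2) (mul_mem h2K (pow_mem ha1 2)))
      (sub_mem (pow_mem hb0 2) (mul_mem h2K (pow_mem hb1 2))))
    (2 * (a0 * b0) - 4 * (a1 * b1))
    (sub_mem (mul_mem h2K (mul_mem ha0 hb0)) (mul_mem h4K (mul_mem ha1 hb1))) ?_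
  linear_combination (a0 ^ 2 + 2 * a1 ^ 2 + b0 ^ 2 + 2 * b1 ^ 2 + 1) * h3
    - 2 * (2 * (a0 * a1 + b0 * b1) + 1) * h1

end UnitObstruction

section MiddleLayer

open Module IsDedekindDomain
open Complex (I)

/-- The prime `2` is a fourth power up to units in `ℚ(ζ₈)`. -/
lemma two_mem_pow_four {K : IntermediateField ℚ ℂ} [NumberField K] (hI : I ∈ K) (h2 : rt 2 ∈ K)
    {P : HeightOneSpectrum (𝓞 K)} (hP : P ∈ primesAbove K 2) :
    ((2 : ℕ) : 𝓞 K) ∈ P.asIdeal ^ 4 := by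
  obtain ⟨z, hz, hzI⟩ : ∃ z ∈ K, z ^ 2 = I := by
    refine ⟨(1 + I) * rt 2 / 2, div_mem (mul_mem (add_mem (one_mem _) hI) h2)
      (_root_.natCast_mem K 2), ?_⟩
    have h3 := rt_sq 2
    push_cast at h3
    linear_combination ((1 + I) ^ 2 / 4) * h3 + (1 / 2) * Complex.I_sq
  have hz4 : z ^ 4 = -1 := by
    linear_combination (z ^ 2 + I) * hzI + Complex.I_sq
  have hzi : IsIntegral ℤ z := by
    refine IsIntegral.of_pow (n := 2) (by norm_num) ?_
    rw [hzI]
    exact isIntegral_I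
  refine natCast_mem_pow_of_eq Nat.prime_two hP 4 (y := 1 - z) (c := -(1 + z + z ^ 2) ^ 2)
    (c' := -(1 + z ^ 3 - z ^ 2) ^ 2) (n := 1) (n' := 1) (sub_mem (one_mem _) hz)
    (neg_mem (pow_mem (add_mem (add_mem (one_mem _) hz) (pow_mem hz 2)) 2))
    (neg_mem (pow_mem (sub_mem (add_mem (one_mem _) (pow_mem hz 3)) (pow_mem hz 2)) 2))
    (isIntegral_one.sub hzi) (((isIntegral_one.add hzi).add (hzi.pow 2)).pow 2).neg
    (((isIntegral_one.add (hzi.pow 3)).sub (hzi.pow 2)).pow 2).neg (by norm_num) (by norm_num) ?_ ?_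
  · push_cast
    linear_combination (-(z ^ 4) + 2 * z ^ 3 - z ^ 2 + 2 * z - 3) * hz4
  · have h3 : (1 + z + z ^ 2) * (1 + z ^ 3 - z ^ 2) = 1 := by
      linear_combination z * hz4
    push_cast
    linear_combination ((1 + z + z ^ 2) * (1 + z ^ 3 - z ^ 2) + 1) * h3

namespace PQ

variable {p q : ℕ} (h : PQ p q)
include h

lemma ncard_Q2Rnq : (primesAbove (Q2Rnq q) 2).ncard = 2 := by
  have h1 := ncard_primesAbove_mul_le (K := Q2Rnq q) (e := 2) Nat.prime_two h.finrank_Q2Rnq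
    fun P hP => two_mem_sq_of_rt_two (mem_adjoin_of_mem (by simp)) hP
  have h2 := h.ext_Qnq_Q2Rnq.ncard_primesAbove_mono (ℓ := 2) two_ne_zero
  have h3 := h.two_le_ncard_Qnq
  omega

lemma ram_Q2Rnq_Q2qi : h.ext_Q2Rnq_Q2qi.ram = 2 := by
  have h1 : h.ext_Q2Rnq_Q2qi.ram ≤ _ := h.ext_Q2Rnq_Q2qi.ram_le (ℓ := 2) two_ne_zero fun P hP =>
    intCast_mem_of_dvd_pow 2 (hP.four_mul (one_mem _) (n := -1)
      (by rw [one_mul, Complex.I_sq]; norm_num)) (by norm_num)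
  have h2 := h.ext_Q2Rnq_Q2qi.le_ram (ℓ := 2) 4
    (fun P hP => notMem_pow Nat.prime_two (by rw [h.finrank_Q2Rnq, h.ncard_Q2Rnq]; norm_num) hP)
    fun P hP => two_mem_pow_four (mem_adjoin_of_mem (by simp)) (mem_adjoin_of_mem (by simp)) hP
  rw [h.ncard_Q2Rnq] at h1 h2
  omega

lemma idx_Q2Rnq_Q2qi : h.ext_Q2Rnq_Q2qi.idx = 1 := by
  have h8 := h.hq8
  have h2m : rt 2 ∈ Q2Rnq q := mem_adjoin_of_mem (by simp)
  have h2 := rt_sq 2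
  push_cast at h2
  obtain ⟨a, ha, b, hb, hab⟩ := h.exists_sq_add_sq_eq_neg_one
  have h3 := h.ext_Q2Rnq_Q2qi.idx_le (h.ext_Qn2q_Q2Rnq.le ha) (h.ext_Qn2q_Q2Rnq.le hb)
    (by rw [Complex.I_sq]; linear_combination hab) h.I_notMem_Q2Rnq
  have h4 := h.ext_Q2Rnq_Q2qi.one_le_idx (u := 1 + rt 2) (v := rt 2 - 1)
    (add_mem (one_mem _) h2m) (isIntegral_one.add (isIntegral_rt 2)) (sub_mem h2m (one_mem _))
    ((isIntegral_rt 2).sub isIntegral_one) (by linear_combination h2) fun a ha b hb h5 => by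
      refine h.ext_Qnq_Q2Rnq.sq_add_sq_ne (fun c hc d hd => ?_) ha hb
        (by rw [← h5, Complex.I_sq]; ring)
      exact h.ext_bot_Qnq.sq_add_sq_ne_neg_one (n := q) (by omega)
        (by rw [I_mul_rt_sq]; push_cast; rfl) hc hd
  rw [h.rank_Q2Rnq] at h3
  omega

lemma amb_Q2Rnq_Q2qi : h.ext_Q2Rnq_Q2qi.amb = cl2 (Q2qi q) := by
  refine h.ext_Q2Rnq_Q2qi.amb_eq h.ext_QiR2_Q2qi h.ext_Q2Rq_Q2qi h.cl2_QiR2 h.cl2_Q2Rq rfl ?_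
  have hI : I ∈ QiR2 := mem_adjoin_of_mem (by simp)
  have hq : rt q ∈ Q2Rq q := mem_adjoin_of_mem (by simp)
  have hInq : I * rt q ∈ Q2Rnq q := mem_adjoin_of_mem (by simp)
  rintro t (ht | ht | ht)
  · rw [h.ext_Q2Rq_Q2qi.conj_fix t (by rw [ht]; exact mem_adjoin_of_mem (by simp)),
      h.ext_QiR2_Q2qi.conj_fix t (by rw [ht]; exact mem_adjoin_of_mem (by simp)),
      h.ext_Q2Rnq_Q2qi.conj_fix t (by rw [ht]; exact mem_adjoin_of_mem (by simp))]
  · rw [h.ext_Q2Rq_Q2qi.conj_fix t (by rw [ht]; exact hq),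
      h.ext_QiR2_Q2qi.conj_neg t (one_mem _) (by rw [one_mul]; exact ht),
      h.ext_Q2Rnq_Q2qi.conj_neg t (neg_mem hInq)
        (by rw [ht]; linear_combination rt q * Complex.I_sq)]
  · have ht' : (t : ℂ) = I := ht
    rw [h.ext_Q2Rq_Q2qi.conj_neg t (one_mem _) (by rw [one_mul]; exact ht), map_neg,
      h.ext_QiR2_Q2qi.conj_fix t (by rw [ht']; exact hI),
      h.ext_Q2Rnq_Q2qi.conj_neg t (one_mem _) (by rw [one_mul]; exact ht)]

lemma cl2_Q2qi_add_one : cl2 (Q2qi q) + 1 = cl2 (Qn2q q) := by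
  have h1 := h.ext_Q2Rnq_Q2qi.ambiguous_class_number
  have h2 := h.cl2_Q2Rnq_add_one
  rw [h.rank_Q2Rnq, h.rank_Q2qi, h.ram_Q2Rnq_Q2qi, h.idx_Q2Rnq_Q2qi, h.amb_Q2Rnq_Q2qi] at h1
  omega

end PQ

end MiddleLayer

section UpperLayers

open Module IsDedekindDomain
open Complex (I)

namespace PQ

variable {p q : ℕ} (h : PQ p q)
include h

lemma sq_le_absNorm_of_rt_two {K : IntermediateField ℚ ℂ} [NumberField K] (h2 : rt 2 ∈ K)
    {P : HeightOneSpectrum (𝓞 K)} (hP : P ∈ primesAbove K p) : p ^ 2 ≤ P.asIdeal.absNorm :=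
  sq_le_absNorm_of_root h.hp hP h2 0 (-2) (by rw [rt_sq]; norm_num) fun n => by
    simpa [← sub_eq_add_neg] using h.p_two n

lemma p_not_dvd {n : ℤ} (k : ℕ) (hn : n ∣ 2 ^ k * q) : ¬ (p : ℤ) ∣ n := by
  intro h1
  have h2 : p ∣ 2 ^ k * q := by exact_mod_cast h1.trans hn
  have h8 := h.hp8
  rcases h.hp.dvd_mul.1 h2 with h3 | h3
  · have := (Nat.prime_dvd_prime_iff_eq h.hp Nat.prime_two).1 (h.hp.dvd_of_dvd_pow h3)
    omega
  · exact h.ne ((Nat.prime_dvd_prime_iff_eq h.hp h.hq).1 h3)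

lemma idx_Q2Rq_Q2pq_le : h.ext_Q2Rq_Q2pq.idx ≤ 1 := by
  have h1 := h.ext_Q2Rq_Q2pq.ambiguous_class_number
  have h2 : h.ext_Q2Rq_Q2pq.ram ≤ _ := h.ext_Q2Rq_Q2pq.ram_le h.hp.ne_zero fun P hP => by
    rcases h.hp8 with h8 | h8
    · have h1 := hP.four_mul_add_one (one_mem _) (n := p) (k := p / 4)
        (by rw [one_mul, rt_sq]; push_cast; ring) (by omega)
      exact intCast_mem_of_dvd_pow 1 h1 (by simp)
    · have h3 := hP.four_mul (one_mem _) (n := p) (by rw [one_mul, rt_sq]; push_cast; rfl)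
      obtain ⟨k, hk⟩ : ∃ k : ℤ, (p * q : ℤ) = 4 * k + 1 := by
        obtain ⟨a, ha⟩ : ∃ a : ℤ, (p : ℤ) = 8 * a + 3 := ⟨p / 8, by omega⟩
        obtain ⟨b, hb⟩ : ∃ b : ℤ, (q : ℤ) = 8 * b + 7 := ⟨q / 8, by have := h.hq8; omega⟩
        exact ⟨16 * a * b + 14 * a + 6 * b + 5, by rw [ha, hb]; ring⟩
      have h4 := hP.four_mul_add_one (b := rt q) (mem_adjoin_of_mem (by simp)) (n := p * q) (k := k)
        (by rw [mul_pow, rt_sq, rt_sq]; push_cast; ring) hk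
      push_cast at h3 h4
      refine (P.isPrime.mem_or_mem h4).elim id fun h5 => ?_
      refine (P.isPrime.mem_or_mem h3).elim (fun h6 => ?_) id
      refine (false_of_isCoprime (hP := P.isPrime) (m := 4) (n := q) (by exact_mod_cast h6)
        (by exact_mod_cast h5) ?_).elim
      have h7 := h.hq8
      exact ⟨-((q - 3) / 4 * 3 + 2), 3, by omega⟩
  have h3 := ncard_primesAbove_le (K := Q2Rq q) h.hp 1 2 (fun P hP => by rw [pow_one]; exact hP)
    fun P hP => h.sq_le_absNorm_of_rt_two (mem_adjoin_of_mem (by simp)) hP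
  rw [h.finrank_Q2Rq] at h3
  rw [h.rank_Q2Rq, h.rank_Q2pq, h.cl2_Q2Rq] at h1
  omega

lemma four_le_ncard_Q2qi : 4 ≤ (primesAbove (Q2qi q) p).ncard := by
  have hq2 := rt_sq q
  have h22 := rt_sq 2
  have hI : I ∈ Qi := mem_adjoin_of_mem rfl
  have h2m : rt 2 ∈ QiR2 := mem_adjoin_of_mem (by simp)
  push_cast at h22
  rcases h.hp8 with h8 | h8
  · have h1 := one_le_ncard_primesAbove (⊥ : IntermediateField ℚ ℂ) h.hp
    obtain ⟨n, hn⟩ := h.p_one h8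
    obtain ⟨n', hn'⟩ := h.p_two_q h8
    have h2 := h.ext_bot_Qi.two_mul_ncard_le h.hp (zero_mem _) (one_mem _) 0 1 n
      (by push_cast; linear_combination Complex.I_sq) (by simpa using hn)
      (by push_cast; linear_combination 4 * Complex.I_sq)
      (h.p_not_dvd 2 (by norm_num))
    have h3 := h.ext_Qi_QiR2.ncard_primesAbove_mono h.hp.ne_zero
    have h4 := h.ext_QiR2_Q2qi.two_mul_ncard_le h.hp (zero_mem _) h2m 0 (-(2 * q)) n'
      (by push_cast; linear_combination rt q ^ 2 * h22 + 2 * hq2)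
      (by simpa [← sub_eq_add_neg] using hn')
      (by push_cast; linear_combination 4 * rt q ^ 2 * h22 + 8 * hq2)
      (h.p_not_dvd 3 ⟨1, by ring⟩)
    omega
  · have h1 := one_le_ncard_primesAbove Qi h.hp
    obtain ⟨n, hn⟩ := h.p_neg_two h8
    obtain ⟨n', hn'⟩ := h.p_q h8
    have h2 := h.ext_Qi_QiR2.two_mul_ncard_le h.hp (zero_mem _) hI 0 2 n
      (by push_cast; linear_combination rt 2 ^ 2 * Complex.I_sq - h22) (by simpa using hn)
      (by push_cast; linear_combination 4 * rt 2 ^ 2 * Complex.I_sq - 4 * h22)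
      (h.p_not_dvd 3 (by norm_num))
    have h4 := h.ext_QiR2_Q2qi.two_mul_ncard_le h.hp (zero_mem _) (one_mem _) 0 (-q) n'
      (by push_cast; linear_combination hq2)
      (by simpa [← sub_eq_add_neg] using hn')
      (by push_cast; linear_combination 4 * hq2)
      (h.p_not_dvd 2 ⟨1, by ring⟩)
    omega

lemma cl2_Qn2q_le_amb : cl2 (Qn2q q) ≤ h.ext_Q2qi_Q2pqi.amb := by
  have h1 := h.ext_Q2qi_Q2pqi.ambiguous_class_number
  have h2 := h.four_le_ncard_Q2qi
  have h3 := h.ext_Q2qi_Q2pqi.le_ram (ℓ := p) 2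
    (fun P hP => (notMem_sq_of_le_ncard (K := Q2qi q) h.hp 2
      (fun P hP => h.sq_le_absNorm_of_rt_two (mem_adjoin_of_mem (by simp)) hP)
      (by rw [h.finrank_Q2qi]; omega) hP).1)
    fun P hP => natCast_mem_pow_of_eq h.hp hP 2 (y := rt p) (c := 1) (c' := 1) (n := 1) (n' := 1)
      (mem_adjoin_of_mem (by simp)) (one_mem _) (one_mem _) (isIntegral_rt p) isIntegral_one
      isIntegral_one (h.p_not_dvd 0 (one_dvd _)) (h.p_not_dvd 0 (one_dvd _))
      (by rw [rt_sq]; push_cast; ring) (by norm_num)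
  have h4 := h.ext_Q2qi_Q2pqi.idx_le_two h.ext_Q2Rq_Q2pq h.ext_Q2Rq_Q2qi.le h.ext_Q2pq_Q2pqi.le
    (by rw [h.rank_Q2Rq, h.rank_Q2qi]) h.idx_Q2Rq_Q2pq_le fun u hu y hy hyu => by
      rcases h.ext_Q2Rq_Q2qi.mem_or_mul_mem hy (by rw [hyu]; exact hu) with h5 | h5
      · exact ⟨y, h5, Or.inl hyu⟩
      · exact ⟨y * I, h5, Or.inr (by rw [mul_pow, hyu, Complex.I_sq]; ring)⟩
  have h5 := h.cl2_Q2qi_add_one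
  rw [h.rank_Q2qi, h.rank_Q2pqi] at h1
  omega

lemma sq_le_absNorm_Qipq {P : HeightOneSpectrum (𝓞 (Qipq p q))}
    (hP : P ∈ primesAbove (Qipq p q) 2) : 2 ^ 2 ≤ P.asIdeal.absNorm := by
  have hI : I ∈ Qipq p q := mem_adjoin_of_mem (by simp)
  have hp : rt p ∈ Qipq p q := mem_adjoin_of_mem (by simp)
  have h2 : (2 : ℂ) ∈ Qipq p q := _root_.natCast_mem (Qipq p q) 2
  have hodd : ∀ n k : ℤ, ¬ ((2 : ℕ) : ℤ) ∣ n ^ 2 + -1 * n + (2 * k + 1) := by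
    intro n k h1
    obtain ⟨c, hc⟩ := Int.even_mul_pred_self n
    obtain ⟨d, hd⟩ := h1
    have : 2 * (d - c - k) = 1 := by push_cast at hd; linarith
    omega
  rcases h.hp8 with h8 | h8
  · obtain ⟨k, hk⟩ : ∃ k : ℤ, (p : ℤ) = 8 * k + 5 := ⟨p / 8, by omega⟩
    have hkC : (p : ℂ) = 8 * k + 5 := by exact_mod_cast hk
    refine sq_le_absNorm_of_root Nat.prime_two hP (w := (1 + rt p) / 2)
      (div_mem (add_mem (one_mem _) hp) h2) (-1) (2 * (-k - 1) + 1) ?_ (hodd · _)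
    push_cast
    linear_combination (1 / 4) * rt_sq p + (1 / 4) * hkC
  · obtain ⟨k, hk⟩ : ∃ k : ℤ, (p : ℤ) = 8 * k + 3 := ⟨p / 8, by omega⟩
    have hkC : (p : ℂ) = 8 * k + 3 := by exact_mod_cast hk
    refine sq_le_absNorm_of_root Nat.prime_two hP (w := (1 + I * rt p) / 2)
      (div_mem (add_mem (one_mem _) (mul_mem hI hp)) h2) (-1) (2 * k + 1) ?_ (hodd · _)
    push_cast
    linear_combination (1 / 4) * I_mul_rt_sq p - (1 / 4) * hkC

lemma amb_Qipq_Q2pqi_le : h.ext_Qipq_Q2pqi.amb ≤ 1 := by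
  have h1 := h.ext_Qipq_Q2pqi.ambiguous_class_number
  have h2 : h.ext_Qipq_Q2pqi.ram ≤ _ := h.ext_Qipq_Q2pqi.ram_le (ℓ := 2) two_ne_zero fun P hP =>
    intCast_mem_of_dvd_pow 3 (hP.four_mul (one_mem _) (n := 2) (by rw [one_mul, rt_sq]; norm_num))
      (by norm_num)
  have h3 := ncard_primesAbove_le (K := Qipq p q) Nat.prime_two 2 2
    (fun P hP => two_mem_sq_of_I (mem_adjoin_of_mem (by simp)) hP) fun P hP => h.sq_le_absNorm_Qipq hP
  rw [h.finrank_Qipq] at h3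
  rw [h.rank_Qipq, h.rank_Q2pqi, h.cl2_Qipq] at h1
  omega

lemma isCyclic_sylow (P : Sylow 2 (ClassGroup (𝓞 (Q2pqi p q)))) : IsCyclic P :=
  h.ext_Qipq_Q2pqi.isCyclic_sylow h.cl2_Qipq h.amb_Qipq_Q2pqi_le P

lemma card_sylow (P : Sylow 2 (ClassGroup (𝓞 (Q2pqi p q)))) : Nat.card P = 2 ^ cl2 (Qn2q q) :=
  h.ext_Q2qi_Q2pqi.card_sylow _ (by have := h.cl2_Q2Rnq_add_one; have := h.one_le_cl2_Q2Rnq; omega)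
    (by have := h.cl2_Q2qi_add_one; omega) h.cl2_Qn2q_le_amb P (h.isCyclic_sylow P)

end PQ

end UpperLayers

lemma pq_of_cond {p q : ℕ} (h : Cond1 p q ∨ Cond2 p q) : PQ p q := by
  rcases h with ⟨hp, hq, h1, h2, h3, h4, h5⟩ | ⟨hp, hq, h1, h2, h3, h4, h5⟩ <;>
  · rw [jacobiSym_two_eq (by omega)] at h3 h4
    refine ⟨hp, hq, ?_, ?_, h5⟩
    · split_ifs at h3 <;> omega
    · split_ifs at h4 <;> omega

lemma k0_eq_Qn2q (q : ℕ) : k0 q = Qn2q q := by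
  rw [k0, Qn2q, rt, rt, Real.sqrt_mul (by norm_num), Nat.cast_ofNat, Complex.ofReal_mul]

lemma Lstar_eq_Q2pqi (p q : ℕ) : Lstar p q = Q2pqi p q := by
  rw [Lstar, Q2pqi, rt, rt, rt, Nat.cast_ofNat]

lemma card_sylow_eq_pow_cl2 (K : Type*) [Field K] [NumberField K]
    (Q : Sylow 2 (ClassGroup (𝓞 K))) : Nat.card Q = 2 ^ cl2 K := by
  have := Fact.mk Nat.prime_two
  exact Q.card_eq_multiplicity

lemma eq_cl2 {q m : ℕ} (hm : ∀ Q : Sylow 2 (ClassGroup (𝓞 ↥(k0 q))),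
    Nat.card ↥(Q : Subgroup (ClassGroup (𝓞 ↥(k0 q)))) = 2 ^ m) : m = cl2 (Qn2q q) := by
  rw [k0_eq_Qn2q] at hm
  have h1 := hm default
  rw [card_sylow_eq_pow_cl2] at h1
  exact (Nat.pow_right_injective le_rfl h1).symm

lemma PQ.nonempty_mulEquiv {p q : ℕ} (h : PQ p q) {L : IntermediateField ℚ ℂ}
    (hL : L = Q2pqi p q) (P : Sylow 2 (ClassGroup (𝓞 L))) :
    Nonempty (P ≃* Multiplicative (ZMod (2 ^ cl2 (Qn2q q)))) := by
  subst hL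
  rw [← h.card_sylow P]
  exact ⟨(zmodCyclicMulEquiv (h.isCyclic_sylow P)).symm⟩

theorem statement11 (p q : ℕ) (h : Cond1 p q ∨ Cond2 p q) (m : ℕ)
    (hm : ∀ Q : Sylow 2 (ClassGroup (𝓞 ↥(k0 q))),
      Nat.card ↥(Q : Subgroup (ClassGroup (𝓞 ↥(k0 q)))) = 2 ^ m)
    [NumberField ↥(Lstar p q)]
    (P : Sylow 2 (ClassGroup (𝓞 ↥(Lstar p q)))) :
    Nonempty (↥(P : Subgroup (ClassGroup (𝓞 ↥(Lstar p q)))) ≃*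
      Multiplicative (ZMod (2 ^ m))) := by
  obtain rfl := eq_cl2 hm
  exact (pq_of_cond h).nonempty_mulEquiv (Lstar_eq_Q2pqi p q) P
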